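/- arXiv:2303.02793 — 4 statements merged into one kernel-verified Lean document; each statement's English description precedes it below -/
import Mathlib

section
/- There exist polynomials p0, …, p4 ∈ ℤ[x] of degree at most 8 with p4 ≠ 0 such that p0(n)·a(2n) + p1(n)·a(2n+2) + p2(n)·a(2n+4) + p3(n)·a(2n+6) + p4(n)·a(2n+8) = 0 for all integers n ≥ 1, and there exist polynomials q0, …, q4 ∈ ℤ[x] of degree at most 10 with q4 ≠ 0 such that q0(n)·a(2n+1) + q1(n)·a(2n+3) + q2(n)·a(2n+5) + q3(n)·a(2n+7) + q4(n)·a(2n+9) = 0 for all integers n ≥ 1. -/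
/-- `a199250 n` is the number of functions `A : {1,…,n} × {1,2} → {0,1,2,3}` such
that (i) no two horizontally or vertically adjacent entries are equal, (ii) the
numbers of occurrences of any two values differ by at most `1`, and (iii) values
are introduced in row-major order (OEIS A199250). -/
noncomputable def a199250 (n : ℕ) : ℕ :=
  Nat.card {A : Fin n × Fin 2 → Fin 4 //
    (∀ i : Fin n, A (i, 0) ≠ A (i, 1)) ∧
    (∀ (i : Fin n) (j : Fin 2), ∀ h : (i : ℕ) + 1 < n,
      A (i, j) ≠ A (⟨(i : ℕ) + 1, h⟩, j)) ∧
    (∀ v w : Fin 4,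
      (Finset.filter (fun p => A p = v) Finset.univ).card ≤
        (Finset.filter (fun p => A p = w) Finset.univ).card + 1) ∧
    (∀ p : Fin n × Fin 2, 0 < (A p : ℕ) →
      ∃ q : Fin n × Fin 2,
        ((q.1 : ℕ) < (p.1 : ℕ) ∨ (q.1 = p.1 ∧ (q.2 : ℕ) < (p.2 : ℕ))) ∧
        (A q : ℕ) = (A p : ℕ) - 1)}

/-- The coefficients of `1 / (1 - s z - 7 z ^ 2)` in powers of `z`, where `s` is the sum of the six
unit translations of `ℤ³`. -/
def latticeSeries : ℕ → ℤ → ℤ → ℤ → ℤ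
  | 0, a, b, c => if a = 0 ∧ b = 0 ∧ c = 0 then 1 else 0
  | 1, a, b, c => latticeSeries 0 (a - 1) b c + latticeSeries 0 (a + 1) b c
      + latticeSeries 0 a (b - 1) c + latticeSeries 0 a (b + 1) c
      + latticeSeries 0 a b (c - 1) + latticeSeries 0 a b (c + 1)
  | n + 2, a, b, c => latticeSeries (n + 1) (a - 1) b c + latticeSeries (n + 1) (a + 1) b c
      + latticeSeries (n + 1) a (b - 1) c + latticeSeries (n + 1) a (b + 1) c
      + latticeSeries (n + 1) a b (c - 1) + latticeSeries (n + 1) a b (c + 1)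
      + 7 * latticeSeries n a b c

namespace latticeSeries

theorem neg_fst (n : ℕ) (a b c : ℤ) : latticeSeries n (-a) b c = latticeSeries n a b c := by
  induction n using Nat.twoStepInduction generalizing a b c with
  | zero => simp [latticeSeries]
  | one =>
    have h (a b c : ℤ) : latticeSeries 0 (-a) b c = latticeSeries 0 a b c := by
      simp [latticeSeries]
    simp only [latticeSeries.eq_2, ← neg_add', h, show -a + 1 = -(a - 1) by ring]
    ring
  | more n h₀ h₁ =>
    simp only [latticeSeries.eq_3, ← neg_add', h₀, h₁, show -a + 1 = -(a - 1) by ring]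
    ring

theorem swap_fst_snd (n : ℕ) (a b c : ℤ) : latticeSeries n b a c = latticeSeries n a b c := by
  induction n using Nat.twoStepInduction generalizing a b c with
  | zero => simp [latticeSeries, and_left_comm]
  | one =>
    have h (a b c : ℤ) : latticeSeries 0 b a c = latticeSeries 0 a b c := by
      simp [latticeSeries, and_left_comm]
    simp only [latticeSeries.eq_2]
    linear_combination h (a - 1) b c + h (a + 1) b c + h a (b - 1) c + h a (b + 1) c
      + h a b (c - 1) + h a b (c + 1)
  | more n h₀ h₁ =>
    simp only [latticeSeries.eq_3]
    linear_combination h₁ (a - 1) b c + h₁ (a + 1) b c + h₁ a (b - 1) c + h₁ a (b + 1) c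
      + h₁ a b (c - 1) + h₁ a b (c + 1) + 7 * h₀ a b c

theorem swap_snd_trd (n : ℕ) (a b c : ℤ) : latticeSeries n a c b = latticeSeries n a b c := by
  induction n using Nat.twoStepInduction generalizing a b c with
  | zero => simp [latticeSeries, and_comm]
  | one =>
    have h (a b c : ℤ) : latticeSeries 0 a c b = latticeSeries 0 a b c := by
      simp [latticeSeries, and_comm]
    simp only [latticeSeries.eq_2]
    linear_combination h (a - 1) b c + h (a + 1) b c + h a (b - 1) c + h a (b + 1) c
      + h a b (c - 1) + h a b (c + 1)
  | more n h₀ h₁ =>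
    simp only [latticeSeries.eq_3]
    linear_combination h₁ (a - 1) b c + h₁ (a + 1) b c + h₁ a (b - 1) c + h₁ a (b + 1) c
      + h₁ a b (c - 1) + h₁ a b (c + 1) + 7 * h₀ a b c

theorem mul_fst_zero (a b c : ℤ) : a * latticeSeries 0 a b c = 0 := by
  simp only [latticeSeries]
  split_ifs with h <;> simp [h]

theorem mul_fst_one (a b c : ℤ) :
    a * latticeSeries 1 a b c = latticeSeries 0 (a - 1) b c - latticeSeries 0 (a + 1) b c := by
  rw [latticeSeries.eq_2]
  linear_combination mul_fst_zero (a - 1) b c + mul_fst_zero (a + 1) b c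
    + mul_fst_zero a (b - 1) c + mul_fst_zero a (b + 1) c
    + mul_fst_zero a b (c - 1) + mul_fst_zero a b (c + 1)

/-- Multiplication by the first coordinate is a derivation of the convolution algebra; this is its
effect on the generating function. -/
theorem mul_fst (n : ℕ) (a b c : ℤ) :
    a * (latticeSeries (n + 2) a b c + 7 * latticeSeries n a b c) =
      (n + 2) * (latticeSeries (n + 1) (a - 1) b c - latticeSeries (n + 1) (a + 1) b c) := by
  have base (a b c : ℤ) : a * (latticeSeries 2 a b c + 7 * latticeSeries 0 a b c) =
      2 * (latticeSeries 1 (a - 1) b c - latticeSeries 1 (a + 1) b c) := by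
    rw [latticeSeries.eq_3 a b c 0]
    have f₁ := mul_fst_one (a - 1) b c
    have f₂ := mul_fst_one (a + 1) b c
    have h := mul_fst_one a
    have e₁ := latticeSeries.eq_2 (a - 1) b c
    have e₂ := latticeSeries.eq_2 (a + 1) b c
    simp only [sub_add_cancel, add_sub_cancel_right] at *
    linear_combination f₁ + f₂ + h (b - 1) c + h (b + 1) c + h b (c - 1) + h b (c + 1)
      + 14 * mul_fst_zero a b c - e₁ + e₂
  induction n using Nat.twoStepInduction generalizing a b c with
  | zero => simpa using base a b c
  | one =>
    have f₁ := base (a - 1) b c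
    have f₂ := base (a + 1) b c
    have h := base a
    have e := latticeSeries.eq_3 a b c 1
    have e₁ := latticeSeries.eq_3 (a - 1) b c 0
    have e₂ := latticeSeries.eq_3 (a + 1) b c 0
    have e₃ := latticeSeries.eq_2 a b c
    norm_num only [sub_add_cancel, add_sub_cancel_right] at *
    linear_combination f₁ + f₂ + h (b - 1) c + h (b + 1) c + h b (c - 1) + h b (c + 1)
      + a * e - 2 * e₁ + 2 * e₂
      + 7 * mul_fst_one a b c + 7 * a * e₃
  | more n h₀ h₁ =>
    have f₁ := h₁ (a - 1) b c
    have f₂ := h₁ (a + 1) b c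
    have h := h₁ a
    have e := latticeSeries.eq_3 a b c (n + 2)
    have e₁ := latticeSeries.eq_3 (a - 1) b c (n + 1)
    have e₂ := latticeSeries.eq_3 (a + 1) b c (n + 1)
    have e₃ := latticeSeries.eq_3 a b c n
    simp only [sub_add_cancel, add_sub_cancel_right, add_assoc, Nat.reduceAdd, Nat.cast_add,
      Nat.cast_one, Nat.cast_ofNat] at *
    linear_combination f₁ + f₂ + h (b - 1) c + h (b + 1) c + h b (c - 1) + h b (c + 1)
      + a * e - (n + 3) * e₁ + (n + 3) * e₂
      + 7 * h₀ a b c + 7 * a * e₃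

theorem rec_zero (n : ℕ) :
    latticeSeries (n + 2) 0 0 0 =
      6 * latticeSeries (n + 1) 1 0 0 + 7 * latticeSeries n 0 0 0 := by
  have h := latticeSeries.eq_3 0 0 0 n
  have h₁ := neg_fst (n + 1) 1 0 0
  have h₂ := swap_fst_snd (n + 1) 1 0 0
  have h₃ := swap_fst_snd (n + 1) (-1) 0 0
  have h₄ := swap_snd_trd (n + 1) 0 1 0
  have h₅ := swap_snd_trd (n + 1) 0 (-1) 0
  norm_num only at h h₁ h₂ h₃ h₄ h₅
  linarith

theorem rec_one (n : ℕ) :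
    (n + 3 : ℤ) * latticeSeries (n + 2) 1 0 0 =
      (n + 2) * (2 * latticeSeries (n + 1) 0 0 0 + 4 * latticeSeries (n + 1) 1 1 0)
        + 7 * (n + 1) * latticeSeries n 1 0 0 := by
  have h := latticeSeries.eq_3 1 0 0 n
  have hd := mul_fst n 1 0 0
  have h₁ := neg_fst (n + 1) 1 1 0
  have h₂ := swap_fst_snd (n + 1) 1 (-1) 0
  have h₄ := swap_snd_trd (n + 1) 1 1 0
  have h₅ := swap_snd_trd (n + 1) 1 (-1) 0
  norm_num only at h hd h₁ h₂ h₄ h₅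
  linear_combination (n + 2 : ℤ) * (h + h₄ + h₅ + 2 * (h₁ - h₂)) + hd

theorem rec_two (n : ℕ) :
    (n + 4 : ℤ) * latticeSeries (n + 2) 1 1 0 =
      (n + 2) * (4 * latticeSeries (n + 1) 1 0 0 + 2 * latticeSeries (n + 1) 1 1 1)
        + 7 * n * latticeSeries n 1 1 0 := by
  have h := latticeSeries.eq_3 1 1 0 n
  have hd := mul_fst n 1 1 0
  have h₁ := swap_fst_snd (n + 1) 2 1 0
  have h₂ := swap_fst_snd (n + 1) 1 0 0
  have h₃ := swap_snd_trd (n + 1) 1 (-1) 1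
  have h₄ := swap_fst_snd (n + 1) (-1) 1 1
  have h₅ := neg_fst (n + 1) 1 1 1
  norm_num only at h hd h₁ h₂ h₃ h₄ h₅
  linear_combination (n + 2 : ℤ) * (h + h₁ + 3 * h₂ + h₃ + h₄ + h₅) + 2 * hd

theorem rec_three (n : ℕ) :
    (n + 5 : ℤ) * latticeSeries (n + 2) 1 1 1 =
      6 * (n + 2) * latticeSeries (n + 1) 1 1 0 + 7 * (n - 1) * latticeSeries n 1 1 1 := by
  have h := latticeSeries.eq_3 1 1 1 n
  have hd := mul_fst n 1 1 1
  have h₁ := swap_fst_snd (n + 1) 2 1 1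
  have h₂ := swap_snd_trd (n + 1) 1 2 1
  have h₃ := swap_snd_trd (n + 1) 1 1 0
  have h₄ := swap_fst_snd (n + 1) 1 0 1
  norm_num only at h hd h₁ h₂ h₃ h₄
  linear_combination (n + 2 : ℤ) * (h + 2 * h₁ + h₂ + 5 * h₃ + 4 * h₄) + 3 * hd

end latticeSeries

/-- The signs with which the four colours contribute to the `j`-th coordinate of the walk on `ℤ³`
attached to a colouring. -/
def colorSign (j : Fin 3) (v : Fin 4) : ℤ := !![1, 1, -1, -1; 1, -1, 1, -1; 1, -1, -1, 1] j v

/-- The step of the walk on `ℤ³` made by a row with two distinct colours. -/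
def rowStep (j : Fin 3) (r : Fin 4 × Fin 4) : ℤ := (colorSign j r.1 + colorSign j r.2) / 2

/-- The rows `f` form a proper colouring whose walk ends at `(a, b, c)`. -/
def IsWalkColoring {n : ℕ} (f : Fin n → Fin 4 × Fin 4) (a b c : ℤ) : Prop :=
  (∀ i, (f i).1 ≠ (f i).2) ∧
  (∀ (i : Fin n) (h : (i : ℕ) + 1 < n),
    (f i).1 ≠ (f ⟨i + 1, h⟩).1 ∧ (f i).2 ≠ (f ⟨i + 1, h⟩).2) ∧
  2 * a = ∑ i, (colorSign 0 (f i).1 + colorSign 0 (f i).2) ∧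
  2 * b = ∑ i, (colorSign 1 (f i).1 + colorSign 1 (f i).2) ∧
  2 * c = ∑ i, (colorSign 2 (f i).1 + colorSign 2 (f i).2)

theorem two_mul_rowStep (j : Fin 3) (r : Fin 4 × Fin 4) (h : r.1 ≠ r.2) :
    2 * rowStep j r = colorSign j r.1 + colorSign j r.2 := by
  revert j r
  decide

theorem isWalkColoring_cons {n : ℕ} (r : Fin 4 × Fin 4) (g : Fin (n + 1) → Fin 4 × Fin 4)
    (a b c : ℤ) :
    IsWalkColoring (Fin.cons r g : Fin (n + 2) → Fin 4 × Fin 4) a b c ↔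
      (r.1 ≠ r.2 ∧ r.1 ≠ (g 0).1 ∧ r.2 ≠ (g 0).2) ∧
        IsWalkColoring g (a - rowStep 0 r) (b - rowStep 1 r) (c - rowStep 2 r) := by
  by_cases hr : r.1 = r.2
  · refine iff_of_false (fun h => h.1 0 (by simpa using hr)) (fun h => h.1.1 hr)
  have h₀ := two_mul_rowStep 0 r hr
  have h₁ := two_mul_rowStep 1 r hr
  have h₂ := two_mul_rowStep 2 r hr
  have key : (∀ (i : Fin (n + 2)) (h : (i : ℕ) + 1 < n + 2),
      ((Fin.cons r g : Fin (n + 2) → Fin 4 × Fin 4) i).1 ≠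
        ((Fin.cons r g : Fin (n + 2) → Fin 4 × Fin 4) ⟨i + 1, h⟩).1 ∧
      ((Fin.cons r g : Fin (n + 2) → Fin 4 × Fin 4) i).2 ≠
        ((Fin.cons r g : Fin (n + 2) → Fin 4 × Fin 4) ⟨i + 1, h⟩).2) ↔
      (r.1 ≠ (g 0).1 ∧ r.2 ≠ (g 0).2) ∧
      (∀ (i : Fin (n + 1)) (h : (i : ℕ) + 1 < n + 1),
        (g i).1 ≠ (g ⟨i + 1, h⟩).1 ∧ (g i).2 ≠ (g ⟨i + 1, h⟩).2) := by
    rw [Fin.forall_fin_succ]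
    refine and_congr ?_ (forall_congr' fun i => ?_)
    · exact ⟨fun h => h (by simp), fun h _ => h⟩
    · exact ⟨fun h hi => h (by simpa using hi), fun h hi => h (by simpa using hi)⟩
  unfold IsWalkColoring
  rw [key, Fin.forall_fin_succ]
  simp only [Fin.sum_univ_succ (n := n + 1), Fin.cons_zero, Fin.cons_succ, ne_eq, hr,
    not_false_eq_true, true_and]
  constructor
  · rintro ⟨hv, ⟨hadj, hg⟩, ha, hb, hc⟩
    exact ⟨hadj, hv, hg, by linarith, by linarith, by linarith⟩
  · rintro ⟨hadj, hv, hg, ha, hb, hc⟩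
    exact ⟨hv, ⟨hadj, hg⟩, by linarith, by linarith, by linarith⟩

open Classical in
/-- The number of proper colourings of `n + 1` rows with first row `r` whose walk ends at
`(a, b, c)`. -/
noncomputable def walkCount (n : ℕ) (r : Fin 4 × Fin 4) (a b c : ℤ) : ℤ :=
  ∑ f : Fin (n + 1) → Fin 4 × Fin 4, if f 0 = r ∧ IsWalkColoring f a b c then 1 else 0

open Classical in
theorem walkCount_zero (r : Fin 4 × Fin 4) (a b c : ℤ) :
    walkCount 0 r a b c =
      if r.1 ≠ r.2 ∧ a = rowStep 0 r ∧ b = rowStep 1 r ∧ c = rowStep 2 r then 1 else 0 := by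
  unfold walkCount
  rw [Finset.sum_eq_single (fun _ => r)]
  · refine if_congr ?_ rfl rfl
    by_cases hr : r.1 = r.2
    · simp [IsWalkColoring, hr]
    have h₀ := two_mul_rowStep 0 r hr
    have h₁ := two_mul_rowStep 1 r hr
    have h₂ := two_mul_rowStep 2 r hr
    simp only [IsWalkColoring, ← h₀, ← h₁, ← h₂]
    simp [hr]
  · intro f _ hf
    rw [if_neg]
    rintro ⟨h, -⟩
    exact hf (funext fun i => by rw [Fin.fin_one_eq_zero i, h])
  · simp

open Classical in
theorem walkCount_succ (n : ℕ) (r : Fin 4 × Fin 4) (a b c : ℤ) :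
    walkCount (n + 1) r a b c =
      ∑ r' : Fin 4 × Fin 4, if r.1 ≠ r.2 ∧ r.1 ≠ r'.1 ∧ r.2 ≠ r'.2 then
        walkCount n r' (a - rowStep 0 r) (b - rowStep 1 r) (c - rowStep 2 r) else 0 := by
  have h : walkCount (n + 1) r a b c = ∑ g : Fin (n + 1) → Fin 4 × Fin 4,
      if (r.1 ≠ r.2 ∧ r.1 ≠ (g 0).1 ∧ r.2 ≠ (g 0).2) ∧
        IsWalkColoring g (a - rowStep 0 r) (b - rowStep 1 r) (c - rowStep 2 r) then 1 else 0 := by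
    unfold walkCount
    rw [← (Fin.consEquiv fun _ : Fin (n + 2) => Fin 4 × Fin 4).sum_comp, Fintype.sum_prod_type,
      Finset.sum_eq_single r]
    · simp only [Fin.consEquiv_apply, Fin.cons_zero, true_and]
      exact Finset.sum_congr rfl fun g _ => if_congr (isWalkColoring_cons r g a b c) rfl rfl
    · intro r' _ hr'
      simp [Fin.consEquiv_apply, hr']
    · simp
  rw [h]
  unfold walkCount
  have h' (p : Prop) [Decidable p] (s : (Fin (n + 1) → Fin 4 × Fin 4) → ℤ) :
      (if p then ∑ g, s g else 0) = ∑ g, if p then s g else 0 := by split_ifs <;> simp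
  simp only [h']
  rw [Finset.sum_comm]
  refine Finset.sum_congr rfl fun g _ => ?_
  rw [Finset.sum_eq_single (g 0)]
  · by_cases hg : r.1 ≠ r.2 ∧ r.1 ≠ (g 0).1 ∧ r.2 ≠ (g 0).2 <;> simp [hg]
  · intro r' _ hr'
    simp [hr'.symm]
  · simp

theorem walkCount_diag (n : ℕ) (x : Fin 4) (a b c : ℤ) : walkCount n (x, x) a b c = 0 := by
  cases n <;> simp [walkCount_zero, walkCount_succ]

theorem rowStep_swap (j : Fin 3) (r : Fin 4 × Fin 4) : rowStep j r.swap = rowStep j r := by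
  simp [rowStep, add_comm]

theorem walkCount_swap (n : ℕ) (r : Fin 4 × Fin 4) (a b c : ℤ) :
    walkCount n r.swap a b c = walkCount n r a b c := by
  induction n generalizing r a b c with
  | zero => simp only [walkCount_zero, rowStep_swap, Prod.fst_swap, Prod.snd_swap, ne_comm]
  | succ n ih =>
    rw [walkCount_succ, walkCount_succ, ← (Equiv.prodComm (Fin 4) (Fin 4)).sum_comp]
    refine Finset.sum_congr rfl fun r' _ => ?_
    simp only [Equiv.prodComm_apply, rowStep_swap, Prod.fst_swap, Prod.snd_swap, ih]
    refine if_congr ?_ rfl rfl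
    tauto

/-- Half the number of proper colourings of `n + 1` rows whose walk ends at `(a, b, c)`. -/
noncomputable def halfWalkCount (n : ℕ) (a b c : ℤ) : ℤ :=
  walkCount n (0, 1) a b c + walkCount n (0, 2) a b c + walkCount n (0, 3) a b c
    + walkCount n (1, 2) a b c + walkCount n (1, 3) a b c + walkCount n (2, 3) a b c

theorem sum_walkCount (n : ℕ) (a b c : ℤ) :
    ∑ r, walkCount n r a b c = 2 * halfWalkCount n a b c := by
  have h (x y : Fin 4) : walkCount n (y, x) a b c = walkCount n (x, y) a b c :=
    walkCount_swap n (x, y) a b c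
  rw [Fintype.sum_prod_type]
  simp only [Fin.sum_univ_four, walkCount_diag, h 0 1, h 0 2, h 0 3, h 1 2, h 1 3, h 2 3,
    halfWalkCount]
  ring

/-- A row is followed in one way by each of the six pairs of colours, except by the complementary
pair, by which it is followed in two ways. -/
theorem walkCount_succ_eq (n : ℕ) (a b c : ℤ) :
    walkCount (n + 1) (0, 1) a b c =
      halfWalkCount n (a - 1) b c + walkCount n (2, 3) (a - 1) b c ∧
    walkCount (n + 1) (2, 3) a b c =
      halfWalkCount n (a + 1) b c + walkCount n (0, 1) (a + 1) b c ∧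
    walkCount (n + 1) (0, 2) a b c =
      halfWalkCount n a (b - 1) c + walkCount n (1, 3) a (b - 1) c ∧
    walkCount (n + 1) (1, 3) a b c =
      halfWalkCount n a (b + 1) c + walkCount n (0, 2) a (b + 1) c ∧
    walkCount (n + 1) (0, 3) a b c =
      halfWalkCount n a b (c - 1) + walkCount n (1, 2) a b (c - 1) ∧
    walkCount (n + 1) (1, 2) a b c =
      halfWalkCount n a b (c + 1) + walkCount n (0, 3) a b (c + 1) := by
  have h (x y : Fin 4) (a b c : ℤ) : walkCount n (y, x) a b c = walkCount n (x, y) a b c :=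
    walkCount_swap n (x, y) a b c
  simp only [walkCount_succ, Fintype.sum_prod_type, Fin.sum_univ_four, walkCount_diag,
    h 0 1, h 0 2, h 0 3, h 1 2, h 1 3, h 2 3, halfWalkCount]
  simp [rowStep, colorSign]
  refine ⟨?_, ?_, ?_, ?_, ?_, ?_⟩ <;> ring

theorem halfWalkCount_zero (a b c : ℤ) : halfWalkCount 0 a b c = latticeSeries 1 a b c := by
  simp [halfWalkCount, walkCount_zero, rowStep, colorSign, latticeSeries, sub_eq_zero,
    eq_neg_iff_add_eq_zero]
  ring

theorem halfWalkCount_add_two (n : ℕ) (a b c : ℤ) :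
    halfWalkCount (n + 2) a b c =
      halfWalkCount (n + 1) (a - 1) b c + halfWalkCount (n + 1) (a + 1) b c
      + halfWalkCount (n + 1) a (b - 1) c + halfWalkCount (n + 1) a (b + 1) c
      + halfWalkCount (n + 1) a b (c - 1) + halfWalkCount (n + 1) a b (c + 1)
      + 7 * halfWalkCount n a b c := by
  have h := walkCount_succ_eq n
  conv_lhs => rw [halfWalkCount]
  obtain ⟨h₁, h₂, h₃, h₄, h₅, h₆⟩ := walkCount_succ_eq (n + 1) a b c
  rw [h₁, h₂, h₃, h₄, h₅, h₆, (h (a - 1) b c).2.1, (h (a + 1) b c).1, (h a (b - 1) c).2.2.2.1,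
    (h a (b + 1) c).2.2.1, (h a b (c - 1)).2.2.2.2.2, (h a b (c + 1)).2.2.2.2.1]
  simp only [sub_add_cancel, add_sub_cancel_right]
  linear_combination -halfWalkCount.eq_1 n a b c

theorem halfWalkCount_one (a b c : ℤ) :
    halfWalkCount 1 a b c = latticeSeries 2 a b c - latticeSeries 0 a b c := by
  have h : walkCount 0 (2, 3) (a - 1) b c = latticeSeries 0 a b c ∧
      walkCount 0 (0, 1) (a + 1) b c = latticeSeries 0 a b c ∧
      walkCount 0 (1, 3) a (b - 1) c = latticeSeries 0 a b c ∧
      walkCount 0 (0, 2) a (b + 1) c = latticeSeries 0 a b c ∧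
      walkCount 0 (1, 2) a b (c - 1) = latticeSeries 0 a b c ∧
      walkCount 0 (0, 3) a b (c + 1) = latticeSeries 0 a b c := by
    simp [walkCount_zero, rowStep, colorSign, latticeSeries, sub_eq_iff_eq_add]
  obtain ⟨e₁, e₂, e₃, e₄, e₅, e₆⟩ := h
  obtain ⟨h₁, h₂, h₃, h₄, h₅, h₆⟩ := walkCount_succ_eq 0 a b c
  rw [zero_add] at h₁ h₂ h₃ h₄ h₅ h₆
  rw [halfWalkCount, h₁, h₂, h₃, h₄, h₅, h₆, e₁, e₂, e₃, e₄, e₅, e₆, latticeSeries.eq_3]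
  simp only [halfWalkCount_zero]
  ring

theorem halfWalkCount_succ (n : ℕ) (a b c : ℤ) :
    halfWalkCount (n + 1) a b c = latticeSeries (n + 2) a b c - latticeSeries n a b c := by
  induction n using Nat.twoStepInduction generalizing a b c with
  | zero => exact halfWalkCount_one a b c
  | one =>
    rw [halfWalkCount_add_two, latticeSeries.eq_3 a b c 1, latticeSeries.eq_2 a b c]
    simp only [zero_add, halfWalkCount_one, halfWalkCount_zero, Nat.reduceAdd]
    rw [latticeSeries.eq_2 a b c]
    ring
  | more n h₀ h₁ =>
    rw [halfWalkCount_add_two]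
    simp only [h₀, h₁]
    linear_combination latticeSeries.eq_3 a b c n - latticeSeries.eq_3 a b c (n + 2)

/-- No two adjacent cells have the same colour. -/
def IsProper {n : ℕ} (A : Fin n × Fin 2 → Fin 4) : Prop :=
  (∀ i : Fin n, A (i, 0) ≠ A (i, 1)) ∧
  (∀ (i : Fin n) (j : Fin 2), ∀ h : (i : ℕ) + 1 < n, A (i, j) ≠ A (⟨(i : ℕ) + 1, h⟩, j))

/-- Any two colours occur equally often, up to a difference of one. -/
def IsBalanced {n : ℕ} (A : Fin n × Fin 2 → Fin 4) : Prop :=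
  ∀ v w : Fin 4, (Finset.filter (fun p => A p = v) Finset.univ).card ≤
    (Finset.filter (fun p => A p = w) Finset.univ).card + 1

/-- The number of cells preceding `p` in row-major order. -/
def rowMajor {n : ℕ} (p : Fin n × Fin 2) : ℕ := 2 * p.1 + p.2

/-- The row-major position of the first occurrence of the colour `v`. -/
noncomputable def firstOcc {n : ℕ} (A : Fin n × Fin 2 → Fin 4) (v : Fin 4) : ℕ :=
  sInf (rowMajor '' {p | A p = v})

theorem rowMajor_lt {n : ℕ} (p q : Fin n × Fin 2) :
    rowMajor q < rowMajor p ↔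
      (q.1 : ℕ) < (p.1 : ℕ) ∨ (q.1 = p.1 ∧ (q.2 : ℕ) < (p.2 : ℕ)) := by
  simp only [rowMajor, Fin.ext_iff]
  omega

theorem rowMajor_injective {n : ℕ} : Function.Injective (rowMajor (n := n)) := by
  intro p q h
  simp only [rowMajor] at h
  ext <;> omega

section firstOcc

variable {n : ℕ} {A : Fin n × Fin 2 → Fin 4}

theorem firstOcc_le (p : Fin n × Fin 2) : firstOcc A (A p) ≤ rowMajor p :=
  Nat.sInf_le ⟨p, rfl, rfl⟩

theorem exists_firstOcc (hA : Function.Surjective A) (v : Fin 4) :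
    ∃ p, A p = v ∧ rowMajor p = firstOcc A v := by
  obtain ⟨p, hp⟩ := hA v
  exact Nat.sInf_mem (s := rowMajor '' {p | A p = v}) ⟨_, p, hp, rfl⟩

theorem firstOcc_injective (hA : Function.Surjective A) : Function.Injective (firstOcc A) := by
  intro v w h
  obtain ⟨p, rfl, hp⟩ := exists_firstOcc hA v
  obtain ⟨q, rfl, hq⟩ := exists_firstOcc hA w
  rw [rowMajor_injective (hp.trans (h.trans hq.symm))]

theorem firstOcc_perm (σ : Equiv.Perm (Fin 4)) : firstOcc (σ.symm ∘ A) = firstOcc A ∘ σ := by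
  ext v
  simp [firstOcc, Equiv.symm_apply_eq]

/-- Colours are introduced in row-major order iff their first occurrences are in increasing
order. -/
theorem strictMono_firstOcc_iff (hA : Function.Surjective A) :
    StrictMono (firstOcc A) ↔ ∀ p : Fin n × Fin 2, 0 < (A p : ℕ) →
      ∃ q : Fin n × Fin 2,
        ((q.1 : ℕ) < (p.1 : ℕ) ∨ (q.1 = p.1 ∧ (q.2 : ℕ) < (p.2 : ℕ))) ∧
        (A q : ℕ) = (A p : ℕ) - 1 := by
  simp only [← rowMajor_lt]
  constructor
  · intro h p hp
    obtain ⟨q, hq, hq'⟩ := exists_firstOcc hA ⟨(A p : ℕ) - 1, by omega⟩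
    refine ⟨q, ?_, by rw [hq]⟩
    rw [hq']
    refine (h ?_).trans_le (firstOcc_le p)
    rw [Fin.lt_def]
    simp only
    omega
  · intro h
    rw [Fin.strictMono_iff_lt_succ]
    intro i
    obtain ⟨p, hp, hp'⟩ := exists_firstOcc hA i.succ
    obtain ⟨q, hq, hq'⟩ := h p (by simp [hp])
    rw [← hp']
    have : A q = i.castSucc := by ext; simp [hq', hp]
    rw [← this]
    exact (firstOcc_le q).trans_lt hq

end firstOcc

theorem sum_card_color {n : ℕ} (A : Fin n × Fin 2 → Fin 4) :
    ∑ v, (Finset.filter (fun p => A p = v) Finset.univ).card = 2 * n := by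
  rw [← Finset.card_eq_sum_card_fiberwise (fun _ _ => Finset.mem_coe.2 (Finset.mem_univ _))]
  simp [mul_comm]

theorem IsBalanced.surjective {n : ℕ} (hn : 2 ≤ n) {A : Fin n × Fin 2 → Fin 4}
    (h : IsBalanced A) : Function.Surjective A := by
  intro v
  have hs := sum_card_color A
  rw [Fin.sum_univ_four] at hs
  have h₀ := h 0 v
  have h₁ := h 1 v
  have h₂ := h 2 v
  have h₃ := h 3 v
  have hv : 0 < (Finset.filter (fun p => A p = v) Finset.univ).card := by
    fin_cases v <;> simp only [Fin.zero_eta, Fin.mk_one, Fin.reduceFinMk] at * <;> omega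
  obtain ⟨p, hp⟩ := Finset.card_pos.1 hv
  exact ⟨p, (Finset.mem_filter.1 hp).2⟩

theorem isProper_perm {n : ℕ} (σ : Equiv.Perm (Fin 4)) (A : Fin n × Fin 2 → Fin 4) :
    IsProper (σ ∘ A) ↔ IsProper A := by
  simp [IsProper]

theorem isBalanced_perm {n : ℕ} (σ : Equiv.Perm (Fin 4)) (A : Fin n × Fin 2 → Fin 4) :
    IsBalanced (σ ∘ A) ↔ IsBalanced A := by
  simp only [IsBalanced, Function.comp_apply, ← Equiv.eq_symm_apply]
  exact σ.symm.forall_congr fun v => σ.symm.forall_congr fun w => Iff.rfl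

theorem existsUnique_strictMono_comp_perm {m : ℕ} {f : Fin m → ℕ} (hf : Function.Injective f) :
    ∃! σ : Equiv.Perm (Fin m), StrictMono (f ∘ σ) := by
  refine ⟨Tuple.sort f, (Tuple.monotone_sort f).strictMono_of_injective
    (hf.comp (Tuple.sort f).injective), fun σ hσ => ?_⟩
  have := Tuple.unique_monotone hσ.monotone (Tuple.monotone_sort f)
  exact Equiv.ext fun i => hf (congrFun this i)

theorem card_isProper_isBalanced {n : ℕ} (hn : 2 ≤ n) :
    Nat.card {A : Fin n × Fin 2 → Fin 4 // IsProper A ∧ IsBalanced A} = 24 * a199250 n := by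
  classical
  have h (σ : Equiv.Perm (Fin 4)) : a199250 n =
      Finset.card {A : Fin n × Fin 2 → Fin 4 |
        (IsProper A ∧ IsBalanced A) ∧ StrictMono (firstOcc A ∘ σ)} := by
    rw [← Fintype.card_subtype, ← Nat.card_eq_fintype_card]
    refine Nat.card_congr ((Equiv.arrowCongr (Equiv.refl _) σ).subtypeEquiv fun A => ?_)
    have hσ : (Equiv.arrowCongr (Equiv.refl _) σ) A = σ ∘ A := rfl
    have hA : A = σ.symm ∘ (σ ∘ A) := by ext; simp
    rw [hσ, isProper_perm, isBalanced_perm, ← firstOcc_perm, ← hA, and_assoc, IsProper, and_assoc]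
    refine and_congr_right fun _ => and_congr_right fun _ => and_congr_right fun hb => ?_
    exact (strictMono_firstOcc_iff (IsBalanced.surjective hn hb)).symm
  have key : Nat.card {A : Fin n × Fin 2 → Fin 4 // IsProper A ∧ IsBalanced A} =
      ∑ σ : Equiv.Perm (Fin 4), Finset.card {A : Fin n × Fin 2 → Fin 4 |
        (IsProper A ∧ IsBalanced A) ∧ StrictMono (firstOcc A ∘ σ)} := by
    rw [Nat.card_eq_fintype_card, Fintype.card_subtype]
    simp only [Finset.card_filter]
    rw [Finset.sum_comm]
    refine Finset.sum_congr rfl fun A _ => ?_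
    by_cases hA : IsProper A ∧ IsBalanced A
    · obtain ⟨σ, hσ, huniq⟩ :=
        existsUnique_strictMono_comp_perm (firstOcc_injective (hA.2.surjective hn))
      rw [Finset.sum_eq_single σ]
      · simp [hA, hσ]
      · intro τ _ hτ
        exact if_neg fun h => hτ (huniq τ h.2)
      · simp
    · simp [hA]
  rw [key, Finset.sum_congr rfl fun σ _ => (h σ).symm]
  simp [Fintype.card_perm, Nat.factorial]

theorem card_isProper_and {n : ℕ} (P : (Fin n → Fin 4 × Fin 4) → Prop) [DecidablePred P]
    (h : ∀ A : Fin n × Fin 2 → Fin 4,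
      IsProper A ∧ IsBalanced A ↔ P fun i => (A (i, 0), A (i, 1))) :
    (Nat.card {A : Fin n × Fin 2 → Fin 4 // IsProper A ∧ IsBalanced A} : ℤ) =
      ∑ f, if P f then 1 else 0 := by
  let e : (Fin n × Fin 2 → Fin 4) ≃ (Fin n → Fin 4 × Fin 4) :=
    (Equiv.curry _ _ _).trans (Equiv.arrowCongr (Equiv.refl _) (finTwoArrowEquiv _))
  have he : Nat.card {A : Fin n × Fin 2 → Fin 4 // IsProper A ∧ IsBalanced A} =
      Nat.card {f // P f} := Nat.card_congr (e.subtypeEquiv h)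
  rw [he, Nat.card_eq_fintype_card, Fintype.card_subtype, Finset.sum_boole]

theorem sum_colorSign {n : ℕ} (A : Fin n × Fin 2 → Fin 4) (j : Fin 3) :
    ∑ i, (colorSign j (A (i, 0)) + colorSign j (A (i, 1))) =
      ∑ v, (Finset.filter (fun p => A p = v) Finset.univ).card * colorSign j v := by
  have h : ∑ p, colorSign j (A p) = ∑ i, (colorSign j (A (i, 0)) + colorSign j (A (i, 1))) := by
    rw [Fintype.sum_prod_type]
    simp
  rw [← h, ← Finset.sum_fiberwise _ A]
  refine Finset.sum_congr rfl fun v _ => ?_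
  rw [Finset.sum_congr rfl fun p hp => by rw [(Finset.mem_filter.1 hp).2]]
  simp

theorem isWalkColoring_rows {n : ℕ} (A : Fin n × Fin 2 → Fin 4) (a b c : ℤ) :
    IsWalkColoring (fun i => (A (i, 0), A (i, 1))) a b c ↔ IsProper A ∧
      2 * a = ∑ v, (Finset.filter (fun p => A p = v) Finset.univ).card * colorSign 0 v ∧
      2 * b = ∑ v, (Finset.filter (fun p => A p = v) Finset.univ).card * colorSign 1 v ∧
      2 * c = ∑ v, (Finset.filter (fun p => A p = v) Finset.univ).card * colorSign 2 v := by
  simp only [IsWalkColoring, IsProper, sum_colorSign, Fin.forall_fin_two, forall_and, and_assoc]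

open Classical in
theorem sum_isWalkColoring (n : ℕ) (a b c : ℤ) :
    (∑ f : Fin (n + 1) → Fin 4 × Fin 4, if IsWalkColoring f a b c then (1 : ℤ) else 0) =
      2 * halfWalkCount n a b c := by
  rw [← sum_walkCount]
  unfold walkCount
  rw [Finset.sum_comm]
  refine Finset.sum_congr rfl fun f _ => ?_
  rw [Finset.sum_eq_single (f 0)]
  · simp
  · intro r _ hr
    simp [hr.symm]
  · simp

theorem IsWalkColoring.unique {n : ℕ} {f : Fin n → Fin 4 × Fin 4} {a b c a' b' c' : ℤ}
    (h : IsWalkColoring f a b c) (h' : IsWalkColoring f a' b' c') : a = a' ∧ b = b' ∧ c = c' := by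
  obtain ⟨-, -, ha, hb, hc⟩ := h
  obtain ⟨-, -, ha', hb', hc'⟩ := h'
  omega

theorem isBalanced_iff_of_even {n : ℕ} (hn : Even n) (A : Fin n × Fin 2 → Fin 4) :
    IsProper A ∧ IsBalanced A ↔ IsWalkColoring (fun i => (A (i, 0), A (i, 1))) 0 0 0 := by
  have hs := sum_card_color A
  rw [isWalkColoring_rows]
  refine and_congr_right fun _ => ?_
  simp only [IsBalanced, Fin.forall_fin_succ, IsEmpty.forall_iff, Fin.sum_univ_four] at hs ⊢
  simp [colorSign] at hs ⊢
  obtain ⟨k, rfl⟩ := hn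
  generalize (Finset.filter (fun p => A p = 0) Finset.univ).card = d₀ at *
  generalize (Finset.filter (fun p => A p = 1) Finset.univ).card = d₁ at *
  generalize (Finset.filter (fun p => A p = 2) Finset.univ).card = d₂ at *
  generalize (Finset.filter (fun p => A p = 3) Finset.univ).card = d₃ at *
  constructor
  · intro h
    have h₀ : d₀ = k := by omega
    have h₁ : d₁ = k := by omega
    have h₂ : d₂ = k := by omega
    omega
  · intro h
    omega

theorem isBalanced_iff_of_odd {n : ℕ} (hn : Odd n) (A : Fin n × Fin 2 → Fin 4) :
    IsProper A ∧ IsBalanced A ↔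
      IsWalkColoring (fun i => (A (i, 0), A (i, 1))) 1 0 0 ∨
      IsWalkColoring (fun i => (A (i, 0), A (i, 1))) (-1) 0 0 ∨
      IsWalkColoring (fun i => (A (i, 0), A (i, 1))) 0 1 0 ∨
      IsWalkColoring (fun i => (A (i, 0), A (i, 1))) 0 (-1) 0 ∨
      IsWalkColoring (fun i => (A (i, 0), A (i, 1))) 0 0 1 ∨
      IsWalkColoring (fun i => (A (i, 0), A (i, 1))) 0 0 (-1) := by
  have hs := sum_card_color A
  simp only [isWalkColoring_rows, ← and_or_left]
  refine and_congr_right fun _ => ?_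
  simp only [IsBalanced, Fin.forall_fin_succ, IsEmpty.forall_iff, Fin.sum_univ_four] at hs ⊢
  simp [colorSign] at hs ⊢
  obtain ⟨k, rfl⟩ := hn
  generalize (Finset.filter (fun p => A p = 0) Finset.univ).card = d₀ at *
  generalize (Finset.filter (fun p => A p = 1) Finset.univ).card = d₁ at *
  generalize (Finset.filter (fun p => A p = 2) Finset.univ).card = d₂ at *
  generalize (Finset.filter (fun p => A p = 3) Finset.univ).card = d₃ at *
  constructor
  · intro h
    have h₀ : d₀ = k ∨ d₀ = k + 1 := by omega
    have h₁ : d₁ = k ∨ d₁ = k + 1 := by omega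
    have h₂ : d₂ = k ∨ d₂ = k + 1 := by omega
    rcases h₀ with rfl | rfl <;> rcases h₁ with rfl | rfl <;> rcases h₂ with rfl | rfl <;> omega
  · intro h
    omega

theorem a199250_even (k : ℕ) :
    12 * (a199250 (2 * k + 2) : ℤ) =
      latticeSeries (2 * k + 2) 0 0 0 - latticeSeries (2 * k) 0 0 0 := by
  classical
  have h := card_isProper_and (fun f => IsWalkColoring f 0 0 0)
    (isBalanced_iff_of_even (n := 2 * k + 1 + 1) ⟨k + 1, by ring⟩)
  rw [sum_isWalkColoring, halfWalkCount_succ, card_isProper_isBalanced (by omega)] at h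
  push_cast at h
  linarith

theorem a199250_odd (k : ℕ) :
    2 * (a199250 (2 * k + 3) : ℤ) =
      latticeSeries (2 * k + 3) 1 0 0 - latticeSeries (2 * k + 1) 1 0 0 := by
  classical
  have h := card_isProper_and
    (fun f => IsWalkColoring f 1 0 0 ∨ IsWalkColoring f (-1) 0 0 ∨ IsWalkColoring f 0 1 0 ∨
      IsWalkColoring f 0 (-1) 0 ∨ IsWalkColoring f 0 0 1 ∨ IsWalkColoring f 0 0 (-1))
    (isBalanced_iff_of_odd (n := 2 * k + 1 + 1 + 1) ⟨k + 1, by ring⟩)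
  have ite_or' (p q : Prop) [Decidable p] [Decidable q] [Decidable (p ∨ q)]
      (hpq : p → ¬ q) :
      (if p ∨ q then (1 : ℤ) else 0) = (if p then 1 else 0) + if q then 1 else 0 := by
    by_cases hp : p
    · simp [hp, hpq hp]
    · simp [hp]
  have hdisj (f : Fin (2 * k + 1 + 1 + 1) → Fin 4 × Fin 4) {a b c a' b' c' : ℤ}
      (h : ¬ (a = a' ∧ b = b' ∧ c = c')) (hf : IsWalkColoring f a b c) :
      ¬ IsWalkColoring f a' b' c' := fun hf' => h (hf.unique hf')
  have hsum : ((24 * a199250 (2 * k + 3) : ℕ) : ℤ) = 2 * halfWalkCount (2 * k + 2) 1 0 0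
      + 2 * halfWalkCount (2 * k + 2) (-1) 0 0 + 2 * halfWalkCount (2 * k + 2) 0 1 0
      + 2 * halfWalkCount (2 * k + 2) 0 (-1) 0 + 2 * halfWalkCount (2 * k + 2) 0 0 1
      + 2 * halfWalkCount (2 * k + 2) 0 0 (-1) := by
    rw [← card_isProper_isBalanced (by omega), h]
    simp only [← sum_isWalkColoring, ← Finset.sum_add_distrib]
    refine Finset.sum_congr rfl fun f _ => ?_
    rw [ite_or', ite_or', ite_or', ite_or', ite_or']
    · ring
    all_goals
      intro hf
      try simp only [not_or]
      repeat' apply And.intro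
      all_goals exact hdisj f (by decide) hf
  simp only [halfWalkCount_succ] at hsum
  have e₁ (n : ℕ) : latticeSeries n (-1) 0 0 = latticeSeries n 1 0 0 :=
    latticeSeries.neg_fst n 1 0 0
  have e₂ (n : ℕ) : latticeSeries n 0 1 0 = latticeSeries n 1 0 0 :=
    latticeSeries.swap_fst_snd n 1 0 0
  have e₃ (n : ℕ) : latticeSeries n 0 (-1) 0 = latticeSeries n (-1) 0 0 :=
    latticeSeries.swap_fst_snd n (-1) 0 0
  have e₄ (n : ℕ) : latticeSeries n 0 0 1 = latticeSeries n 0 1 0 :=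
    latticeSeries.swap_snd_trd n 0 1 0
  have e₅ (n : ℕ) : latticeSeries n 0 0 (-1) = latticeSeries n 0 (-1) 0 :=
    latticeSeries.swap_snd_trd n 0 (-1) 0
  simp only [e₅, e₄, e₃, e₂, e₁] at hsum
  push_cast at hsum
  linarith

set_option maxHeartbeats 4000000 in
theorem even_combination {A B G D : ℕ → ℚ} {x : ℚ} (hx : 0 ≤ x)
    (hA : ∀ i : ℕ, A (i + 1) = 6 * B i + 7 * A i)
    (hB : ∀ i : ℕ, (x + i + 2) * B (i + 1) =
      (2 * x + 2 * i + 3) * (A (i + 1) + 2 * G (i + 1)) + 7 * (x + i + 1) * B i)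
    (hG : ∀ i : ℕ, (x + i + 2) * G (i + 1) =
      (x + i + 1) * (4 * B i + 2 * D i) + 7 * (x + i) * G i)
    (hD : ∀ i : ℕ, (x + i + 3) * D (i + 1) =
      3 * (2 * x + 2 * i + 3) * G (i + 1) + 7 * (x + i) * D i) :
    (460992 * (x + 1) ^ 8 + 5109328 * (x + 1) ^ 7 + 21536970 * (x + 1) ^ 6 + 42696983 * (x
        + 1) ^ 5 + 39335583 * (x + 1) ^ 4 + 13433595 * (x + 1) ^ 3) *
        (A 1 - A 0) +
    (-639744 * (x + 1) ^ 8 - 8511104 * (x + 1) ^ 7 - 46104296 * (x + 1) ^ 6 - 131154086 *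
        (x + 1) ^ 5 - 210885514 * (x + 1) ^ 4 - 192123022 * (x + 1) ^ 3 - 94156734 * (x + 1)
        ^ 2 - 22343608 * (x + 1) - 2276736) *
        (A 2 - A 1) +
    (191616 * (x + 1) ^ 8 + 2877344 * (x + 1) ^ 7 + 17781116 * (x + 1) ^ 6 + 58075704 * (x
        + 1) ^ 5 + 106638242 * (x + 1) ^ 4 + 106936104 * (x + 1) ^ 3 + 50522216 * (x + 1) ^ 2
        + 6388000 * (x + 1) - 302016) *
        (A 3 - A 2) +
    (-13056 * (x + 1) ^ 8 - 216320 * (x + 1) ^ 7 - 1472360 * (x + 1) ^ 6 - 5274074 * (x +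
        1) ^ 5 - 10533618 * (x + 1) ^ 4 - 11300690 * (x + 1) ^ 3 - 5457382 * (x + 1) ^ 2 -
        487128 * (x + 1) + 94464) *
        (A 4 - A 3) +
    (192 * (x + 1) ^ 8 + 3472 * (x + 1) ^ 7 + 25610 * (x + 1) ^ 6 + 98609 * (x + 1) ^ 5 +
        209723 * (x + 1) ^ 4 + 236861 * (x + 1) ^ 3 + 118076 * (x + 1) ^ 2 + 9328 * (x + 1) -
        2496) *
        (A 5 - A 4) = 0 := by
  have hA0 : A 1 = 6 * B 0 + 7 * A 0 := hA 0
  have hB0 : B 1 = ((2 * x + 3) * (A 1 + 2 * G 1) + 7 * (x + 1) * B 0) / (x + 2) := by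
    rw [eq_div_iff (by positivity)]
    linear_combination (norm := (push_cast; ring)) hB 0
  have hD0 : D 1 = (3 * (2 * x + 3) * G 1 + 7 * (x + 0) * D 0) / (x + 3) := by
    rw [eq_div_iff (by positivity)]
    linear_combination (norm := (push_cast; ring)) hD 0
  have hA1 : A 2 = 6 * B 1 + 7 * A 1 := hA 1
  have hG1 : G 2 = ((x + 2) * (4 * B 1 + 2 * D 1) + 7 * (x + 1) * G 1) / (x + 3) := by
    rw [eq_div_iff (by positivity)]
    linear_combination (norm := (push_cast; ring)) hG 1
  have hB1 : B 2 = ((2 * x + 5) * (A 2 + 2 * G 2) + 7 * (x + 2) * B 1) / (x + 3) := by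
    rw [eq_div_iff (by positivity)]
    linear_combination (norm := (push_cast; ring)) hB 1
  have hD1 : D 2 = (3 * (2 * x + 5) * G 2 + 7 * (x + 1) * D 1) / (x + 4) := by
    rw [eq_div_iff (by positivity)]
    linear_combination (norm := (push_cast; ring)) hD 1
  have hA2 : A 3 = 6 * B 2 + 7 * A 2 := hA 2
  have hG2 : G 3 = ((x + 3) * (4 * B 2 + 2 * D 2) + 7 * (x + 2) * G 2) / (x + 4) := by
    rw [eq_div_iff (by positivity)]
    linear_combination (norm := (push_cast; ring)) hG 2
  have hB2 : B 3 = ((2 * x + 7) * (A 3 + 2 * G 3) + 7 * (x + 3) * B 2) / (x + 4) := by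
    rw [eq_div_iff (by positivity)]
    linear_combination (norm := (push_cast; ring)) hB 2
  have hD2 : D 3 = (3 * (2 * x + 7) * G 3 + 7 * (x + 2) * D 2) / (x + 5) := by
    rw [eq_div_iff (by positivity)]
    linear_combination (norm := (push_cast; ring)) hD 2
  have hA3 : A 4 = 6 * B 3 + 7 * A 3 := hA 3
  have hG3 : G 4 = ((x + 4) * (4 * B 3 + 2 * D 3) + 7 * (x + 3) * G 3) / (x + 5) := by
    rw [eq_div_iff (by positivity)]
    linear_combination (norm := (push_cast; ring)) hG 3
  have hB3 : B 4 = ((2 * x + 9) * (A 4 + 2 * G 4) + 7 * (x + 4) * B 3) / (x + 5) := by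
    rw [eq_div_iff (by positivity)]
    linear_combination (norm := (push_cast; ring)) hB 3
  have hD3 : D 4 = (3 * (2 * x + 9) * G 4 + 7 * (x + 3) * D 3) / (x + 6) := by
    rw [eq_div_iff (by positivity)]
    linear_combination (norm := (push_cast; ring)) hD 3
  have hA4 : A 5 = 6 * B 4 + 7 * A 4 := hA 4
  have hG4 : G 5 = ((x + 5) * (4 * B 4 + 2 * D 4) + 7 * (x + 4) * G 4) / (x + 6) := by
    rw [eq_div_iff (by positivity)]
    linear_combination (norm := (push_cast; ring)) hG 4
  have hB4 : B 5 = ((2 * x + 11) * (A 5 + 2 * G 5) + 7 * (x + 5) * B 4) / (x + 6) := by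
    rw [eq_div_iff (by positivity)]
    linear_combination (norm := (push_cast; ring)) hB 4
  have hD4 : D 5 = (3 * (2 * x + 11) * G 5 + 7 * (x + 4) * D 4) / (x + 7) := by
    rw [eq_div_iff (by positivity)]
    linear_combination (norm := (push_cast; ring)) hD 4
  rw [hA4, hB3, hA3, hG3, hD2, hB2, hA2, hG2, hD1, hB1, hA1, hG1, hD0, hB0, hA0]
  field_simp
  ring

set_option maxHeartbeats 4000000 in
theorem odd_combination {A B G D : ℕ → ℚ} {x : ℚ} (hx : 0 ≤ x)
    (hA : ∀ i : ℕ, A (i + 1) = 6 * B i + 7 * A i)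
    (hB : ∀ i : ℕ, (x + i + 2) * B (i + 1) =
      (2 * x + 2 * i + 3) * (A (i + 1) + 2 * G (i + 1)) + 7 * (x + i + 1) * B i)
    (hG : ∀ i : ℕ, (x + i + 2) * G (i + 1) =
      (x + i + 1) * (4 * B i + 2 * D i) + 7 * (x + i) * G i)
    (hD : ∀ i : ℕ, (x + i + 3) * D (i + 1) =
      3 * (2 * x + 2 * i + 3) * G (i + 1) + 7 * (x + i) * D i) :
    (4148928 * (x + 1) ^ 10 + 86090256 * (x + 1) ^ 9 + 731407026 * (x + 1) ^ 8 +
        3277026459 * (x + 1) ^ 7 + 8300636358 * (x + 1) ^ 6 + 11795169407 * (x + 1) ^ 5 +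
        8657223274 * (x + 1) ^ 4 + 2526293784 * (x + 1) ^ 3) *
        (B 1 - B 0) +
    (-5757696 * (x + 1) ^ 10 - 132257664 * (x + 1) ^ 9 - 1287022632 * (x + 1) ^ 8 -
        6931513638 * (x + 1) ^ 7 - 22662722313 * (x + 1) ^ 6 - 46455256393 * (x + 1) ^ 5 -
        59563251146 * (x + 1) ^ 4 - 46207935263 * (x + 1) ^ 3 - 20203962975 * (x + 1) ^ 2 -
        4424755468 * (x + 1) - 421247904) *
        (B 2 - B 1) +
    (1724544 * (x + 1) ^ 10 + 42566688 * (x + 1) ^ 9 + 450289356 * (x + 1) ^ 8 +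
        2664337824 * (x + 1) ^ 7 + 9644646333 * (x + 1) ^ 6 + 21910345387 * (x + 1) ^ 5 +
        30687106706 * (x + 1) ^ 4 + 24663169255 * (x + 1) ^ 3 + 9349986451 * (x + 1) ^ 2 +
        635576668 * (x + 1) - 156900576) *
        (B 3 - B 2) +
    (-117504 * (x + 1) ^ 10 - 3082752 * (x + 1) ^ 9 - 34586088 * (x + 1) ^ 8 - 216091962 *
        (x + 1) ^ 7 - 819816903 * (x + 1) ^ 6 - 1928820967 * (x + 1) ^ 5 - 2747891630 * (x +
        1) ^ 4 - 2187964865 * (x + 1) ^ 3 - 788545049 * (x + 1) ^ 2 - 39860948 * (x + 1) +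
        15031968) *
        (B 4 - B 3) +
    (1728 * (x + 1) ^ 10 + 47952 * (x + 1) ^ 9 + 566418 * (x + 1) ^ 8 + 3705381 * (x + 1)
        ^ 7 + 14619213 * (x + 1) ^ 6 + 35467142 * (x + 1) ^ 5 + 51539644 * (x + 1) ^ 4 +
        41271777 * (x + 1) ^ 3 + 14688805 * (x + 1) ^ 2 + 704900 * (x + 1) - 276000) *
        (B 5 - B 4) = 0 := by
  have hA0 : A 1 = 6 * B 0 + 7 * A 0 := hA 0
  have hB0 : B 1 = ((2 * x + 3) * (A 1 + 2 * G 1) + 7 * (x + 1) * B 0) / (x + 2) := by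
    rw [eq_div_iff (by positivity)]
    linear_combination (norm := (push_cast; ring)) hB 0
  have hD0 : D 1 = (3 * (2 * x + 3) * G 1 + 7 * (x + 0) * D 0) / (x + 3) := by
    rw [eq_div_iff (by positivity)]
    linear_combination (norm := (push_cast; ring)) hD 0
  have hA1 : A 2 = 6 * B 1 + 7 * A 1 := hA 1
  have hG1 : G 2 = ((x + 2) * (4 * B 1 + 2 * D 1) + 7 * (x + 1) * G 1) / (x + 3) := by
    rw [eq_div_iff (by positivity)]
    linear_combination (norm := (push_cast; ring)) hG 1
  have hB1 : B 2 = ((2 * x + 5) * (A 2 + 2 * G 2) + 7 * (x + 2) * B 1) / (x + 3) := by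
    rw [eq_div_iff (by positivity)]
    linear_combination (norm := (push_cast; ring)) hB 1
  have hD1 : D 2 = (3 * (2 * x + 5) * G 2 + 7 * (x + 1) * D 1) / (x + 4) := by
    rw [eq_div_iff (by positivity)]
    linear_combination (norm := (push_cast; ring)) hD 1
  have hA2 : A 3 = 6 * B 2 + 7 * A 2 := hA 2
  have hG2 : G 3 = ((x + 3) * (4 * B 2 + 2 * D 2) + 7 * (x + 2) * G 2) / (x + 4) := by
    rw [eq_div_iff (by positivity)]
    linear_combination (norm := (push_cast; ring)) hG 2
  have hB2 : B 3 = ((2 * x + 7) * (A 3 + 2 * G 3) + 7 * (x + 3) * B 2) / (x + 4) := by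
    rw [eq_div_iff (by positivity)]
    linear_combination (norm := (push_cast; ring)) hB 2
  have hD2 : D 3 = (3 * (2 * x + 7) * G 3 + 7 * (x + 2) * D 2) / (x + 5) := by
    rw [eq_div_iff (by positivity)]
    linear_combination (norm := (push_cast; ring)) hD 2
  have hA3 : A 4 = 6 * B 3 + 7 * A 3 := hA 3
  have hG3 : G 4 = ((x + 4) * (4 * B 3 + 2 * D 3) + 7 * (x + 3) * G 3) / (x + 5) := by
    rw [eq_div_iff (by positivity)]
    linear_combination (norm := (push_cast; ring)) hG 3
  have hB3 : B 4 = ((2 * x + 9) * (A 4 + 2 * G 4) + 7 * (x + 4) * B 3) / (x + 5) := by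
    rw [eq_div_iff (by positivity)]
    linear_combination (norm := (push_cast; ring)) hB 3
  have hD3 : D 4 = (3 * (2 * x + 9) * G 4 + 7 * (x + 3) * D 3) / (x + 6) := by
    rw [eq_div_iff (by positivity)]
    linear_combination (norm := (push_cast; ring)) hD 3
  have hA4 : A 5 = 6 * B 4 + 7 * A 4 := hA 4
  have hG4 : G 5 = ((x + 5) * (4 * B 4 + 2 * D 4) + 7 * (x + 4) * G 4) / (x + 6) := by
    rw [eq_div_iff (by positivity)]
    linear_combination (norm := (push_cast; ring)) hG 4
  have hB4 : B 5 = ((2 * x + 11) * (A 5 + 2 * G 5) + 7 * (x + 5) * B 4) / (x + 6) := by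
    rw [eq_div_iff (by positivity)]
    linear_combination (norm := (push_cast; ring)) hB 4
  have hD4 : D 5 = (3 * (2 * x + 11) * G 5 + 7 * (x + 4) * D 4) / (x + 7) := by
    rw [eq_div_iff (by positivity)]
    linear_combination (norm := (push_cast; ring)) hD 4
  rw [hB4, hA4, hG4, hD3, hB3, hA3, hG3, hD2, hB2, hA2, hG2, hD1, hB1, hA1, hG1, hD0, hB0, hA0]
  field_simp
  ring

theorem latticeSeries_relations (k : ℕ) :
    (∀ i : ℕ, (latticeSeries (2 * (k + (i + 1))) 0 0 0 : ℚ) =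
      6 * latticeSeries (2 * (k + i) + 1) 1 0 0 + 7 * latticeSeries (2 * (k + i)) 0 0 0) ∧
    (∀ i : ℕ, ((k : ℚ) + i + 2) * latticeSeries (2 * (k + (i + 1)) + 1) 1 0 0 =
      (2 * k + 2 * i + 3) * (latticeSeries (2 * (k + (i + 1))) 0 0 0
        + 2 * latticeSeries (2 * (k + (i + 1))) 1 1 0)
        + 7 * (k + i + 1) * latticeSeries (2 * (k + i) + 1) 1 0 0) ∧
    (∀ i : ℕ, ((k : ℚ) + i + 2) * latticeSeries (2 * (k + (i + 1))) 1 1 0 =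
      (k + i + 1) * (4 * latticeSeries (2 * (k + i) + 1) 1 0 0
        + 2 * latticeSeries (2 * (k + i) + 1) 1 1 1)
        + 7 * (k + i) * latticeSeries (2 * (k + i)) 1 1 0) ∧
    (∀ i : ℕ, ((k : ℚ) + i + 3) * latticeSeries (2 * (k + (i + 1)) + 1) 1 1 1 =
      3 * (2 * k + 2 * i + 3) * latticeSeries (2 * (k + (i + 1))) 1 1 0
        + 7 * (k + i) * latticeSeries (2 * (k + i) + 1) 1 1 1) := by
  refine ⟨fun i => ?_, fun i => ?_, fun i => ?_, fun i => ?_⟩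
  · have h := congrArg (Int.cast : ℤ → ℚ) (latticeSeries.rec_zero (2 * (k + i)))
    push_cast at h
    exact h
  · have h := congrArg (Int.cast : ℤ → ℚ) (latticeSeries.rec_one (2 * (k + i) + 1))
    push_cast at h
    simp only [show 2 * (k + (i + 1)) = 2 * (k + i) + 2 by ring]
    linear_combination h / 2
  · have h := congrArg (Int.cast : ℤ → ℚ) (latticeSeries.rec_two (2 * (k + i)))
    push_cast at h
    simp only [show 2 * (k + (i + 1)) = 2 * (k + i) + 2 by ring]
    linear_combination h / 2
  · have h := congrArg (Int.cast : ℤ → ℚ) (latticeSeries.rec_three (2 * (k + i) + 1))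
    push_cast at h
    simp only [show 2 * (k + (i + 1)) = 2 * (k + i) + 2 by ring]
    linear_combination h / 2

open Polynomial in
/-- The even-indexed subsequence of `a199250` satisfies a recurrence of order `4`
and degree at most `8`, and the odd-indexed subsequence satisfies a recurrence of
order `4` and degree at most `10`. -/
theorem stmt4 :
    (∃ p : Fin 5 → Polynomial ℤ,
      (∀ i, (p i).degree ≤ 8) ∧ p 4 ≠ 0 ∧
      ∀ n : ℕ, 1 ≤ n →
        ∑ i : Fin 5, (p i).eval (n : ℤ) * (a199250 (2 * n + 2 * (i : ℕ)) : ℤ) = 0) ∧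
    (∃ q : Fin 5 → Polynomial ℤ,
      (∀ i, (q i).degree ≤ 10) ∧ q 4 ≠ 0 ∧
      ∀ n : ℕ, 1 ≤ n →
        ∑ i : Fin 5, (q i).eval (n : ℤ) * (a199250 (2 * n + 1 + 2 * (i : ℕ)) : ℤ) = 0) := by
  constructor
  · refine ⟨![460992 * X ^ 8 + 5109328 * X ^ 7 + 21536970 * X ^ 6 + 42696983 * X ^ 5 + 39335583 * X
        ^ 4 + 13433595 * X ^ 3,
      -639744 * X ^ 8 - 8511104 * X ^ 7 - 46104296 * X ^ 6 - 131154086 * X ^ 5 - 210885514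
        * X ^ 4 - 192123022 * X ^ 3 - 94156734 * X ^ 2 - 22343608 * X - 2276736,
      191616 * X ^ 8 + 2877344 * X ^ 7 + 17781116 * X ^ 6 + 58075704 * X ^ 5 + 106638242 *
        X ^ 4 + 106936104 * X ^ 3 + 50522216 * X ^ 2 + 6388000 * X - 302016,
      -13056 * X ^ 8 - 216320 * X ^ 7 - 1472360 * X ^ 6 - 5274074 * X ^ 5 - 10533618 * X ^
        4 - 11300690 * X ^ 3 - 5457382 * X ^ 2 - 487128 * X + 94464,
      192 * X ^ 8 + 3472 * X ^ 7 + 25610 * X ^ 6 + 98609 * X ^ 5 + 209723 * X ^ 4 + 236861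
        * X ^ 3 + 118076 * X ^ 2 + 9328 * X - 2496],
      fun i => ?_, ?_, fun n hn => ?_⟩
    · fin_cases i <;> simp only [Fin.zero_eta, Fin.mk_one, Fin.reduceFinMk, Matrix.cons_val] <;>
        compute_degree
    · intro h
      simpa using congrArg (eval 0) h
    · obtain ⟨k, rfl⟩ := Nat.exists_eq_add_of_le' hn
      obtain ⟨hA, hB, hG, hD⟩ := latticeSeries_relations k
      have h := even_combination (A := fun i => (latticeSeries (2 * (k + i)) 0 0 0 : ℚ))
        (B := fun i => (latticeSeries (2 * (k + i) + 1) 1 0 0 : ℚ))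
        (G := fun i => (latticeSeries (2 * (k + i)) 1 1 0 : ℚ))
        (D := fun i => (latticeSeries (2 * (k + i) + 1) 1 1 1 : ℚ))
        (Nat.cast_nonneg k) hA hB hG hD
      have ha (i : ℕ) : 12 * (a199250 (2 * (k + 1) + 2 * i) : ℚ) =
          latticeSeries (2 * (k + (i + 1))) 0 0 0 - latticeSeries (2 * (k + i)) 0 0 0 := by
        have := congrArg (Int.cast : ℤ → ℚ) (a199250_even (k + i))
        push_cast at this
        rw [show 2 * (k + 1) + 2 * i = 2 * (k + i) + 2 by ring]
        exact this
      have h₀ := ha 0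
      have h₁ := ha 1
      have h₂ := ha 2
      have h₃ := ha 3
      have h₄ := ha 4
      beta_reduce at h
      simp only [Nat.reduceAdd] at h₀ h₁ h₂ h₃ h₄
      rw [← h₀, ← h₁, ← h₂, ← h₃, ← h₄] at h
      rw [← Int.cast_inj (α := ℚ), Fin.sum_univ_five]
      simp only [Matrix.cons_val, Fin.coe_ofNat_eq_mod, Nat.reduceMod, eval_add, eval_sub, eval_neg,
        eval_mul, eval_pow, eval_X, eval_ofNat]
      push_cast
      linear_combination h / 12
  · refine ⟨![4148928 * X ^ 10 + 86090256 * X ^ 9 + 731407026 * X ^ 8 + 3277026459 * X ^ 7 +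
        8300636358 * X ^ 6 + 11795169407 * X ^ 5 + 8657223274 * X ^ 4 + 2526293784 * X ^ 3,
      -5757696 * X ^ 10 - 132257664 * X ^ 9 - 1287022632 * X ^ 8 - 6931513638 * X ^ 7 -
        22662722313 * X ^ 6 - 46455256393 * X ^ 5 - 59563251146 * X ^ 4 - 46207935263 * X ^ 3
        - 20203962975 * X ^ 2 - 4424755468 * X - 421247904,
      1724544 * X ^ 10 + 42566688 * X ^ 9 + 450289356 * X ^ 8 + 2664337824 * X ^ 7 +
        9644646333 * X ^ 6 + 21910345387 * X ^ 5 + 30687106706 * X ^ 4 + 24663169255 * X ^ 3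
        + 9349986451 * X ^ 2 + 635576668 * X - 156900576,
      -117504 * X ^ 10 - 3082752 * X ^ 9 - 34586088 * X ^ 8 - 216091962 * X ^ 7 - 819816903
        * X ^ 6 - 1928820967 * X ^ 5 - 2747891630 * X ^ 4 - 2187964865 * X ^ 3 - 788545049 *
        X ^ 2 - 39860948 * X + 15031968,
      1728 * X ^ 10 + 47952 * X ^ 9 + 566418 * X ^ 8 + 3705381 * X ^ 7 + 14619213 * X ^ 6 +
        35467142 * X ^ 5 + 51539644 * X ^ 4 + 41271777 * X ^ 3 + 14688805 * X ^ 2 + 704900 *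
        X - 276000],
      fun i => ?_, ?_, fun n hn => ?_⟩
    · fin_cases i <;> simp only [Fin.zero_eta, Fin.mk_one, Fin.reduceFinMk, Matrix.cons_val] <;>
        compute_degree
    · intro h
      simpa using congrArg (eval 0) h
    · obtain ⟨k, rfl⟩ := Nat.exists_eq_add_of_le' hn
      obtain ⟨hA, hB, hG, hD⟩ := latticeSeries_relations k
      have h := odd_combination (A := fun i => (latticeSeries (2 * (k + i)) 0 0 0 : ℚ))
        (B := fun i => (latticeSeries (2 * (k + i) + 1) 1 0 0 : ℚ))
        (G := fun i => (latticeSeries (2 * (k + i)) 1 1 0 : ℚ))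
        (D := fun i => (latticeSeries (2 * (k + i) + 1) 1 1 1 : ℚ))
        (Nat.cast_nonneg k) hA hB hG hD
      have ha (i : ℕ) : 2 * (a199250 (2 * (k + 1) + 1 + 2 * i) : ℚ) =
          latticeSeries (2 * (k + (i + 1)) + 1) 1 0 0 - latticeSeries (2 * (k + i) + 1) 1 0 0 := by
        have := congrArg (Int.cast : ℤ → ℚ) (a199250_odd (k + i))
        push_cast at this
        rw [show 2 * (k + 1) + 1 + 2 * i = 2 * (k + i) + 3 by ring]
        exact this
      have h₀ := ha 0
      have h₁ := ha 1
      have h₂ := ha 2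
      have h₃ := ha 3
      have h₄ := ha 4
      beta_reduce at h
      simp only [Nat.reduceAdd] at h₀ h₁ h₂ h₃ h₄
      rw [← h₀, ← h₁, ← h₂, ← h₃, ← h₄] at h
      rw [← Int.cast_inj (α := ℚ), Fin.sum_univ_five]
      simp only [Matrix.cons_val, Fin.coe_ofNat_eq_mod, Nat.reduceMod, eval_add, eval_sub, eval_neg,
        eval_mul, eval_pow, eval_X, eval_ofNat]
      push_cast
      linear_combination h / 2
end

section
/- For every integer n ≥ 12, the sequence a satisfies the constant-coefficient linear recurrence a(n+17) − 7·a(n+16) + 14·a(n+15) − 12·a(n+14) + 26·a(n+13) − 42·a(n+12) + 8·a(n+11) − 4·a(n+10) + a(n+9) + 73·a(n+8) − 58·a(n+7) + 44·a(n+6) − 84·a(n+5) + 8·a(n+4) + 36·a(n+3) − 28·a(n+2) + 56·a(n+1) − 32·a(n) = 0. -/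
/-- `a250556 n` is the number of vectors `v ∈ {0,1,2,3}^{n+2}` for which there
exists a sign vector `s ∈ {-1,+1}ⁿ` with
`∑_{k=1}^{n} s_k · (v_{k+2} - 2·v_{k+1} + v_k) = 0` (OEIS A250556). -/
noncomputable def a250556 (n : ℕ) : ℕ :=
  Nat.card {v : Fin (n + 2) → Fin 4 //
    ∃ s : Fin n → ℤ, (∀ k, s k = 1 ∨ s k = -1) ∧
      ∑ k : Fin n, s k *
        (((v k.succ.succ : ℕ) : ℤ) - 2 * ((v k.succ.castSucc : ℕ) : ℤ) +
          ((v k.castSucc.castSucc : ℕ) : ℤ)) = 0}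

namespace SecondDifference

/-- Binary trees with data at the leaves. -/
inductive Tree (α : Type) where
  | leaf (x : α) : Tree α
  | node (l r : Tree α) : Tree α

namespace Tree

variable {α γ β : Type}

/-- The leaf reached by reading the binary digits of `i`, lowest first. -/
def get : Tree α → ℕ → α
  | leaf x, _ => x
  | node l r, i => bif Nat.beq (i % 2) 0 then l.get (i / 2) else r.get (i / 2)

def all (p : α → Bool) : Tree α → Bool
  | leaf x => p x
  | node l r => l.all p && r.all p

def map (f : α → γ) : Tree α → Tree γ
  | leaf x => leaf (f x)
  | node l r => node (l.map f) (r.map f)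

/-- `map f` in continuation-passing style, every new leaf being evaluated by `force`. -/
def mapForce (f : α → γ) (force : γ → (γ → β) → β) : Tree α → (Tree γ → β) → β
  | leaf x, k => force (f x) fun y => k (leaf y)
  | node l r, k => l.mapForce f force fun l' => r.mapForce f force fun r' => k (node l' r')

theorem get_of_all {p : α → Bool} {t : Tree α} (h : t.all p = true) (i : ℕ) :
    p (t.get i) = true := by
  induction t generalizing i with
  | leaf x => exact h
  | node l r hl hr =>
    simp only [all, Bool.and_eq_true] at h
    rw [get]
    cases Nat.beq (i % 2) 0
    · exact hr h.2 _
    · exact hl h.1 _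

theorem get_map (f : α → γ) (t : Tree α) (i : ℕ) : (t.map f).get i = f (t.get i) := by
  induction t generalizing i with
  | leaf x => rfl
  | node l r hl hr =>
    rw [map, get, get]
    cases Nat.beq (i % 2) 0
    · exact hr _
    · exact hl _

theorem mapForce_eq (f : α → γ) {force : γ → (γ → β) → β} (hf : ∀ x k, force x k = k x)
    (t : Tree α) (k : Tree γ → β) : t.mapForce f force k = k (t.map f) := by
  induction t generalizing k with
  | leaf x => simp [mapForce, map, hf]
  | node l r hl hr => simp [mapForce, map, hl, hr]

end Tree

/-- Evaluates `n` to a numeral before handing it to `k`. -/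
def forceNat {β : Type} (n : ℕ) (k : ℕ → β) : β :=
  Nat.casesOn n (k 0) fun m => k (Nat.succ m)

theorem forceNat_eq {β : Type} (n : ℕ) (k : ℕ → β) : forceNat n k = k n := by
  cases n <;> rfl

/-- A function of the last two letters `a b < 4` that is invariant under the reflection
`x ↦ 3 - x`, stored through its values for `a < 2`. -/
@[ext]
structure Cell where
  (x00 x01 x02 x03 x10 x11 x12 x13 : ℕ)

namespace Cell

def get (q : Cell) : ℕ → ℕ → ℕ
  | 0, 0 => q.x00
  | 0, 1 => q.x01
  | 0, 2 => q.x02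
  | 0, 3 => q.x03
  | 1, 0 => q.x10
  | 1, 1 => q.x11
  | 1, 2 => q.x12
  | 1, 3 => q.x13
  | 2, 0 => q.x13
  | 2, 1 => q.x12
  | 2, 2 => q.x11
  | 2, 3 => q.x10
  | 3, 0 => q.x03
  | 3, 1 => q.x02
  | 3, 2 => q.x01
  | 3, 3 => q.x00
  | _, _ => 0

def all (p : ℕ → Bool) (q : Cell) : Bool :=
  p q.x00 && p q.x01 && p q.x02 && p q.x03 && p q.x10 && p q.x11 && p q.x12 && p q.x13

def force {β : Type} (q : Cell) (k : Cell → β) : β :=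
  forceNat q.x00 fun y00 => forceNat q.x01 fun y01 => forceNat q.x02 fun y02 =>
  forceNat q.x03 fun y03 => forceNat q.x10 fun y10 => forceNat q.x11 fun y11 =>
  forceNat q.x12 fun y12 => forceNat q.x13 fun y13 => k ⟨y00, y01, y02, y03, y10, y11, y12, y13⟩

theorem force_eq {β : Type} (q : Cell) (k : Cell → β) : q.force k = k q := by
  simp [force, forceNat_eq]

end Cell

/-- The absolute value of the second difference of `a, b, c`. -/
def secondDiff (a b c : ℕ) : ℕ := (a + c - 2 * b) + (2 * b - (a + c))

def mem (S : List ℕ) (t : ℕ) : Bool := S.any fun s => Nat.beq s t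

/-- The absolute values of the sums `±t ± d` with `t ∈ S`. -/
def spread (S : List ℕ) (d : ℕ) : List ℕ :=
  S.flatMap fun t => [t + d, (t - d) + (d - t)]

/-- The least `m ≤ t` such that `|t - 2 * i * m|` is an element of `S` smaller than `t`, and `t + 1` if
there is none. The minimum of `x` and `m` is written `x - (x - m)`. -/
def flips (S : List ℕ) (t i : ℕ) : ℕ :=
  S.foldr (fun s m =>
    bif Nat.ble t s then m
    else bif Nat.beq (Nat.mod (Nat.sub t s) (2 * i)) 0 then
      Nat.sub (Nat.div (Nat.sub t s) (2 * i)) (Nat.sub (Nat.div (Nat.sub t s) (2 * i)) m)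
    else bif Nat.beq (Nat.mod (Nat.add t s) (2 * i)) 0 then
      Nat.sub (Nat.div (Nat.add t s) (2 * i)) (Nat.sub (Nat.div (Nat.add t s) (2 * i)) m)
    else m) (t + 1)

def redundant (S : List ℕ) (t : ℕ) : Bool :=
  Nat.blt (((List.range 7).map fun i => i * (flips S t i - 1)).sum) t

def isReduction (S T : List ℕ) : Bool :=
  (T.all fun t => mem S t) && S.all fun t => mem T t || redundant S t

/-- A set of partial sums, and the indices of the sets following it under each difference. -/
structure Row where
  sums : List ℕ
  next0 : ℕ
  next1 : ℕ
  next2 : ℕ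
  next3 : ℕ
  next4 : ℕ
  next5 : ℕ
  next6 : ℕ

def Row.next (r : Row) : ℕ → ℕ
  | 0 => r.next0
  | 1 => r.next1
  | 2 => r.next2
  | 3 => r.next3
  | 4 => r.next4
  | 5 => r.next5
  | _ => r.next6

/-- Some choice of signs `±d` for the elements `d` of `u` brings `t` to zero. -/
def Balances : List ℕ → ℤ → Prop
  | [], t => t = 0
  | d :: u, t => Balances u (t + d) ∨ Balances u (t - d)

def Accepts (u S : List ℕ) : Prop := ∃ t ∈ S, Balances u (t : ℤ)

theorem balances_neg (u : List ℕ) (t : ℤ) : Balances u (-t) ↔ Balances u t := by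
  induction u generalizing t with
  | nil => simp [Balances]
  | cons d u ih =>
    rw [Balances, Balances, show -t + d = -(t - d) by ring, show -t - d = -(t + d) by ring,
      ih, ih, or_comm]

theorem balances_natAbs (u : List ℕ) (t : ℤ) : Balances u (t.natAbs : ℤ) ↔ Balances u t := by
  rcases Int.natAbs_eq t with h | h
  · rw [← h]
  · rw [← balances_neg, ← h]

theorem natAbs_sub_eq (x y : ℕ) : ((x : ℤ) - y).natAbs = (x - y) + (y - x) := by omega

theorem mem_iff {S : List ℕ} {t : ℕ} : mem S t = true ↔ t ∈ S := by
  simp [mem]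

theorem accepts_cons (d : ℕ) (u S : List ℕ) : Accepts (d :: u) S ↔ Accepts u (spread S d) := by
  simp only [Accepts, Balances, spread, List.mem_flatMap]
  constructor
  · rintro ⟨t, ht, h | h⟩
    · exact ⟨t + d, ⟨t, ht, by simp⟩, by simpa using h⟩
    · refine ⟨_, ⟨t, ht, List.mem_cons_of_mem _ (List.mem_cons_self ..)⟩, ?_⟩
      rwa [← natAbs_sub_eq, balances_natAbs]
  · rintro ⟨x, ⟨t, ht, hx⟩, h⟩
    refine ⟨t, ht, ?_⟩
    simp only [List.mem_cons, List.not_mem_nil, or_false] at hx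
    rcases hx with rfl | rfl
    · left; simpa using h
    · right; rwa [← natAbs_sub_eq, balances_natAbs] at h

theorem exists_negative_counts {u : List ℕ} (hu : ∀ d ∈ u, d < 7) {t : ℤ} (h : Balances u t) :
    ∃ p : ℕ → ℕ, t ≤ ∑ i ∈ Finset.range 7, (i : ℤ) * p i ∧
      ∀ i m : ℕ, m ≤ p i → Balances u (t - 2 * i * m) := by
  induction u generalizing t with
  | nil =>
    refine ⟨fun _ => 0, ?_, fun i m hm => ?_⟩
    · simp [show t = 0 from h]
    · obtain rfl : m = 0 := by simpa using hm
      simpa using h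
  | cons d u ih =>
    have hu' : ∀ d ∈ u, d < 7 := fun e he => hu e (List.mem_cons_of_mem _ he)
    rcases h with h | h
    · obtain ⟨p, hp, hflip⟩ := ih hu' h
      refine ⟨p, by omega, fun i m hm => Or.inl ?_⟩
      rw [show t - 2 * i * m + d = t + d - 2 * i * m by ring]
      exact hflip i m hm
    · obtain ⟨p, hp, hflip⟩ := ih hu' h
      refine ⟨fun i => p i + if i = d then 1 else 0, ?_, fun i m hm => ?_⟩
      · have hd : d ∈ Finset.range 7 := Finset.mem_range.2 (hu d (List.mem_cons_self ..))
        have : ∑ i ∈ Finset.range 7, (i : ℤ) * ((p i + if i = d then 1 else 0 : ℕ) : ℤ)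
            = ∑ i ∈ Finset.range 7, (i : ℤ) * p i + d := by
          simp only [Nat.cast_add, Nat.cast_ite, Nat.cast_one, Nat.cast_zero, mul_add,
            Finset.sum_add_distrib, mul_ite, mul_one, mul_zero]
          rw [Finset.sum_ite_eq' (Finset.range 7) d (fun i => (i : ℤ)), if_pos hd]
        refine le_of_le_of_eq ?_ this.symm
        omega
      · rcases Nat.lt_or_ge (p i) m with hlt | hle
        · have hid : i = d := by
            by_contra hne
            simp [hne] at hm
            omega
          subst hid
          obtain rfl : m = p i + 1 := by
            simp at hm
            omega
          left
          have := hflip i (p i) le_rfl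
          rwa [show t - 2 * i * ((p i + 1 : ℕ) : ℤ) + i = t - i - 2 * i * (p i : ℤ) by
            push_cast; ring]
        · right
          rw [show t - 2 * i * m - d = t - d - 2 * i * m by ring]
          exact hflip i m hle

theorem flips_spec (S : List ℕ) (t i : ℕ) : flips S t i = t + 1 ∨
    ∃ s ∈ S, s < t ∧ ((t : ℤ) - 2 * i * flips S t i).natAbs = s := by
  have key : ∀ R : List ℕ, R ⊆ S → flips R t i = t + 1 ∨
      ∃ s ∈ S, s < t ∧ ((t : ℤ) - 2 * i * flips R t i).natAbs = s := by
    intro R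
    induction R with
    | nil => exact fun _ => Or.inl rfl
    | cons s R ih =>
      intro hR
      have ih := ih fun x hx => hR (List.mem_cons_of_mem _ hx)
      have hs : s ∈ S := hR (List.mem_cons_self ..)
      have hmin : ∀ x m : ℕ, Nat.sub x (Nat.sub x m) = m ∨ Nat.sub x (Nat.sub x m) = x := by
        intro x m
        change x - (x - m) = m ∨ x - (x - m) = x
        omega
      have hcons : flips (s :: R) t i = bif Nat.ble t s then flips R t i
          else bif Nat.beq (Nat.mod (Nat.sub t s) (2 * i)) 0 then
            Nat.sub (Nat.div (Nat.sub t s) (2 * i))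
              (Nat.sub (Nat.div (Nat.sub t s) (2 * i)) (flips R t i))
          else bif Nat.beq (Nat.mod (Nat.add t s) (2 * i)) 0 then
            Nat.sub (Nat.div (Nat.add t s) (2 * i))
              (Nat.sub (Nat.div (Nat.add t s) (2 * i)) (flips R t i))
          else flips R t i := rfl
      rcases h1 : Nat.ble t s with _ | _
      · have hst : s < t := by
          by_contra hle
          rw [Nat.ble_eq_true_of_le (by omega)] at h1
          cases h1
        rw [h1, cond_false] at hcons
        rcases h2 : Nat.beq (Nat.mod (Nat.sub t s) (2 * i)) 0 with _ | _
        · rw [h2, cond_false] at hcons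
          rcases h3 : Nat.beq (Nat.mod (Nat.add t s) (2 * i)) 0 with _ | _
          · rw [h3, cond_false] at hcons
            rwa [hcons]
          · rw [h3, cond_true] at hcons
            rcases hmin (Nat.div (Nat.add t s) (2 * i)) (flips R t i) with h | h
            · rwa [hcons, h]
            · refine Or.inr ⟨s, hs, hst, ?_⟩
              rw [hcons, h]
              have h4 : (t + s) % (2 * i) = 0 := Nat.eq_of_beq_eq_true h3
              have h5 : 2 * i * ((t + s) / (2 * i)) = t + s :=
                Nat.mul_div_cancel' (Nat.dvd_of_mod_eq_zero h4)
              change ((t : ℤ) - 2 * i * ((t + s) / (2 * i) : ℕ)).natAbs = s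
              zify at h5 ⊢
              rw [h5]
              simp
        · rw [h2, cond_true] at hcons
          rcases hmin (Nat.div (Nat.sub t s) (2 * i)) (flips R t i) with h | h
          · rwa [hcons, h]
          · refine Or.inr ⟨s, hs, hst, ?_⟩
            rw [hcons, h]
            have h4 : (t - s) % (2 * i) = 0 := Nat.eq_of_beq_eq_true h2
            have h5 : 2 * i * ((t - s) / (2 * i)) = t - s :=
              Nat.mul_div_cancel' (Nat.dvd_of_mod_eq_zero h4)
            change ((t : ℤ) - 2 * i * ((t - s) / (2 * i) : ℕ)).natAbs = s
            zify [hst.le] at h5 ⊢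
            rw [h5]
            simp
      · rw [h1, cond_true] at hcons
        rwa [hcons]
  exact key S (List.Subset.refl S)

theorem exists_smaller_of_redundant {u S : List ℕ} {t : ℕ} (hu : ∀ d ∈ u, d < 7)
    (hred : redundant S t = true) (h : Balances u (t : ℤ)) :
    ∃ s ∈ S, s < t ∧ Balances u (s : ℤ) := by
  obtain ⟨p, hp, hflip⟩ := exists_negative_counts hu h
  have hsum : ∑ i ∈ Finset.range 7, i * (flips S t i - 1) < t := by
    rw [Finset.sum_range]
    simpa [redundant, Nat.blt_eq, List.range_succ, Fin.sum_univ_succ, add_assoc] using hred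
  obtain ⟨i, hi, hpi⟩ : ∃ i ∈ Finset.range 7, i * (flips S t i - 1) < i * p i := by
    refine Finset.exists_lt_of_sum_lt (lt_of_lt_of_le hsum ?_)
    exact_mod_cast hp
  have hflips : flips S t i - 1 < p i := lt_of_mul_lt_mul_left' hpi
  rcases flips_spec S t i with hf | ⟨s, hs, hst, habs⟩
  · have h1 : i * (flips S t i - 1) < t := lt_of_le_of_lt
      (Finset.single_le_sum (f := fun i => i * (flips S t i - 1)) (fun _ _ => Nat.zero_le _) hi)
      hsum
    have h2 : 0 < i := Nat.pos_of_ne_zero (by rintro rfl; simp at hpi)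
    rw [hf, Nat.add_sub_cancel] at h1
    nlinarith
  · refine ⟨s, hs, hst, ?_⟩
    rw [← habs, balances_natAbs]
    exact hflip i _ (by omega)

theorem accepts_congr {u S T : List ℕ} (hu : ∀ d ∈ u, d < 7) (hST : isReduction S T = true) :
    Accepts u S ↔ Accepts u T := by
  simp only [isReduction, Bool.and_eq_true, List.all_eq_true, Bool.or_eq_true, mem_iff] at hST
  obtain ⟨hsub, hred⟩ := hST
  constructor
  · rintro ⟨t, ht, h⟩
    induction t using Nat.strong_induction_on with
    | _ t ih =>
      rcases hred t ht with hT | hr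
      · exact ⟨t, hT, h⟩
      · obtain ⟨s, hs, hst, h'⟩ := exists_smaller_of_redundant hu hr h
        exact ih s hst hs h'
  · rintro ⟨t, ht, h⟩
    exact ⟨t, hsub t ht, h⟩

/-- The absolute values of the second differences of the word `a, b, w`. -/
def secondDiffs : (n : ℕ) → ℕ → ℕ → (Fin n → Fin 4) → List ℕ
  | 0, _, _, _ => []
  | n + 1, a, b, w => secondDiff a b (w 0) :: secondDiffs n b (w 0) (Fin.tail w)

/-- The number of continuations of length `n` after the letters `a, b` that bring one of the
partial sums in `S` to zero. -/
noncomputable def count (n a b : ℕ) (S : List ℕ) : ℕ :=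
  Nat.card {w : Fin n → Fin 4 // Accepts (secondDiffs n a b w) S}

theorem secondDiff_lt {a b c : ℕ} (ha : a < 4) (hb : b < 4) (hc : c < 4) :
    secondDiff a b c < 7 := by
  unfold secondDiff
  omega

theorem secondDiffs_lt {n a b : ℕ} (ha : a < 4) (hb : b < 4) (w : Fin n → Fin 4) :
    ∀ d ∈ secondDiffs n a b w, d < 7 := by
  induction n generalizing a b with
  | zero => simp [secondDiffs]
  | succ n ih =>
    intro d hd
    rw [secondDiffs, List.mem_cons] at hd
    rcases hd with rfl | hd
    · exact secondDiff_lt ha hb (w 0).isLt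
    · exact ih hb (w 0).isLt _ d hd

theorem card_subtype_cons {n : ℕ} (P : (Fin (n + 1) → Fin 4) → Prop) :
    Nat.card {v // P v} = ∑ c : Fin 4, Nat.card {w : Fin n → Fin 4 // P (Fin.cons c w)} := by
  rw [← Nat.card_sigma]
  refine Nat.card_congr (Equiv.trans (Equiv.symm (Equiv.subtypeEquiv
    (Fin.consEquiv fun _ => Fin 4) (p := fun x => P (Fin.cons x.1 x.2)) fun _ => Iff.rfl)) ?_)
  exact Equiv.subtypeProdEquivSigmaSubtype fun c w => P (Fin.cons c w)

theorem count_zero (a b : ℕ) (S : List ℕ) : count 0 a b S = bif mem S 0 then 1 else 0 := by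
  have h : ∀ w : Fin 0 → Fin 4, Accepts (secondDiffs 0 a b w) S ↔ mem S 0 = true := by
    simp [Accepts, secondDiffs, Balances, mem_iff]
  rw [count, Nat.card_congr (Equiv.subtypeEquivRight h)]
  cases mem S 0 <;> simp

theorem count_succ (n a b : ℕ) (S : List ℕ) :
    count (n + 1) a b S = ∑ c : Fin 4, count n b c (spread S (secondDiff a b c)) := by
  rw [count, card_subtype_cons]
  refine Finset.sum_congr rfl fun c _ => Nat.card_congr (Equiv.subtypeEquivRight fun w => ?_)
  rw [secondDiffs, accepts_cons, Fin.cons_zero, Fin.tail_cons]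

theorem count_congr {n a b : ℕ} (ha : a < 4) (hb : b < 4) {S T : List ℕ}
    (hST : isReduction S T = true) : count n a b S = count n a b T :=
  Nat.card_congr (Equiv.subtypeEquivRight fun w => accepts_congr (secondDiffs_lt ha hb w) hST)

theorem count_le (n a b : ℕ) (S : List ℕ) : count n a b S ≤ 4 ^ n := by
  refine (Finite.card_subtype_le _).trans ?_
  simp

/-- The second difference of `v` at `k`. -/
def diffAt {n : ℕ} (v : Fin (n + 2) → Fin 4) (k : Fin n) : ℤ :=
  ((v k.succ.succ : ℕ) : ℤ) - 2 * ((v k.succ.castSucc : ℕ) : ℤ) +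
    ((v k.castSucc.castSucc : ℕ) : ℤ)

theorem balances_secondDiff (u : List ℕ) (a b c : ℕ) (t : ℤ) :
    Balances (secondDiff a b c :: u) t ↔
      Balances u (t + ((c : ℤ) - 2 * b + a)) ∨ Balances u (t - ((c : ℤ) - 2 * b + a)) := by
  have h : (secondDiff a b c : ℤ) = (c : ℤ) - 2 * b + a ∨
      (secondDiff a b c : ℤ) = -((c : ℤ) - 2 * b + a) := by
    unfold secondDiff
    omega
  rw [Balances]
  rcases h with h | h
  · rw [h]
  · rw [h, sub_neg_eq_add, ← sub_eq_add_neg, or_comm]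

theorem exists_signs_iff {n : ℕ} (a b : Fin 4) (w : Fin n → Fin 4) (t : ℤ) :
    (∃ s : Fin n → ℤ, (∀ k, s k = 1 ∨ s k = -1) ∧ t + ∑ k : Fin n, s k *
      diffAt (Fin.cons a (Fin.cons b w : Fin (n + 1) → Fin 4)) k = 0) ↔
      Balances (secondDiffs n a b w) t := by
  induction n generalizing a b t with
  | zero =>
    simp only [Finset.univ_eq_empty, Finset.sum_empty, add_zero, secondDiffs, Balances]
    exact ⟨fun ⟨_, _, h⟩ => h, fun h => ⟨fun _ => 1, fun _ => Or.inl rfl, h⟩⟩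
  | succ n ih =>
    have hw : w = Fin.cons (w 0) (Fin.tail w) := (Fin.cons_self_tail w).symm
    have h0 : diffAt (Fin.cons a (Fin.cons b w : Fin (n + 2) → Fin 4)) 0
        = ((w 0 : ℕ) : ℤ) - 2 * (b : ℕ) + (a : ℕ) := rfl
    have hs (k : Fin n) : diffAt (Fin.cons a (Fin.cons b w : Fin (n + 2) → Fin 4)) k.succ
        = diffAt (Fin.cons b (Fin.cons (w 0) (Fin.tail w) : Fin (n + 1) → Fin 4)) k := by
      rw [← hw]
      rfl
    rw [secondDiffs, balances_secondDiff, ← ih, ← ih, ← exists_or, Fin.exists_fin_succ_pi,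
      exists_comm]
    refine exists_congr fun s => ?_
    simp only [Fin.forall_fin_succ, Fin.sum_univ_succ, Fin.cons_zero, Fin.cons_succ, h0, hs]
    constructor
    · rintro ⟨x, ⟨rfl | rfl, hs⟩, h⟩
      · exact Or.inl ⟨hs, by linarith⟩
      · exact Or.inr ⟨hs, by linarith⟩
    · rintro (⟨hs, h⟩ | ⟨hs, h⟩)
      · exact ⟨1, ⟨Or.inl rfl, hs⟩, by linarith⟩
      · exact ⟨-1, ⟨Or.inr rfl, hs⟩, by linarith⟩

theorem a250556_eq (n : ℕ) :
    a250556 n = ∑ a : Fin 4, ∑ b : Fin 4, count n a b [0] := by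
  have h : a250556 n = Nat.card {v : Fin (n + 2) → Fin 4 //
      ∃ s : Fin n → ℤ, (∀ k, s k = 1 ∨ s k = -1) ∧ ∑ k : Fin n, s k * diffAt v k = 0} := rfl
  rw [h, card_subtype_cons]
  refine Finset.sum_congr rfl fun a _ => ?_
  rw [card_subtype_cons]
  refine Finset.sum_congr rfl fun b _ => Nat.card_congr (Equiv.subtypeEquivRight fun w => ?_)
  simp [Accepts, ← exists_signs_iff]

/-- An automaton whose states are sets of partial sums, up to reduction; the root index is `0`. -/
def table : Tree Row :=
  (.node
   (.node
    (.node
     (.node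
      (.node
       (.node
        (.node
         (.node
          (.leaf ⟨[0], 0, 1, 2, 3, 4, 5, 6⟩)
          (.leaf ⟨[5, 15, 25, 35, 45], 128, 104, 100, 96, 112, 131, 112⟩))
         (.leaf ⟨[6, 18], 64, 76, 78, 82, 51, 44, 89⟩))
        (.node
         (.leaf ⟨[4, 6, 8], 32, 35, 65, 29, 28, 8, 67⟩)
         (.leaf ⟨[2, 8, 12, 18, 22], 96, 38, 49, 46, 70, 100, 70⟩)))
       (.node
        (.node
         (.leaf ⟨[3, 7], 16, 34, 46, 49, 38, 50, 8⟩)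
         (.leaf ⟨[1, 7, 9, 15], 80, 37, 29, 69, 99, 69, 29⟩))
        (.node
         (.leaf ⟨[2, 4, 8], 48, 29, 33, 36, 33, 38, 39⟩)
         (.leaf ⟨[1, 9, 11, 19, 29], 112, 93, 38, 70, 103, 119, 72⟩))))
      (.node
       (.node
        (.node
         (.leaf ⟨[1, 3], 8, 28, 29, 33, 29, 34, 35⟩)
         (.leaf ⟨[3, 5, 7, 13], 72, 70, 29, 33, 38, 93, 38⟩))
        (.node
         (.leaf ⟨[1, 7, 9], 40, 37, 29, 69, 71, 55, 29⟩)
         (.leaf ⟨[4, 6, 14, 16, 24], 104, 72, 70, 38, 93, 112, 93⟩)))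
       (.node
        (.node
         (.leaf ⟨[2, 10], 24, 8, 45, 36, 15, 31, 17⟩)
         (.leaf ⟨[1, 9, 11, 21], 88, 66, 38, 70, 72, 73, 31⟩))
        (.node
         (.leaf ⟨[3, 7, 13], 56, 70, 46, 49, 38, 81, 38⟩)
         (.leaf ⟨[5, 15, 25, 35], 120, 104, 100, 96, 112, 125, 112⟩)))))
     (.node
      (.node
       (.node
        (.node
         (.node
          (.leaf ⟨[4], 4, 10, 15, 19, 22, 23, 24⟩)
          (.leaf ⟨[4, 6, 14, 16, 24, 34, 44, 54], 132, 72, 70, 38, 93, 130, 93⟩))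
         (.leaf ⟨[1, 3, 15], 68, 91, 29, 33, 29, 65, 92⟩))
        (.node
         (.leaf ⟨[1, 5, 7], 36, 33, 29, 39, 29, 33, 36⟩)
         (.leaf ⟨[3, 7, 13, 17, 23], 100, 70, 46, 49, 38, 96, 38⟩)))
       (.node
        (.node
         (.leaf ⟨[2, 8], 20, 38, 49, 14, 55, 56, 48⟩)
         (.leaf ⟨[1, 7, 9, 17], 84, 37, 29, 69, 71, 55, 29⟩))
        (.node
         (.leaf ⟨[2, 4, 10], 52, 29, 33, 36, 37, 29, 39⟩)
         (.leaf ⟨[1, 11, 13, 25, 37], 116, 107, 68, 39, 35, 94, 108⟩))))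
      (.node
       (.node
        (.node
         (.leaf ⟨[5, 7], 12, 32, 35, 39, 8, 43, 44⟩)
         (.leaf ⟨[5, 7, 17, 19], 76, 94, 35, 39, 68, 67, 95⟩))
        (.node
         (.leaf ⟨[1, 11, 13], 44, 67, 68, 39, 35, 32, 76⟩)
         (.leaf ⟨[5, 7, 17, 19, 31], 108, 94, 35, 39, 68, 67, 116⟩)))
       (.node
        (.node
         (.leaf ⟨[0, 2, 4], 28, 29, 33, 29, 33, 29, 65⟩)
         (.leaf ⟨[3, 5, 7, 9, 21], 92, 65, 29, 33, 29, 28, 68⟩))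
        (.node
         (.leaf ⟨[4, 6, 14], 60, 72, 70, 38, 85, 86, 66⟩)
         (.leaf ⟨[1, 9, 11, 19, 29, 39], 124, 93, 38, 70, 103, 127, 72⟩))))))
    (.node
     (.node
      (.node
       (.node
        (.node
         (.node
          (.leaf ⟨[2], 2, 8, 13, 14, 15, 16, 17⟩)
          (.leaf ⟨[1, 9, 11, 19, 29, 39, 49], 130, 93, 38, 70, 103, 132, 72⟩))
         (.leaf ⟨[0, 2, 8, 12], 66, 38, 33, 29, 70, 72, 34⟩))
        (.node
         (.leaf ⟨[2, 4, 6, 8], 34, 29, 33, 29, 33, 38, 28⟩)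
         (.leaf ⟨[0, 6, 12, 18, 24], 98, 36, 39, 82, 39, 36, 98⟩)))
       (.node
        (.node
         (.leaf ⟨[0, 6], 18, 36, 48, 21, 52, 14, 53⟩)
         (.leaf ⟨[3, 9, 15, 21], 82, 39, 36, 98, 36, 39, 82⟩))
        (.node
         (.leaf ⟨[2, 8, 12], 50, 38, 49, 46, 70, 77, 34⟩)
         (.leaf ⟨[0, 12, 24, 36], 114, 95, 51, 82, 78, 108, 121⟩))))
      (.node
       (.node
        (.node
         (.leaf ⟨[3, 5], 10, 30, 29, 37, 40, 41, 8⟩)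
         (.leaf ⟨[3, 5, 7, 17], 74, 34, 29, 33, 38, 66, 8⟩))
        (.node
         (.leaf ⟨[1, 9, 11], 42, 66, 38, 70, 72, 73, 31⟩)
         (.leaf ⟨[6, 18, 30], 106, 108, 78, 82, 51, 95, 114⟩)))
       (.node
        (.node
         (.leaf ⟨[1, 11], 26, 43, 8, 48, 31, 62, 63⟩)
         (.leaf ⟨[4, 6, 8, 18, 20], 90, 35, 65, 29, 28, 68, 107⟩))
        (.node
         (.leaf ⟨[4, 12], 58, 71, 47, 80, 83, 84, 47⟩)
         (.leaf ⟨[0, 8, 16, 24, 32], 122, 80, 47, 99, 117, 99, 47⟩)))))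
     (.node
      (.node
       (.node
        (.node
         (.node
          (.leaf ⟨[6], 6, 12, 17, 21, 24, 26, 27⟩)
          (.leaf ⟨[0, 10, 20, 30, 40, 50, 60], 134, 112, 96, 100, 104, 133, 104⟩))
         (.leaf ⟨[2, 4, 6, 8, 12], 70, 29, 33, 29, 33, 38, 33⟩))
        (.node
         (.leaf ⟨[1, 3, 7], 38, 33, 29, 33, 29, 70, 29⟩)
         (.leaf ⟨[1, 3, 7, 17], 102, 33, 29, 33, 29, 110, 29⟩)))
       (.node
        (.node
         (.leaf ⟨[0, 8], 22, 40, 47, 54, 58, 59, 15⟩)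
         (.leaf ⟨[1, 9, 11, 19], 86, 93, 38, 70, 103, 104, 72⟩))
        (.node
         (.leaf ⟨[3, 5, 11], 54, 69, 29, 37, 80, 37, 29⟩)
         (.leaf ⟨[3, 5, 7, 13, 23, 33], 118, 70, 29, 33, 38, 123, 38⟩))))
      (.node
       (.node
        (.node
         (.leaf ⟨[1, 5], 14, 33, 38, 48, 29, 49, 36⟩)
         (.leaf ⟨[4, 8, 20], 78, 92, 47, 36, 45, 68, 97⟩))
        (.node
         (.leaf ⟨[1, 5, 9], 46, 33, 38, 70, 29, 49, 29⟩)
         (.leaf ⟨[2, 4, 6, 8, 12, 22], 110, 29, 33, 29, 33, 38, 33⟩)))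
       (.node
        (.node
         (.leaf ⟨[2, 4, 6], 30, 29, 33, 29, 37, 38, 28⟩)
         (.leaf ⟨[4, 6, 8, 20], 94, 92, 65, 29, 28, 68, 107⟩))
        (.node
         (.leaf ⟨[4, 6, 16], 62, 31, 34, 38, 66, 88, 43⟩)
         (.leaf ⟨[3, 5, 7, 13, 23, 33, 43], 126, 70, 29, 33, 38, 129, 38⟩)))))))
   (.node
    (.node
     (.node
      (.node
       (.node
        (.node
         (.node
          (.leaf ⟨[1], 1, 7, 8, 9, 10, 11, 12⟩)
          (.leaf ⟨[0, 2, 8, 12, 18, 28, 38, 48], 129, 38, 33, 29, 70, 126, 70⟩))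
         (.leaf ⟨[2, 4, 6, 8, 10], 65, 29, 33, 29, 33, 29, 28⟩))
        (.node
         (.leaf ⟨[0, 2, 4, 6], 33, 29, 33, 29, 33, 29, 33⟩)
         (.leaf ⟨[2, 10, 14, 26], 97, 68, 45, 36, 47, 35, 78⟩)))
       (.node
        (.node
         (.leaf ⟨[4, 8], 17, 35, 47, 36, 45, 8, 51⟩)
         (.leaf ⟨[2, 8, 12, 18], 81, 38, 49, 46, 70, 100, 70⟩))
        (.node
         (.leaf ⟨[0, 4, 6, 10], 49, 29, 70, 38, 33, 46, 33⟩)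
         (.leaf ⟨[0, 10, 20, 30], 113, 112, 96, 100, 104, 120, 104⟩))))
      (.node
       (.node
        (.node
         (.leaf ⟨[2, 4], 9, 29, 33, 36, 37, 38, 39⟩)
         (.leaf ⟨[4, 6, 14, 16], 73, 72, 70, 38, 93, 86, 66⟩))
        (.node
         (.leaf ⟨[0, 2, 8], 41, 38, 33, 29, 55, 72, 34⟩)
         (.leaf ⟨[5, 15, 25], 105, 104, 100, 96, 112, 113, 86⟩)))
       (.node
        (.node
         (.leaf ⟨[0, 10], 25, 42, 50, 56, 60, 61, 62⟩)
         (.leaf ⟨[0, 12, 24], 89, 95, 51, 82, 78, 76, 106⟩))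
        (.node
         (.leaf ⟨[3, 9, 15], 57, 39, 36, 79, 36, 39, 82⟩)
         (.leaf ⟨[6, 18, 30, 42], 121, 108, 78, 82, 51, 95, 114⟩)))))
     (.node
      (.node
       (.node
        (.node
         (.node
          (.leaf ⟨[5], 5, 11, 16, 20, 23, 25, 26⟩)
          (.leaf ⟨[5, 15, 25, 35, 45, 55], 133, 104, 100, 96, 112, 134, 112⟩))
         (.leaf ⟨[2, 4, 6, 10, 12], 69, 29, 33, 29, 37, 29, 33⟩))
        (.node
         (.leaf ⟨[0, 2, 6, 8], 37, 29, 33, 29, 69, 29, 33⟩)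
         (.leaf ⟨[4, 12, 20], 101, 99, 47, 80, 109, 80, 47⟩)))
       (.node
        (.node
         (.leaf ⟨[3, 9], 21, 39, 36, 53, 36, 48, 57⟩)
         (.leaf ⟨[0, 2, 8, 18], 85, 102, 33, 29, 55, 103, 70⟩))
        (.node
         (.leaf ⟨[0, 6, 12], 53, 36, 39, 57, 39, 36, 79⟩)
         (.leaf ⟨[4, 12, 20, 28], 117, 99, 47, 80, 122, 80, 47⟩))))
      (.node
       (.node
        (.node
         (.leaf ⟨[0, 4], 13, 29, 15, 38, 45, 46, 47⟩)
         (.leaf ⟨[3, 7, 13, 17], 77, 70, 46, 49, 38, 96, 38⟩))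
        (.node
         (.leaf ⟨[0, 4, 8], 45, 29, 47, 29, 45, 29, 47⟩)
         (.leaf ⟨[0, 8, 16, 24], 109, 80, 47, 99, 117, 99, 47⟩)))
       (.node
        (.node
         (.leaf ⟨[1, 3, 5], 29, 33, 29, 33, 29, 33, 29⟩)
         (.leaf ⟨[0, 2, 8, 12, 18], 93, 38, 33, 29, 70, 103, 70⟩))
        (.node
         (.leaf ⟨[5, 15], 61, 73, 77, 81, 86, 87, 88⟩)
         (.leaf ⟨[0, 10, 20, 30, 40], 125, 112, 96, 100, 104, 128, 104⟩))))))
    (.node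
     (.node
      (.node
       (.node
        (.node
         (.node
          (.leaf ⟨[3], 3, 9, 14, 18, 19, 20, 21⟩)
          (.leaf ⟨[0, 10, 20, 30, 40, 50], 131, 112, 96, 100, 104, 133, 104⟩))
         (.leaf ⟨[0, 2, 12, 14], 67, 68, 28, 29, 65, 35, 90⟩))
        (.node
         (.leaf ⟨[3, 5, 7, 9], 35, 65, 29, 33, 29, 28, 68⟩)
         (.leaf ⟨[3, 5, 11, 13, 19], 99, 69, 29, 37, 80, 37, 29⟩)))
       (.node
        (.node
         (.leaf ⟨[1, 7], 19, 37, 29, 52, 54, 55, 36⟩)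
         (.leaf ⟨[0, 8, 16], 83, 80, 47, 99, 101, 71, 47⟩))
        (.node
         (.leaf ⟨[2, 10, 14], 51, 68, 45, 36, 47, 35, 78⟩)
         (.leaf ⟨[4, 6, 8, 18, 20, 32], 115, 35, 65, 29, 28, 68, 107⟩))))
      (.node
       (.node
        (.node
         (.leaf ⟨[4, 6], 11, 31, 34, 38, 41, 42, 43⟩)
         (.leaf ⟨[4, 6, 8, 18], 75, 35, 65, 29, 28, 8, 67⟩))
        (.node
         (.leaf ⟨[0, 2, 12], 43, 8, 28, 29, 34, 74, 75⟩)
         (.leaf ⟨[0, 2, 12, 14, 26], 107, 68, 28, 29, 65, 35, 115⟩)))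
       (.node
        (.node
         (.leaf ⟨[0, 12], 27, 44, 51, 57, 17, 63, 64⟩)
         (.leaf ⟨[0, 2, 4, 14, 16], 91, 29, 33, 29, 33, 29, 65⟩))
        (.node
         (.leaf ⟨[3, 5, 13], 59, 55, 29, 37, 84, 85, 38⟩)
         (.leaf ⟨[0, 2, 8, 12, 18, 28, 38], 123, 38, 33, 29, 70, 126, 70⟩)))))
     (.node
      (.node
       (.node
        (.node
         (.leaf ⟨[0, 2], 7, 8, 28, 29, 30, 31, 32⟩)
         (.leaf ⟨[3, 5, 11, 13], 71, 69, 29, 37, 80, 37, 29⟩))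
        (.node
         (.leaf ⟨[2, 4, 8, 10], 39, 29, 33, 36, 33, 29, 39⟩)
         (.leaf ⟨[3, 5, 7, 13, 23], 103, 70, 29, 33, 38, 111, 38⟩)))
       (.node
        (.node
         (.leaf ⟨[1, 9], 23, 41, 38, 55, 59, 60, 31⟩)
         (.leaf ⟨[0, 10, 20], 87, 86, 96, 100, 104, 105, 73⟩))
        (.node
         (.leaf ⟨[2, 4, 6, 12], 55, 29, 33, 29, 37, 38, 33⟩)
         (.leaf ⟨[4, 6, 14, 16, 24, 34], 119, 72, 70, 38, 93, 124, 93⟩))))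
      (.node
       (.node
        (.node
         (.leaf ⟨[2, 6], 15, 29, 45, 29, 47, 38, 45⟩)
         (.leaf ⟨[0, 6, 12, 18], 79, 36, 39, 82, 39, 36, 98⟩))
        (.node
         (.leaf ⟨[2, 6, 10], 47, 29, 45, 29, 47, 29, 45⟩)
         (.leaf ⟨[0, 2, 8, 12, 18, 28], 111, 38, 33, 29, 70, 118, 70⟩)))
       (.node
        (.node
         (.leaf ⟨[3, 5, 7], 31, 34, 29, 33, 38, 66, 8⟩)
         (.leaf ⟨[1, 11, 13, 25], 95, 107, 68, 39, 35, 94, 108⟩))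
        (.node
         (.leaf ⟨[5, 7, 17], 63, 32, 35, 39, 8, 43, 44⟩)
         (.leaf ⟨[4, 6, 14, 16, 24, 34, 44], 127, 72, 70, 38, 93, 130, 93⟩))))))))

def Row.accepts (r : Row) : Bool := mem r.sums 0

/-- The values at the empty word `z` plus those at the continuations, where `gd` belongs to the set
following under the difference `d`. -/
def combine (z : ℕ) (g0 g1 g2 g3 g4 g5 g6 : Cell) : Cell :=
  ⟨Nat.add z (Nat.add (Nat.add g0.x00 g1.x01) (Nat.add g2.x02 g3.x03)),
   Nat.add z (Nat.add (Nat.add g2.x10 g1.x11) (Nat.add g0.x12 g1.x13)),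
   Nat.add z (Nat.add (Nat.add g4.x13 g3.x12) (Nat.add g2.x11 g1.x10)),
   Nat.add z (Nat.add (Nat.add g6.x03 g5.x02) (Nat.add g4.x01 g3.x00)),
   Nat.add z (Nat.add (Nat.add g1.x00 g2.x01) (Nat.add g3.x02 g4.x03)),
   Nat.add z (Nat.add (Nat.add g1.x10 g0.x11) (Nat.add g1.x12 g2.x13)),
   Nat.add z (Nat.add (Nat.add g3.x13 g2.x12) (Nat.add g1.x11 g0.x10)),
   Nat.add z (Nat.add (Nat.add g5.x03 g4.x02) (Nat.add g3.x01 g2.x00))⟩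

def advance (c : ℕ) (V : Tree Cell) (r : Row) : Cell :=
  combine (bif r.accepts then c else 0) (V.get r.next0) (V.get r.next1) (V.get r.next2)
    (V.get r.next3) (V.get r.next4) (V.get r.next5) (V.get r.next6)

/-- The linear combinations, with the given coefficients, of the numbers of accepted continuations
of lengths `0, 1, 2, …`, by Horner's scheme. -/
def horner : List ℕ → Tree Cell
  | [] => .leaf ⟨0, 0, 0, 0, 0, 0, 0, 0⟩
  | c :: cs => table.map (advance c (horner cs))

/-- `horner` in continuation-passing style, with all entries evaluated. -/
def hornerForce {β : Type} : List ℕ → (Tree Cell → β) → β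
  | [], k => k (.leaf ⟨0, 0, 0, 0, 0, 0, 0, 0⟩)
  | c :: cs, k => hornerForce cs fun V => table.mapForce (advance c V) Cell.force k

def base : ℕ := 2 ^ 128

def posCoeffs : List ℕ :=
  [0, 0, 0, 0, 0, 0, 0, 0, 0, 0, 0, 0,
    0, 56, 0, 36, 8, 0, 44, 0, 73, 1, 0, 8, 0, 26, 0, 14, 0, 1]

def negCoeffs : List ℕ :=
  [0, 0, 0, 0, 0, 0, 0, 0, 0, 0, 0, 0,
    32, 0, 28, 0, 0, 84, 0, 58, 0, 0, 4, 0, 42, 0, 12, 0, 7, 0]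

theorem table_spec : (table.all fun r => (List.range 7).all fun d =>
    isReduction (spread r.sums d) (table.get (r.next d)).sums) = true := by
  decide +kernel

theorem horner_check : (hornerForce (List.zipWith (fun p q => p + base * q) posCoeffs negCoeffs)
    fun V => V.all (Cell.all fun x => Nat.beq (x % base) (x / base))) = true := by
  decide +kernel

theorem count_next (n : ℕ) {a b : ℕ} (ha : a < 4) (hb : b < 4) (i : ℕ) :
    count (n + 1) a b (table.get i).sums = ∑ c : Fin 4,
      count n b c (table.get ((table.get i).next (secondDiff a b c))).sums := by
  rw [count_succ]
  refine Finset.sum_congr rfl fun c _ => count_congr hb c.isLt ?_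
  have h := Tree.get_of_all table_spec i
  rw [List.all_eq_true] at h
  exact h _ (List.mem_range.2 (secondDiff_lt ha hb c.isLt))

/-- The sum of `cs_j * f (n + j)` over the entries `cs_j` of the list. -/
def linComb (f : ℕ → ℕ) : List ℕ → ℕ → ℕ
  | [], _ => 0
  | c :: cs, n => c * f n + linComb f cs (n + 1)

theorem linComb_sum {ι : Type} [Fintype ι] (f : ι → ℕ → ℕ) (cs : List ℕ) (n : ℕ) :
    linComb (fun n => ∑ i, f i n) cs n = ∑ i, linComb (f i) cs n := by
  induction cs generalizing n with
  | nil => simp [linComb]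
  | cons c cs ih => simp [linComb, ih, Finset.sum_add_distrib, Finset.mul_sum]

theorem linComb_shift {ι : Type} [Fintype ι] {f : ℕ → ℕ} {g : ι → ℕ → ℕ}
    (h : ∀ n, f (n + 1) = ∑ i, g i n) (cs : List ℕ) (n : ℕ) :
    linComb f cs (n + 1) = ∑ i, linComb (g i) cs n := by
  rw [← linComb_sum]
  induction cs generalizing n with
  | nil => rfl
  | cons c cs ih => rw [linComb, linComb, h, ih]

theorem linComb_mono {f g : ℕ → ℕ} (h : ∀ n, f n ≤ g n) (cs : List ℕ) (n : ℕ) :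
    linComb f cs n ≤ linComb g cs n := by
  induction cs generalizing n with
  | nil => rfl
  | cons c cs ih => exact add_le_add (Nat.mul_le_mul_left c (h n)) (ih (n + 1))

theorem linComb_zipWith (f : ℕ → ℕ) (x : ℕ) {cs ds : List ℕ} (h : cs.length = ds.length)
    (n : ℕ) : linComb f (List.zipWith (fun c d => c + x * d) cs ds) n =
      linComb f cs n + x * linComb f ds n := by
  induction cs generalizing ds n with
  | nil =>
    obtain rfl : ds = [] := List.eq_nil_of_length_eq_zero h.symm
    rfl
  | cons c cs ih =>
    cases ds with
    | nil => simp at h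
    | cons d ds =>
      rw [List.zipWith_cons_cons, linComb, linComb, linComb, ih (by simpa using h)]
      ring

theorem Cell.of_all {p : ℕ → Bool} {q : Cell} (h : q.all p = true) {a b : ℕ} (ha : a < 4)
    (hb : b < 4) : p (q.get a b) = true := by
  simp only [Cell.all, Bool.and_eq_true] at h
  interval_cases a <;> interval_cases b <;> simp only [Cell.get, h]

theorem get_combine (z : ℕ) (r : Row) (g : ℕ → Cell) {a b : ℕ} (ha : a < 4) (hb : b < 4) :
    (combine z (g r.next0) (g r.next1) (g r.next2) (g r.next3) (g r.next4) (g r.next5)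
      (g r.next6)).get a b =
      z + ∑ c : Fin 4, (g (r.next (secondDiff a b c))).get b c := by
  rw [Fin.sum_univ_four]
  interval_cases a <;> interval_cases b <;>
    simp [Cell.get, combine, secondDiff, Row.next] <;> ring

theorem get_horner (cs : List ℕ) (i : ℕ) {a b : ℕ} (ha : a < 4) (hb : b < 4) :
    ((horner cs).get i).get a b = linComb (fun n => count n a b (table.get i).sums) cs 0 := by
  induction cs generalizing i a b with
  | nil => interval_cases a <;> interval_cases b <;> rfl
  | cons c cs ih =>
    rw [horner, Tree.get_map, advance, get_combine _ _ (horner cs).get ha hb, linComb,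
      linComb_shift fun n => count_next n ha hb i, count_zero]
    congr 1
    · rw [Row.accepts]
      cases mem (table.get i).sums 0 <;> simp
    · exact Finset.sum_congr rfl fun c _ => ih _ hb c.isLt

theorem hornerForce_eq {β : Type} (cs : List ℕ) (k : Tree Cell → β) :
    hornerForce cs k = k (horner cs) := by
  induction cs generalizing k with
  | nil => rfl
  | cons c cs ih => rw [hornerForce, ih, Tree.mapForce_eq _ Cell.force_eq, horner]

theorem linComb_count_zero (i : ℕ) {a b : ℕ} (ha : a < 4) (hb : b < 4) :
    linComb (fun n => count n a b (table.get i).sums) posCoeffs 0 =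
      linComb (fun n => count n a b (table.get i).sums) negCoeffs 0 := by
  have h := horner_check
  rw [hornerForce_eq] at h
  have h := Nat.eq_of_beq_eq_true (Cell.of_all (Tree.get_of_all h i) ha hb)
  rw [get_horner _ _ ha hb, linComb_zipWith _ _ (show posCoeffs.length = negCoeffs.length from rfl)] at h
  have hlt : linComb (fun n => count n a b (table.get i).sums) posCoeffs 0 < base :=
    lt_of_le_of_lt (linComb_mono (fun n => count_le n a b _) posCoeffs 0) (by decide +kernel)
  rwa [Nat.add_mul_mod_self_left, Nat.mod_eq_of_lt hlt,
    Nat.add_mul_div_left _ _ (by decide +kernel), Nat.div_eq_of_lt hlt, zero_add] at h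

theorem linComb_count (n i : ℕ) {a b : ℕ} (ha : a < 4) (hb : b < 4) :
    linComb (fun n => count n a b (table.get i).sums) posCoeffs n =
      linComb (fun n => count n a b (table.get i).sums) negCoeffs n := by
  induction n generalizing i a b with
  | zero => exact linComb_count_zero i ha hb
  | succ n ih =>
    rw [linComb_shift fun n => count_next n ha hb i, linComb_shift fun n => count_next n ha hb i]
    exact Finset.sum_congr rfl fun c _ => ih _ hb c.isLt

theorem linComb_a250556 (n : ℕ) :
    linComb a250556 posCoeffs n = linComb a250556 negCoeffs n := by
  have h : a250556 = fun n => ∑ a : Fin 4, ∑ b : Fin 4, count n a b (table.get 0).sums :=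
    funext a250556_eq
  rw [h]
  simp only [linComb_sum]
  exact Finset.sum_congr rfl fun a _ => Finset.sum_congr rfl fun b _ =>
    linComb_count n 0 a.isLt b.isLt

end SecondDifference

/-- For every `n ≥ 12` the sequence `a250556` satisfies the stated
constant-coefficient linear recurrence of order `17`. -/
theorem stmt6 (n : ℕ) (hn : 12 ≤ n) :
    (a250556 (n + 17) : ℤ) - 7 * a250556 (n + 16) + 14 * a250556 (n + 15)
      - 12 * a250556 (n + 14) + 26 * a250556 (n + 13) - 42 * a250556 (n + 12)
      + 8 * a250556 (n + 11) - 4 * a250556 (n + 10) + a250556 (n + 9)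
      + 73 * a250556 (n + 8) - 58 * a250556 (n + 7) + 44 * a250556 (n + 6)
      - 84 * a250556 (n + 5) + 8 * a250556 (n + 4) + 36 * a250556 (n + 3)
      - 28 * a250556 (n + 2) + 56 * a250556 (n + 1) - 32 * a250556 n = 0 := by
  obtain ⟨m, rfl⟩ := Nat.exists_eq_add_of_le' hn
  have h := SecondDifference.linComb_a250556 m
  simp only [SecondDifference.linComb, SecondDifference.posCoeffs, SecondDifference.negCoeffs,
    add_assoc, Nat.reduceAdd, zero_mul, zero_add] at h ⊢
  zify at h
  linarith
end

section
/- The sequence a is D-finite: there exist an integer r ≥ 1 and polynomials p0, …, pr ∈ ℤ[x], not all zero, such that p0(n)·a(n) + p1(n)·a(n+1) + ⋯ + pr(n)·a(n+r) = 0 for all integers n ≥ 1. -/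
/-- `a264947 n` is the number of `4 × n` arrays with entries in `{0,1,2,3}` such
that each of the four values occurs exactly `n` times, no two horizontally
adjacent entries are equal, and values are introduced in row-major order
(OEIS A264947). -/
noncomputable def a264947 (n : ℕ) : ℕ :=
  Nat.card {A : Fin 4 × Fin n → Fin 4 //
    (∀ v : Fin 4, (Finset.filter (fun p => A p = v) Finset.univ).card = n) ∧
    (∀ (i : Fin 4) (j : Fin n), ∀ h : (j : ℕ) + 1 < n,
      A (i, j) ≠ A (i, ⟨(j : ℕ) + 1, h⟩)) ∧
    (∀ p : Fin 4 × Fin n, 0 < (A p : ℕ) →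
      ∃ q : Fin 4 × Fin n,
        ((q.1 : ℕ) < (p.1 : ℕ) ∨ (q.1 = p.1 ∧ (q.2 : ℕ) < (p.2 : ℕ))) ∧
        (A q : ℕ) = (A p : ℕ) - 1)}

namespace DiagonalRecurrence

open MvPowerSeries Finset
open scoped Nat

variable {ι : Type*}

/-- Every monomial occurring in `p` has all its exponents at most `b`. -/
def BoxBounded (b : ℕ) (p : MvPowerSeries ι ℤ) : Prop :=
  ∀ k : ι →₀ ℕ, coeff k p ≠ 0 → ∀ i, k i ≤ b

theorem BoxBounded.mono {b b' : ℕ} {p : MvPowerSeries ι ℤ} (h : BoxBounded b p) (hb : b ≤ b') :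
    BoxBounded b' p :=
  fun k hk i => (h k hk i).trans hb

theorem BoxBounded.add {b : ℕ} {p q : MvPowerSeries ι ℤ} (hp : BoxBounded b p)
    (hq : BoxBounded b q) : BoxBounded b (p + q) := by
  intro k hk
  by_cases h : coeff k p = 0
  · exact hq k fun h' => hk (by rw [map_add, h, h', add_zero])
  · exact hp k h

theorem coeff_zsmul (k : ι →₀ ℕ) (c : ℤ) (p : MvPowerSeries ι ℤ) :
    coeff k (c • p) = c * coeff k p := by
  rw [map_smul, smul_eq_mul]

theorem BoxBounded.smul {b : ℕ} {p : MvPowerSeries ι ℤ} (c : ℤ) (hp : BoxBounded b p) :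
    BoxBounded b (c • p) := by
  intro k hk
  refine hp k fun h => hk ?_
  rw [coeff_zsmul, h, mul_zero]

theorem BoxBounded.mul {b b' : ℕ} {p q : MvPowerSeries ι ℤ} (hp : BoxBounded b p)
    (hq : BoxBounded b' q) : BoxBounded (b + b') (p * q) := by
  classical
  intro k hk i
  rw [coeff_mul] at hk
  obtain ⟨⟨u, v⟩, huv, hne⟩ := exists_ne_zero_of_sum_ne_zero hk
  rw [HasAntidiagonal.mem_antidiagonal] at huv
  have h1 := hp u (left_ne_zero_of_mul hne) i
  have h2 := hq v (right_ne_zero_of_mul hne) i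
  rw [← huv, Finsupp.add_apply]
  exact add_le_add h1 h2

theorem BoxBounded.one : BoxBounded 0 (1 : MvPowerSeries ι ℤ) := by
  classical
  intro k hk i
  rw [coeff_one] at hk
  have : k = 0 := by by_contra h; simp [h] at hk
  simp [this]

theorem BoxBounded.prod {κ : Type*} (s : Finset κ) {b : κ → ℕ} {p : κ → MvPowerSeries ι ℤ}
    (hp : ∀ r ∈ s, BoxBounded (b r) (p r)) : BoxBounded (∑ r ∈ s, b r) (∏ r ∈ s, p r) := by
  classical
  induction s using Finset.induction_on with
  | empty => simpa using BoxBounded.one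
  | insert r s hr ih =>
    rw [prod_insert hr, sum_insert hr]
    exact (hp r (mem_insert_self r s)).mul (ih fun r' h => hp r' (mem_insert_of_mem h))

theorem BoxBounded.monomial {b : ℕ} {e : ι →₀ ℕ} (he : ∀ i, e i ≤ b) (a : ℤ) :
    BoxBounded b (MvPowerSeries.monomial e a) := by
  classical
  intro k hk i
  rw [coeff_monomial] at hk
  have : k = e := by by_contra h; simp [h] at hk
  exact this ▸ he i

/-- The linear operator multiplying the coefficient of index `k` by `h k`. -/
def weigh (h : (ι →₀ ℕ) → ℤ) (p : MvPowerSeries ι ℤ) : MvPowerSeries ι ℤ :=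
  fun k => h k * coeff k p

theorem coeff_weigh (h : (ι →₀ ℕ) → ℤ) (p : MvPowerSeries ι ℤ) (k : ι →₀ ℕ) :
    coeff k (weigh h p) = h k * coeff k p := rfl

theorem BoxBounded.weigh {b : ℕ} {p : MvPowerSeries ι ℤ} (h : (ι →₀ ℕ) → ℤ)
    (hp : BoxBounded b p) : BoxBounded b (weigh h p) :=
  fun k hk => hp k (right_ne_zero_of_mul hk)

theorem weigh_mul_of_additive {L : (ι →₀ ℕ) → ℤ} (hL : ∀ u v, L (u + v) = L u + L v)
    (p q : MvPowerSeries ι ℤ) : weigh L (p * q) = weigh L p * q + p * weigh L q := by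
  classical
  ext k
  rw [map_add, coeff_weigh, coeff_mul, coeff_mul, coeff_mul, mul_sum, ← sum_add_distrib]
  refine sum_congr rfl fun x hx => ?_
  rw [HasAntidiagonal.mem_antidiagonal] at hx
  rw [coeff_weigh, coeff_weigh, ← hx, hL]
  ring

theorem pow_succ_mul_weigh {L : (ι →₀ ℕ) → ℤ} (hL : ∀ u v, L (u + v) = L u + L v)
    (Q g : MvPowerSeries ι ℤ) (M : ℕ) :
    Q ^ (M + 1) * weigh L g = Q * weigh L (Q ^ M * g) + (-(M : ℤ)) • (weigh L Q * (Q ^ M * g)) := by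
  induction M with
  | zero => simp
  | succ M ih =>
    have h := weigh_mul_of_additive hL Q (Q ^ M * g)
    rw [show Q ^ (M + 1) * g = Q * (Q ^ M * g) by ring, h]
    rw [zsmul_eq_mul] at ih ⊢
    push_cast at ih ⊢
    linear_combination Q * ih

/-- Weighing by `h` costs `s` further powers of the denominator `Q`, each of which raises the
exponents of the numerator by at most `D`. -/
def IsStep (Q : MvPowerSeries ι ℤ) (D s : ℕ) (h : (ι →₀ ℕ) → ℤ) : Prop :=
  ∀ (M b : ℕ) (g : MvPowerSeries ι ℤ), BoxBounded b (Q ^ M * g) →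
    BoxBounded (b + s * D) (Q ^ (M + s) * weigh h g)

theorem IsStep.affine {Q : MvPowerSeries ι ℤ} {D : ℕ} (hQ : BoxBounded D Q)
    {L : (ι →₀ ℕ) → ℤ} (hL : ∀ u v, L (u + v) = L u + L v) (c : ℤ) :
    IsStep Q D 1 (fun k => L k + c) := by
  intro M b g hg
  have h1 : weigh (fun k => L k + c) g = weigh L g + c • g := by
    ext k
    rw [map_add, coeff_weigh, coeff_weigh, coeff_zsmul]
    ring
  have h2 : Q ^ (M + 1) * weigh (fun k => L k + c) g = Q * weigh L (Q ^ M * g) +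
      (-(M : ℤ)) • (weigh L Q * (Q ^ M * g)) + c • (Q * (Q ^ M * g)) := by
    rw [h1, mul_add, pow_succ_mul_weigh hL, mul_smul_comm, pow_succ']
    simp only [mul_assoc]
  rw [h2, one_mul, add_comm b D]
  exact ((hQ.mul (hg.weigh L)).add (((hQ.weigh L).mul hg).smul _)).add ((hQ.mul hg).smul _)

theorem IsStep.one (Q : MvPowerSeries ι ℤ) (D : ℕ) : IsStep Q D 0 (fun _ => 1) := by
  intro M b g hg
  have : weigh (fun _ => 1) g = g := by ext k; rw [coeff_weigh, one_mul]
  simpa [this] using hg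

theorem IsStep.mul {Q : MvPowerSeries ι ℤ} {D s s' : ℕ} {h h' : (ι →₀ ℕ) → ℤ}
    (hs : IsStep Q D s h) (hs' : IsStep Q D s' h') :
    IsStep Q D (s + s') (fun k => h k * h' k) := by
  intro M b g hg
  have h1 : weigh (fun k => h k * h' k) g = weigh h' (weigh h g) := by
    ext k
    rw [coeff_weigh, coeff_weigh, coeff_weigh]
    ring
  have h2 := hs' _ _ _ (hs _ _ _ hg)
  rwa [h1, ← add_assoc, add_mul, ← add_assoc]

theorem IsStep.prod {Q : MvPowerSeries ι ℤ} {D : ℕ} {κ : Type*} (t : Finset κ) {s : κ → ℕ}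
    {h : κ → (ι →₀ ℕ) → ℤ} (hs : ∀ r ∈ t, IsStep Q D (s r) (h r)) :
    IsStep Q D (∑ r ∈ t, s r) (fun k => ∏ r ∈ t, h r k) := by
  classical
  induction t using Finset.induction_on with
  | empty => simpa using IsStep.one Q D
  | insert r t hr ih =>
    simp only [prod_insert hr, sum_insert hr]
    exact (hs r (mem_insert_self r t)).mul (ih fun r' h => hs r' (mem_insert_of_mem h))

theorem IsStep.pow {Q : MvPowerSeries ι ℤ} {D s : ℕ} {h : (ι →₀ ℕ) → ℤ} (hs : IsStep Q D s h)
    (n : ℕ) : IsStep Q D (n * s) (fun k => h k ^ n) := by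
  simpa using IsStep.prod (range n) (s := fun _ => s) (h := fun _ => h) fun _ _ => hs

theorem exists_relation_of_boxBounded [Fintype ι] {E : Type*} [Fintype E]
    {Q : MvPowerSeries ι ℤ} (hQ : Q ≠ 0) (g : E → MvPowerSeries ι ℤ) (M b : ℕ)
    (hg : ∀ e, BoxBounded b (Q ^ M * g e)) (hcard : (b + 1) ^ Fintype.card ι < Fintype.card E) :
    ∃ c : E → ℤ, c ≠ 0 ∧ ∑ e, c e • g e = 0 := by
  classical
  let toExp : (ι → Fin (b + 1)) → ι →₀ ℕ := fun k => Finsupp.equivFunOnFinite.symm fun i => k i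
  obtain ⟨c, hc0, hc, -⟩ := Int.Matrix.exists_ne_zero_int_vec_norm_le
    (Matrix.of fun (k : ι → Fin (b + 1)) (e : E) => coeff (toExp k) (Q ^ M * g e))
    (by simpa using hcard) (by simp)
  refine ⟨c, hc0, ?_⟩
  have hzero : Q ^ M * ∑ e, c e • g e = 0 := by
    ext k
    rw [mul_sum, map_sum, map_zero]
    simp only [mul_smul_comm, coeff_zsmul]
    by_cases hk : ∀ i, k i ≤ b
    · have h := congrFun hc fun i => (⟨k i, Nat.lt_succ_of_le (hk i)⟩ : Fin (b + 1))
      have hexp : toExp (fun i => (⟨k i, Nat.lt_succ_of_le (hk i)⟩ : Fin (b + 1))) = k := by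
        ext i; rfl
      simp only [Matrix.mulVec, dotProduct, Matrix.of_apply, hexp, Pi.zero_apply] at h
      rw [← h]
      exact sum_congr rfl fun e _ => mul_comm _ _
    · refine sum_eq_zero fun e _ => ?_
      have : coeff k (Q ^ M * g e) = 0 := by
        by_contra hne
        exact hk (hg e k hne)
      rw [this, mul_zero]
  exact (mul_eq_zero.mp hzero).resolve_left (pow_ne_zero M hQ)

section Diagonal

variable [Fintype ι] [DecidableEq ι] (o : ι)

/-- The exponent with all entries equal to `n`. -/
noncomputable def diag (n : ℕ) : ι →₀ ℕ := Finsupp.equivFunOnFinite.symm fun _ => n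

/-- Extension by zero of an exponent supported off the distinguished variable `o`. -/
noncomputable def extend (m : {i // i ≠ o} → ℕ) : ι →₀ ℕ :=
  Finsupp.equivFunOnFinite.symm fun i => if h : i ≠ o then m ⟨i, h⟩ else 0

/-- The weight `k_o ^ β ∏_{i ≠ o} (k_i - k_o) (k_i - k_o - 1) ⋯ (k_i - k_o - m_i + 1)`. -/
def diagWeight (β : ℕ) (m : {i // i ≠ o} → ℕ) (k : ι →₀ ℕ) : ℤ :=
  (k o : ℤ) ^ β * ∏ i, ∏ b ∈ range (m i), ((k i : ℤ) - k o - b)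

theorem diagWeight_diag_add_extend (β n : ℕ) (m m' : {i // i ≠ o} → ℕ) :
    diagWeight o β m (diag n + extend o m') =
      (n : ℤ) ^ β * ∏ i, ∏ b ∈ range (m i), ((m' i : ℤ) - b) := by
  have ho : (diag n + extend o m' : ι →₀ ℕ) o = n := by simp [diag, extend]
  have hi : ∀ i : {i // i ≠ o}, (diag n + extend o m' : ι →₀ ℕ) i = n + m' i := by
    intro i
    simp [diag, extend, i.2]
  simp only [diagWeight, ho, hi]
  push_cast
  simp only [add_sub_cancel_left]

theorem isStep_diagWeight {Q : MvPowerSeries ι ℤ} {D : ℕ} (hQ : BoxBounded D Q) (β : ℕ)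
    (m : {i // i ≠ o} → ℕ) : IsStep Q D (β + ∑ i, m i) (diagWeight o β m) := by
  have h1 : IsStep Q D 1 (fun k => (k o : ℤ)) := by
    simpa using IsStep.affine hQ (L := fun k => (k o : ℤ)) (by intro u v; simp) 0
  have h2 : IsStep Q D (∑ i, ∑ b ∈ range (m i), 1)
      (fun k => ∏ i, ∏ b ∈ range (m i), ((k i : ℤ) - k o - b)) := by
    refine IsStep.prod _ fun i _ => IsStep.prod _ fun b _ => ?_
    exact IsStep.affine hQ (L := fun k => (k i : ℤ) - k o)
      (by intro u v; simp only [Finsupp.add_apply]; push_cast; ring) (-(b : ℤ))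
  have h3 := (h1.pow β).mul h2
  simp only [sum_const, card_range, smul_eq_mul, mul_one] at h3
  exact h3

/-- The exponents `α` of the shift along the diagonal, `β` of the multiplication by the
diagonal index, and `m` of the operators transversal to the diagonal. -/
abbrev OperatorIndex (N : ℕ) : Type _ :=
  Fin (N + 1) × Fin (N + 1) × ({i // i ≠ o} → Fin (N + 1))

/-- The image of `f` under the operator of index `e`. -/
noncomputable def operatorTerm {N : ℕ} (f : MvPowerSeries ι ℤ) (e : OperatorIndex o N) : MvPowerSeries ι ℤ :=
  weigh (diagWeight o e.2.1 fun i => e.2.2 i)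
    (monomial (diag (e.1 : ℕ) + extend o fun i => e.2.2 i) 1 * f)

theorem exists_operator_annihilating {P Q f : MvPowerSeries ι ℤ} (hQ0 : Q ≠ 0) {D : ℕ}
    (hP : BoxBounded D P) (hQ : BoxBounded D Q) (h : Q * f = P) :
    ∃ N : ℕ, 1 ≤ N ∧ ∃ c : OperatorIndex o N → ℤ, c ≠ 0 ∧
      ∑ e, c e • operatorTerm o f e = 0 := by
  set d := Fintype.card ι with hd
  have hd_pos : 0 < d := Fintype.card_pos_iff.mpr ⟨o⟩
  have hcard : Fintype.card {i // i ≠ o} = d - 1 := by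
    simp [hd]
  set K := D + 3 + d * D with hK
  set N := K ^ d with hN
  have hN1 : 1 ≤ N := Nat.one_le_pow _ _ (by omega)
  refine ⟨N, hN1, ?_⟩
  refine exists_relation_of_boxBounded hQ0 _ (1 + d * N) (D + 2 * N + d * N * D) ?_ ?_
  · rintro ⟨α, β, m⟩
    have hα : (α : ℕ) ≤ N := Nat.lt_succ_iff.mp α.2
    have hβ : (β : ℕ) ≤ N := Nat.lt_succ_iff.mp β.2
    have hm : ∀ i, (m i : ℕ) ≤ N := fun i => Nat.lt_succ_iff.mp (m i).2
    set s := (β : ℕ) + ∑ i, (m i : ℕ) with hs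
    have hsN : s ≤ d * N := by
      have h1 : ∑ i, (m i : ℕ) ≤ (d - 1) * N := by
        refine (sum_le_sum fun i _ => hm i).trans ?_
        rw [sum_const, card_univ, hcard, smul_eq_mul]
      obtain ⟨d', hd'⟩ : ∃ d', d = d' + 1 := ⟨d - 1, by omega⟩
      rw [hd'] at h1 ⊢
      rw [add_mul, one_mul]
      simp only [add_tsub_cancel_right] at h1
      omega
    obtain ⟨j, hj⟩ := Nat.exists_eq_add_of_le hsN
    have hmon : BoxBounded (2 * N + D)
        (Q ^ 1 * (monomial (diag (α : ℕ) + extend o fun i => (m i : ℕ)) 1 * f)) := by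
      rw [pow_one, mul_left_comm, h]
      refine (BoxBounded.monomial (fun i => ?_) 1).mul hP
      simp only [diag, extend, Finsupp.add_apply, Finsupp.equivFunOnFinite_symm_apply_apply]
      split_ifs with hi
      · have := hm ⟨i, hi⟩
        omega
      · omega
    have hstep := isStep_diagWeight o hQ β (fun i => (m i : ℕ)) _ _ _ hmon
    have hpow : BoxBounded (j * D) (Q ^ j) := by
      simpa using BoxBounded.prod (range j) (b := fun _ => D) (p := fun _ => Q) fun _ _ => hQ
    have hfin := hpow.mul hstep
    rw [← hs, ← mul_assoc, ← pow_add] at hfin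
    have e1 : j + (1 + s) = 1 + d * N := by omega
    have e2 : j * D + (2 * N + D + s * D) = D + 2 * N + d * N * D := by
      rw [hj]; ring
    rw [e1, e2] at hfin
    exact hfin
  · have hE : Fintype.card (OperatorIndex o N) = (N + 1) ^ (d + 1) := by
      simp only [Fintype.card_prod, Fintype.card_fin, Fintype.card_pi, prod_const, card_univ,
        hcard]
      obtain ⟨d', hd'⟩ : ∃ d', d = d' + 1 := ⟨d - 1, by omega⟩
      rw [hd']
      simp only [add_tsub_cancel_right]
      ring
    rw [hE]
    calc (D + 2 * N + d * N * D + 1) ^ d ≤ (K * (N + 1)) ^ d := by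
          refine Nat.pow_le_pow_left ?_ d
          rw [hK]
          nlinarith [Nat.zero_le (D * N), Nat.zero_le (d * D)]
      _ = N * (N + 1) ^ d := by rw [mul_pow]
      _ < (N + 1) * (N + 1) ^ d := Nat.mul_lt_mul_of_pos_right (Nat.lt_succ_self N) (by positivity)
      _ = (N + 1) ^ (d + 1) := by ring

theorem coeff_operatorTerm_of_eq {N : ℕ} (f : MvPowerSeries ι ℤ) (α β : Fin (N + 1))
    (m : {i // i ≠ o} → Fin (N + 1)) {n : ℕ} (hn : N ≤ n) :
    coeff (diag n + extend o fun i => (m i : ℕ)) (operatorTerm o f (α, β, m)) =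
      (∏ i, ((m i : ℕ)! : ℤ)) * ((n : ℤ) ^ (β : ℕ) * coeff (diag (n - α)) f) := by
  have hα : (α : ℕ) ≤ n := (Nat.lt_succ_iff.mp α.2).trans hn
  have hexp : (diag n + extend o fun i => (m i : ℕ)) =
      (diag (α : ℕ) + extend o fun i => (m i : ℕ)) + diag (n - α) := by
    ext i
    simp only [diag, Finsupp.add_apply, Finsupp.equivFunOnFinite_symm_apply_apply]
    omega
  have hfact : ∀ i, ∏ b ∈ range (m i : ℕ), (((m i : ℕ) : ℤ) - b) = ((m i : ℕ)! : ℤ) := by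
    intro i
    rw [← Nat.descFactorial_self, Nat.descFactorial_eq_prod_range, Nat.cast_prod]
    refine prod_congr rfl fun b hb => ?_
    rw [Nat.cast_sub (mem_range.mp hb).le]
  rw [operatorTerm, coeff_weigh, diagWeight_diag_add_extend, hexp, coeff_add_monomial_mul]
  simp only [hfact]
  ring

theorem coeff_operatorTerm_of_lt {N : ℕ} (f : MvPowerSeries ι ℤ) (e : OperatorIndex o N)
    (m : {i // i ≠ o} → ℕ) (n : ℕ) {i : {i // i ≠ o}} (hi : m i < e.2.2 i) :
    coeff (diag n + extend o m) (operatorTerm o f e) = 0 := by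
  rw [operatorTerm, coeff_weigh, diagWeight_diag_add_extend]
  have : ∏ b ∈ range (e.2.2 i : ℕ), ((m i : ℤ) - b) = 0 :=
    prod_eq_zero (mem_range.mpr hi) (sub_self _)
  rw [prod_eq_zero (mem_univ i) this, mul_zero, zero_mul]

/-- The diagonal of a rational power series satisfies a linear recurrence with polynomial
coefficients. -/
theorem exists_diagonal_recurrence (o : ι) {P Q f : MvPowerSeries ι ℤ} (hQ0 : Q ≠ 0) {D : ℕ}
    (hP : BoxBounded D P) (hQ : BoxBounded D Q) (h : Q * f = P) :
    ∃ (N : ℕ) (q : Fin (N + 1) → Polynomial ℤ), 1 ≤ N ∧ (∃ α, q α ≠ 0) ∧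
      ∀ n : ℕ, N ≤ n → ∑ α, (q α).eval (n : ℤ) * coeff (diag (n - α)) f = 0 := by
  obtain ⟨N, hN, c, hc0, hc⟩ := exists_operator_annihilating o hQ0 hP hQ h
  obtain ⟨⟨α₀, β₀, m⟩, he₀, hmin⟩ := exists_min_image (univ.filter fun e => c e ≠ 0)
    (fun e : OperatorIndex o N => ∑ i, (e.2.2 i : ℕ)) (by
      obtain ⟨e, he⟩ := Function.ne_iff.mp hc0
      exact ⟨e, by simpa using he⟩)
  simp only [mem_filter, mem_univ, true_and] at he₀ hmin
  let q : Fin (N + 1) → Polynomial ℤ := fun α =>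
    ∑ β : Fin (N + 1), Polynomial.monomial (β : ℕ) (c (α, β, m))
  refine ⟨N, q, hN, ⟨α₀, fun hq => he₀ ?_⟩, fun n hn => ?_⟩
  · have := congrArg (fun p => Polynomial.coeff p (β₀ : ℕ)) hq
    simpa [q, Polynomial.finsetSum_coeff, Polynomial.coeff_monomial, Fin.val_inj] using this
  · have hk := congrArg (coeff (diag n + extend o fun i => (m i : ℕ))) hc
    rw [map_sum, map_zero] at hk
    simp only [coeff_zsmul, Fintype.sum_prod_type] at hk
    have hcollapse : ∀ α β : Fin (N + 1), ∑ m' : {i // i ≠ o} → Fin (N + 1), c (α, β, m') *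
        coeff (diag n + extend o fun i => (m i : ℕ)) (operatorTerm o f (α, β, m')) =
        c (α, β, m) * ((∏ i, ((m i : ℕ)! : ℤ)) *
          ((n : ℤ) ^ (β : ℕ) * coeff (diag (n - α)) f)) := by
      intro α β
      rw [sum_eq_single m, coeff_operatorTerm_of_eq o f α β m hn]
      · intro m' _ hne
        by_cases hc' : c (α, β, m') = 0
        · rw [hc', zero_mul]
        · have hlt : ∃ i, m i < m' i := by
            by_contra! hle
            refine hne (funext fun i => ?_)
            have hsum := hmin _ hc'
            have := (sum_eq_sum_iff_of_le (s := univ) (f := fun i => (m' i : ℕ))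
              (g := fun i => (m i : ℕ)) fun i _ => hle i).mp
              (le_antisymm (sum_le_sum fun i _ => hle i) hsum) i (mem_univ i)
            exact Fin.ext this
          obtain ⟨i, hi⟩ := hlt
          rw [coeff_operatorTerm_of_lt o f (α, β, m') (fun i => (m i : ℕ)) n (i := i) hi,
            mul_zero]
      · exact fun h => absurd (mem_univ m) h
    simp only [hcollapse] at hk
    have hfac : (∏ i, ((m i : ℕ)! : ℤ)) ≠ 0 :=
      prod_ne_zero_iff.mpr fun i _ => by exact_mod_cast (Nat.factorial_pos _).ne'
    refine (mul_eq_zero.mp ?_).resolve_left hfac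
    rw [mul_sum, ← hk]
    refine sum_congr rfl fun α _ => ?_
    simp only [q, Polynomial.eval_finsetSum, Polynomial.eval_monomial]
    rw [sum_mul, mul_sum]
    exact sum_congr rfl fun β _ => by ring

end Diagonal

end DiagonalRecurrence

namespace CarlitzArray

open MvPowerSeries Finset DiagonalRecurrence

open scoped Classical in
/-- Boundedness of the exponents of a polynomial, viewed as a power series. -/
theorem exists_boxBounded_coe {ι : Type*} (p : MvPolynomial ι ℤ) :
    ∃ b, BoxBounded b (p : MvPowerSeries ι ℤ) := by
  refine ⟨p.totalDegree, fun k hk i => ?_⟩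
  rw [MvPolynomial.coeff_coe] at hk
  exact (MvPolynomial.monomial_le_degreeOf i (MvPolynomial.mem_support_iff.mpr hk)).trans
    (MvPolynomial.degreeOf_le_totalDegree p i)

/-- A word is Carlitz if no two adjacent letters are equal. -/
def IsCarlitz {κ : Type*} {n : ℕ} (w : Fin n → κ) : Prop :=
  ∀ (j : Fin n), ∀ h : (j : ℕ) + 1 < n, w j ≠ w ⟨(j : ℕ) + 1, h⟩

theorem isCarlitz_cons {κ : Type*} {n : ℕ} (a : κ) (w : Fin (n + 1) → κ) :
    IsCarlitz (Fin.cons a w : Fin (n + 2) → κ) ↔ a ≠ w 0 ∧ IsCarlitz w := by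
  constructor
  · intro h
    exact ⟨h 0 (by simp), fun j hj => h j.succ (by simpa using hj)⟩
  · rintro ⟨h0, h⟩ j
    refine Fin.cases (fun _ => h0) (fun j hj => ?_) j
    exact h j (by simpa using hj)

section GeneratingFunction

variable {R κ : Type*} [CommRing R] [Fintype κ] (x : κ → R) (t : R)

open scoped Classical in
/-- The sum of the monomials of all Carlitz words of length `n`. -/
noncomputable def wordSum (n : ℕ) : R :=
  ∑ w : Fin n → κ with IsCarlitz w, ∏ j, x (w j)

/-- The sum of the monomials of all Carlitz words of length `n + 1` with first letter `c`. -/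
def firstLetterSum : ℕ → κ → R
  | 0, c => x c
  | n + 1, c => x c * (∑ c', firstLetterSum n c' - firstLetterSum n c)

open scoped Classical in
theorem firstLetterSum_eq (n : ℕ) (c : κ) :
    firstLetterSum x n c =
      ∑ w : Fin (n + 1) → κ, if w 0 = c ∧ IsCarlitz w then ∏ j, x (w j) else 0 := by
  induction n generalizing c with
  | zero =>
    rw [← (Fin.consEquiv fun _ : Fin 1 => κ).sum_comp, Fintype.sum_prod_type]
    have hC : ∀ w : Fin 1 → κ, IsCarlitz w := fun w j hj => by omega
    simp [firstLetterSum, Fin.consEquiv, hC]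
  | succ n ih =>
    have hsum : ∑ c', firstLetterSum x n c' =
        ∑ w : Fin (n + 1) → κ, if IsCarlitz w then ∏ j, x (w j) else 0 := by
      simp only [ih]
      rw [sum_comm]
      refine sum_congr rfl fun w _ => ?_
      by_cases hw : IsCarlitz w <;> simp [hw]
    rw [← (Fin.consEquiv fun _ : Fin (n + 2) => κ).sum_comp, Fintype.sum_prod_type,
      sum_eq_single c, firstLetterSum, hsum, ih, ← sum_sub_distrib, mul_sum]
    · refine sum_congr rfl fun w _ => ?_
      simp only [Fin.consEquiv, Equiv.coe_fn_mk, isCarlitz_cons, Fin.cons_zero, true_and]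
      rw [Fin.prod_univ_succ fun j => x ((Fin.cons c w : Fin (n + 2) → κ) j)]
      simp only [Fin.cons_zero, Fin.cons_succ]
      by_cases hw : IsCarlitz w <;> by_cases h0 : w 0 = c <;>
        simp [hw, h0, eq_comm (a := c)]
    · intro b _ hb
      refine sum_eq_zero fun w _ => if_neg fun h => hb ?_
      simpa [Fin.consEquiv] using h.1
    · exact fun h => absurd (mem_univ c) h

theorem wordSum_succ (n : ℕ) : wordSum x (n + 1) = ∑ c, firstLetterSum x n c := by
  classical
  simp only [firstLetterSum_eq]
  rw [sum_comm, wordSum, sum_filter]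
  refine sum_congr rfl fun w _ => ?_
  by_cases hw : IsCarlitz w <;> simp [hw]

theorem wordSum_zero : wordSum x 0 = 1 := by
  classical
  have hC : ∀ w : Fin 0 → κ, IsCarlitz w := fun w j => j.elim0
  simp [wordSum, hC]

/-- Numerator of the generating function of Carlitz words. -/
def numer : R := ∏ c, (1 + x c * t)

open scoped Classical in
/-- Denominator of the generating function of Carlitz words. -/
noncomputable def denom : R := numer x t - ∑ c, x c * t * ∏ c' ∈ univ.erase c, (1 + x c' * t)

theorem map_numer {S : Type*} [CommRing S] (φ : R →+* S) :
    φ (numer x t) = numer (fun c => φ (x c)) (φ t) := by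
  simp [numer, map_prod]

theorem map_denom {S : Type*} [CommRing S] (φ : R →+* S) :
    φ (denom x t) = denom (fun c => φ (x c)) (φ t) := by
  simp [denom, map_numer, map_prod, map_sum]

theorem pow_dvd_denom_mul_sub_numer (N : ℕ) :
    t ^ (N + 1) ∣ denom x t * ∑ m ∈ range (N + 1), wordSum x m * t ^ m - numer x t := by
  classical
  set H := ∑ m ∈ range (N + 1), wordSum x m * t ^ m with hH
  let F : κ → R := fun c => ∑ n ∈ range N, firstLetterSum x n c * t ^ (n + 1)
  have hHF : H = ∑ c, F c + 1 := by
    rw [hH, sum_range_succ', wordSum_zero, pow_zero, mul_one, sum_comm]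
    simp only [wordSum_succ, sum_mul]
  have hF : ∀ c, (1 + x c * t) * F c = x c * t * H - firstLetterSum x N c * t ^ (N + 1) := by
    intro c
    have h1 : F c + firstLetterSum x N c * t ^ (N + 1) =
        x c * t + ∑ n ∈ range N, firstLetterSum x (n + 1) c * t ^ (n + 2) := by
      rw [← sum_range_succ (fun n => firstLetterSum x n c * t ^ (n + 1)), sum_range_succ',
        firstLetterSum]
      ring
    have h2 : ∑ n ∈ range N, firstLetterSum x (n + 1) c * t ^ (n + 2) =
        x c * t * (∑ c', F c' - F c) := by
      simp only [F]
      rw [sum_comm, ← sum_sub_distrib, mul_sum]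
      refine sum_congr rfl fun n _ => ?_
      rw [firstLetterSum, ← sum_mul]
      ring
    rw [h2] at h1
    rw [hHF]
    linear_combination h1
  refine ⟨-∑ c, (∏ c' ∈ univ.erase c, (1 + x c' * t)) * firstLetterSum x N c, ?_⟩
  have hP : numer x t * (H - 1) = ∑ c, (∏ c' ∈ univ.erase c, (1 + x c' * t)) *
      (x c * t * H - firstLetterSum x N c * t ^ (N + 1)) := by
    rw [hHF, add_sub_cancel_right, mul_sum]
    refine sum_congr rfl fun c _ => ?_
    rw [← hHF, ← hF, numer, ← mul_prod_erase univ _ (mem_univ c)]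
    ring
  have hsplit : ∑ c, (∏ c' ∈ univ.erase c, (1 + x c' * t)) *
      (x c * t * H - firstLetterSum x N c * t ^ (N + 1)) =
      (∑ c, x c * t * ∏ c' ∈ univ.erase c, (1 + x c' * t)) * H -
      (∑ c, (∏ c' ∈ univ.erase c, (1 + x c' * t)) * firstLetterSum x N c) * t ^ (N + 1) := by
    rw [sum_mul, sum_mul, ← sum_sub_distrib]
    exact sum_congr rfl fun c _ => by ring
  rw [denom]
  linear_combination hP + hsplit

end GeneratingFunction

section Count

variable {ρ κ : Type*}

variable (ρ κ) in
/-- Rational generating function of tuples of Carlitz words indexed by `ρ`; the variable `inl r`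
marks the length of the word of index `r`, and `inr c` marks the occurrences of the letter `c`. -/
noncomputable def tupleSeries [Fintype ρ] [Fintype κ] : MvPowerSeries (ρ ⊕ κ) ℤ :=
  ∏ r : ρ, numer (fun c : κ => X (Sum.inr c)) (X (Sum.inl r)) *
    invOfUnit (denom (fun c : κ => X (Sum.inr c)) (X (Sum.inl r))) 1

theorem denom_mul_invOfUnit [Fintype κ] (r : ρ) :
    denom (fun c : κ => (X (Sum.inr c) : MvPowerSeries (ρ ⊕ κ) ℤ)) (X (Sum.inl r)) *
      invOfUnit (denom (fun c : κ => X (Sum.inr c)) (X (Sum.inl r))) 1 = 1 := by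
  refine mul_invOfUnit _ _ ?_
  rw [map_denom]
  simp [denom, numer]

variable (ρ κ) in
theorem exists_denominator_tupleSeries [Fintype ρ] [Fintype κ] :
    ∃ P Q : MvPolynomial (ρ ⊕ κ) ℤ, Q ≠ 0 ∧
      (Q : MvPowerSeries (ρ ⊕ κ) ℤ) * tupleSeries ρ κ = P := by
  let φ := MvPolynomial.coeToMvPowerSeries.ringHom (σ := ρ ⊕ κ) (R := ℤ)
  let P := ∏ r : ρ, numer (fun c : κ => (MvPolynomial.X (Sum.inr c) : MvPolynomial (ρ ⊕ κ) ℤ))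
    (MvPolynomial.X (Sum.inl r))
  let Q := ∏ r : ρ, denom (fun c : κ => (MvPolynomial.X (Sum.inr c) : MvPolynomial (ρ ⊕ κ) ℤ))
    (MvPolynomial.X (Sum.inl r))
  have hP : φ P = ∏ r : ρ, numer (fun c : κ => X (Sum.inr c)) (X (Sum.inl r)) := by
    simp [P, φ, map_prod, map_numer]
  have hQ : φ Q = ∏ r : ρ, denom (fun c : κ => X (Sum.inr c)) (X (Sum.inl r)) := by
    simp [Q, φ, map_prod, map_denom]
  refine ⟨P, Q, fun h => ?_, ?_⟩
  · have h1 : φ Q * ∏ r : ρ,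
        invOfUnit (denom (fun c : κ => X (Sum.inr c)) (X (Sum.inl r))) 1 = 1 := by
      rw [hQ, ← prod_mul_distrib]
      exact prod_eq_one fun r _ => denom_mul_invOfUnit r
    rw [h, map_zero, zero_mul] at h1
    exact zero_ne_one h1
  · change φ Q * tupleSeries ρ κ = φ P
    rw [hP, hQ, tupleSeries, ← prod_mul_distrib]
    refine prod_congr rfl fun r _ => ?_
    rw [mul_left_comm, denom_mul_invOfUnit, mul_one]

theorem coeff_prod_congr {ι τ : Type*} (s : Finset τ) {A B : τ → MvPowerSeries ι ℤ} {n : ℕ}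
    (h : ∀ r ∈ s, ∀ k : ι →₀ ℕ, (∀ i, k i ≤ n) → coeff k (A r) = coeff k (B r)) (k : ι →₀ ℕ)
    (hk : ∀ i, k i ≤ n) : coeff k (∏ r ∈ s, A r) = coeff k (∏ r ∈ s, B r) := by
  classical
  induction s using Finset.induction_on generalizing k with
  | empty => simp
  | insert r s hr ih =>
    rw [prod_insert hr, prod_insert hr, coeff_mul, coeff_mul]
    refine sum_congr rfl fun u hu => ?_
    rw [HasAntidiagonal.mem_antidiagonal] at hu
    have hu1 : ∀ i, u.1 i ≤ n := fun i => le_trans (by simp [← hu]) (hk i)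
    have hu2 : ∀ i, u.2 i ≤ n := fun i => le_trans (by simp [← hu]) (hk i)
    rw [h r (mem_insert_self r s) _ hu1,
      ih (fun r' hr' => h r' (mem_insert_of_mem hr')) _ hu2]

theorem coeff_tupleSeries [Fintype ρ] [Fintype κ] (n : ℕ) (k : ρ ⊕ κ →₀ ℕ) (hk : ∀ i, k i ≤ n) :
    coeff k (tupleSeries ρ κ) = coeff k (∏ r : ρ, ∑ m ∈ range (n + 1),
      wordSum (fun c : κ => (X (Sum.inr c) : MvPowerSeries (ρ ⊕ κ) ℤ)) m * X (Sum.inl r) ^ m) := by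
  refine coeff_prod_congr univ (fun r _ k hk => ?_) k hk
  have h1 := (pow_dvd_denom_mul_sub_numer
    (fun c : κ => (X (Sum.inr c) : MvPowerSeries (ρ ⊕ κ) ℤ)) (X (Sum.inl r)) n).mul_right
    (invOfUnit (denom (fun c : κ => X (Sum.inr c)) (X (Sum.inl r))) 1)
  rw [sub_mul, mul_right_comm, denom_mul_invOfUnit, one_mul, X_pow_dvd_iff] at h1
  have h2 := h1 k (Nat.lt_succ_of_le (hk _))
  rw [map_sub, sub_eq_zero] at h2
  exact h2.symm

/-- The exponent of the monomial of the word `p.2` of length `p.1` in the row `r`. -/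
noncomputable def wordExponent (r : ρ) (p : Σ m : ℕ, Fin m → κ) : ρ ⊕ κ →₀ ℕ :=
  Finsupp.single (Sum.inl r) p.1 + ∑ j, Finsupp.single (Sum.inr (p.2 j)) 1

theorem sum_wordExponent_inl [Fintype ρ] (p : ρ → Σ m : ℕ, Fin m → κ) (r : ρ) :
    (∑ r', wordExponent r' (p r')) (Sum.inl r) = (p r).1 := by
  classical
  simp [wordExponent, Finsupp.finsetSum_apply, Finsupp.single_apply]

theorem sum_wordExponent_inr [Fintype ρ] [DecidableEq κ] {n : ℕ} (A : ρ × Fin n → κ) (c : κ) :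
    (∑ r, wordExponent r ⟨n, fun j => A (r, j)⟩) (Sum.inr c) = #{q | A q = c} := by
  classical
  rw [card_filter, Fintype.sum_prod_type]
  simp [wordExponent, Finsupp.finsetSum_apply, Finsupp.single_apply]

theorem wordSum_mul_X_pow [Fintype κ] (r : ρ) (m : ℕ) :
    wordSum (fun c : κ => (X (Sum.inr c) : MvPowerSeries (ρ ⊕ κ) ℤ)) m * X (Sum.inl r) ^ m =
      open scoped Classical in
      ∑ w : Fin m → κ with IsCarlitz w, monomial (wordExponent r ⟨m, w⟩) 1 := by
  classical
  rw [wordSum, sum_mul]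
  refine sum_congr rfl fun w _ => ?_
  have h : ∏ j, (X (Sum.inr (w j)) : MvPowerSeries (ρ ⊕ κ) ℤ) =
      monomial (∑ j, Finsupp.single (Sum.inr (w j)) 1) 1 := by
    simp only [X, prod_monomial, prod_const_one]
  rw [h, X_pow_eq, monomial_mul_monomial, wordExponent, mul_one, add_comm]

theorem coeff_diag_tupleSeries [Fintype ρ] [Fintype κ] [DecidableEq κ] (n : ℕ) :
    coeff (diag n) (tupleSeries ρ κ) = (Nat.card {A : ρ × Fin n → κ //
      (∀ c, #{q | A q = c} = n) ∧ ∀ r, IsCarlitz fun j => A (r, j)} : ℤ) := by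
  classical
  rw [coeff_tupleSeries n (diag n) fun i => le_refl n]
  simp only [wordSum_mul_X_pow]
  simp only [Finset.sum_sigma']
  rw [prod_univ_sum, map_sum]
  simp only [prod_monomial, prod_const_one, coeff_monomial]
  rw [sum_boole, Nat.card_eq_fintype_card, Fintype.card_subtype, Nat.cast_inj, eq_comm]
  refine card_bij (fun A _ r => ⟨n, fun j => A (r, j)⟩) ?_ ?_ ?_
  · intro A hA
    simp only [mem_filter, mem_univ, true_and] at hA
    simp only [mem_filter, Fintype.mem_piFinset, mem_sigma, mem_range, mem_univ, true_and]
    refine ⟨fun r => ⟨n.lt_succ_self, hA.2 r⟩, ?_⟩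
    ext (r | c)
    · rw [sum_wordExponent_inl]; rfl
    · rw [sum_wordExponent_inr, hA.1]; rfl
  · intro A _ B _ h
    ext ⟨r, j⟩
    have h1 := congrFun h r
    simp only [Sigma.mk.injEq, heq_eq_eq, true_and] at h1
    exact congrFun h1 j
  · intro p hp
    simp only [mem_filter, Fintype.mem_piFinset, mem_sigma, mem_range, mem_univ, true_and] at hp
    obtain ⟨hp, hexp⟩ := hp
    have hlen : ∀ r, ∃ w : Fin n → κ, p r = ⟨n, w⟩ := by
      intro r
      have h1 := congrArg (fun e => e (Sum.inl r)) hexp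
      simp only [sum_wordExponent_inl] at h1
      have hsigma : ∀ p : Σ m : ℕ, Fin m → κ, n = p.1 → ∃ w : Fin n → κ, p = ⟨n, w⟩ := by
        rintro ⟨m, w⟩ rfl
        exact ⟨w, rfl⟩
      exact hsigma _ h1
    choose w hw using hlen
    have hpw : p = fun r => ⟨n, w r⟩ := funext hw
    subst hpw
    refine ⟨fun q => w q.1 q.2, ?_, rfl⟩
    simp only [mem_filter, mem_univ, true_and]
    refine ⟨fun c => ?_, fun r => (hp r).2⟩
    rw [← sum_wordExponent_inr, ← hexp]
    rfl

end Count

end CarlitzArray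

namespace CanonicalArray

open Finset

variable {n : ℕ}

/-- The position of the first occurrence, in row-major order, of the value `v` in a surjective
array. -/
noncomputable def firstPos {A : Fin 4 × Fin n → Fin 4} (hA : Function.Surjective A) (v : Fin 4) :
    Fin 4 ×ₗ Fin n :=
  ({q | A q = v} : Finset (Fin 4 × Fin n)).image toLex |>.min' (by
    obtain ⟨q, hq⟩ := hA v
    exact ⟨toLex q, mem_image_of_mem _ (by simpa using hq)⟩)

theorem apply_firstPos {A : Fin 4 × Fin n → Fin 4} (hA : Function.Surjective A) (v : Fin 4) :
    A (ofLex (firstPos hA v)) = v := by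
  have h := min'_mem (({q | A q = v} : Finset (Fin 4 × Fin n)).image toLex) (by
    obtain ⟨q, hq⟩ := hA v
    exact ⟨toLex q, mem_image_of_mem _ (by simpa using hq)⟩)
  obtain ⟨q, hq, hq'⟩ := mem_image.mp h
  rw [firstPos, ← hq']
  simpa using hq

theorem firstPos_le {A : Fin 4 × Fin n → Fin 4} (hA : Function.Surjective A)
    (q : Fin 4 × Fin n) : firstPos hA (A q) ≤ toLex q :=
  min'_le _ _ (mem_image_of_mem _ (by simp))

theorem firstPos_perm_comp {A : Fin 4 × Fin n → Fin 4} (hA : Function.Surjective A)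
    (σ : Equiv.Perm (Fin 4)) (hσA : Function.Surjective (σ ∘ A)) (v : Fin 4) :
    firstPos hσA (σ v) = firstPos hA v := by
  apply le_antisymm
  · have h := firstPos_le hσA (ofLex (firstPos hA v))
    rwa [Function.comp_apply, apply_firstPos hA, toLex_ofLex] at h
  · have h := firstPos_le hA (ofLex (firstPos hσA (σ v)))
    have h' : A (ofLex (firstPos hσA (σ v))) = v := σ.injective (apply_firstPos hσA (σ v))
    rwa [h', toLex_ofLex] at h

/-- Values are introduced in row-major order. -/
def IsCanonical (A : Fin 4 × Fin n → Fin 4) : Prop :=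
  ∀ p : Fin 4 × Fin n, 0 < (A p : ℕ) →
    ∃ q : Fin 4 × Fin n,
      ((q.1 : ℕ) < (p.1 : ℕ) ∨ (q.1 = p.1 ∧ (q.2 : ℕ) < (p.2 : ℕ))) ∧
      (A q : ℕ) = (A p : ℕ) - 1

theorem isCanonical_iff {A : Fin 4 × Fin n → Fin 4} (hA : Function.Surjective A) :
    IsCanonical A ↔ StrictMono (firstPos hA) := by
  have hlex : ∀ p q : Fin 4 × Fin n, ((q.1 : ℕ) < (p.1 : ℕ) ∨ (q.1 = p.1 ∧ (q.2 : ℕ) < (p.2 : ℕ))) ↔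
      toLex q < toLex p := fun p q => by
    rw [Prod.Lex.toLex_lt_toLex]
    rfl
  simp only [IsCanonical, hlex]
  rw [Fin.strictMono_iff_lt_succ]
  constructor
  · intro h i
    obtain ⟨q, hq, hqv⟩ := h (ofLex (firstPos hA i.succ)) (by rw [apply_firstPos hA]; simp)
    rw [apply_firstPos hA] at hqv
    have hq' : A q = i.castSucc := Fin.ext (by simpa using hqv)
    have h1 := firstPos_le hA q
    rw [hq'] at h1
    exact h1.trans_lt hq
  · intro h p hp
    obtain ⟨i, hi⟩ := Fin.exists_succ_eq.mpr (fun h0 : A p = 0 => by simp [h0] at hp)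
    refine ⟨ofLex (firstPos hA i.castSucc), ?_, ?_⟩
    · refine (h i).trans_le ?_
      rw [hi]
      exact firstPos_le hA p
    · rw [apply_firstPos hA, ← hi]
      simp

theorem firstPos_injective {A : Fin 4 × Fin n → Fin 4} (hA : Function.Surjective A) :
    Function.Injective (firstPos hA) := fun v w h => by
  rw [← apply_firstPos hA v, h, apply_firstPos hA]

/-- Each orbit of surjective arrays under renaming of values has one canonical element. -/
theorem card_eq_mul_card_canonical (S : (Fin 4 × Fin n → Fin 4) → Prop)
    (hsurj : ∀ A, S A → Function.Surjective A)
    (hperm : ∀ (σ : Equiv.Perm (Fin 4)) A, S A → S (σ ∘ A)) :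
    Nat.card {A // S A} = 24 * Nat.card {A // S A ∧ IsCanonical A} := by
  let φ : Equiv.Perm (Fin 4) × {A // S A ∧ IsCanonical A} → {A // S A} :=
    fun x => ⟨x.1 ∘ x.2.1, hperm _ _ x.2.2.1⟩
  have hφ : Function.Bijective φ := by
    constructor
    · rintro ⟨σ, A, hA, hAc⟩ ⟨τ, B, hB, hBc⟩ h
      have hAB : σ ∘ A = τ ∘ B := congrArg Subtype.val h
      have hσA := hsurj _ (hperm σ A hA)
      have hA' := hsurj A hA
      have hB' := hsurj B hB
      have e1 : firstPos hσA ∘ σ = firstPos hA' := funext (firstPos_perm_comp hA' σ hσA)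
      have e2 : ∀ (C : Fin 4 × Fin n → Fin 4) (hC : Function.Surjective C), C = τ ∘ B →
          firstPos hC ∘ τ = firstPos hB' := by
        rintro _ hC rfl
        exact funext (firstPos_perm_comp hB' τ hC)
      have hmono := Tuple.unique_monotone (e1 ▸ ((isCanonical_iff hA').mp hAc).monotone)
        (e2 _ hσA hAB ▸ ((isCanonical_iff hB').mp hBc).monotone)
      have hστ : σ = τ := Equiv.ext fun v => firstPos_injective hσA (congrFun hmono v)
      subst hστ
      have : A = B := funext fun q => σ.injective (congrFun hAB q)
      subst this
      rfl
    · rintro ⟨B, hB⟩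
      have hB' := hsurj B hB
      let σ := Tuple.sort (firstPos hB')
      have hσ : StrictMono (firstPos hB' ∘ σ) :=
        (Tuple.monotone_sort _).strictMono_of_injective
          ((firstPos_injective hB').comp σ.injective)
      have hA := hperm σ.symm B hB
      have hA' := hsurj _ hA
      refine ⟨⟨σ, σ.symm ∘ B, hA, (isCanonical_iff hA').mpr ?_⟩, ?_⟩
      · convert hσ using 1
        funext v
        have := firstPos_perm_comp hB' σ.symm hA' (σ v)
        simpa using this
      · apply Subtype.ext
        funext q
        simp [φ]
  rw [← Nat.card_congr (Equiv.ofBijective φ hφ), Nat.card_prod]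
  congr 1
  rw [Nat.card_eq_fintype_card, Fintype.card_perm, Fintype.card_fin]
  rfl

end CanonicalArray

open CarlitzArray CanonicalArray DiagonalRecurrence in
theorem coeff_diag_tupleSeries_eq (n : ℕ) (hn : 1 ≤ n) :
    MvPowerSeries.coeff (diag n) (tupleSeries (Fin 4) (Fin 4)) = 24 * (a264947 n : ℤ) := by
  rw [coeff_diag_tupleSeries, card_eq_mul_card_canonical, a264947]
  · push_cast
    simp only [and_assoc]
    rfl
  · rintro A ⟨hA, -⟩ v
    have hpos : 0 < (Finset.univ.filter fun q => A q = v).card := by rw [hA v]; exact hn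
    obtain ⟨q, hq⟩ := Finset.card_pos.mp hpos
    exact ⟨q, by simpa using hq⟩
  · rintro σ A ⟨hA, hC⟩
    refine ⟨fun v => ?_, fun r j hj h => hC r j hj (σ.injective h)⟩
    refine Eq.trans ?_ (hA (σ.symm v))
    simp [Equiv.eq_symm_apply]

/-- The sequence `a264947` is D-finite: there are `r ≥ 1` and polynomials
`p₀, …, p_r ∈ ℤ[x]`, not all zero, with
`p₀(n)·a(n) + ⋯ + p_r(n)·a(n+r) = 0` for all `n ≥ 1`. -/
theorem stmt8 :
    ∃ (r : ℕ) (p : ℕ → Polynomial ℤ), 1 ≤ r ∧ (∃ i, i ≤ r ∧ p i ≠ 0) ∧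
      ∀ n : ℕ, 1 ≤ n →
        ∑ i ∈ Finset.range (r + 1), (p i).eval (n : ℤ) * (a264947 (n + i) : ℤ) = 0 := by
  obtain ⟨P, Q, hQ0, h⟩ := CarlitzArray.exists_denominator_tupleSeries (Fin 4) (Fin 4)
  obtain ⟨bP, hP⟩ := CarlitzArray.exists_boxBounded_coe P
  obtain ⟨bQ, hQ⟩ := CarlitzArray.exists_boxBounded_coe Q
  obtain ⟨N, q, hN, ⟨α, hα⟩, hrec⟩ := DiagonalRecurrence.exists_diagonal_recurrence (Sum.inl 0)
    (by exact_mod_cast hQ0) (hP.mono (le_max_left bP bQ)) (hQ.mono (le_max_right bP bQ)) h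
  refine ⟨N, fun i => (q (Fin.ofNat (N + 1) (N - i))).comp (Polynomial.X + Polynomial.C (N : ℤ)),
    hN, ⟨N - α, Nat.sub_le _ _, fun h0 => hα ?_⟩, fun n hn => ?_⟩
  · have hα' : Fin.ofNat (N + 1) (N - (N - α)) = α := by
      apply Fin.ext
      simp only [Fin.ofNat]
      rw [Nat.sub_sub_self (Nat.lt_succ_iff.mp α.2), Nat.mod_eq_of_lt α.2]
    simp only [hα'] at h0
    have := congrArg (fun p => p.comp (Polynomial.X - Polynomial.C (N : ℤ))) h0
    simpa [Polynomial.comp_assoc] using this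
  · have h1 := hrec (n + N) (Nat.le_add_left _ _)
    rw [← Finset.sum_range_reflect, Finset.sum_range]
    refine (mul_eq_zero.mp (?_ : (24 : ℤ) * _ = 0)).resolve_left (by norm_num)
    rw [← h1, Finset.mul_sum]
    refine Finset.sum_congr rfl fun i _ => ?_
    have hi : (i : ℕ) ≤ N := Nat.lt_succ_iff.mp i.2
    have hi' : Fin.ofNat (N + 1) (N - (N + 1 - 1 - i)) = i := by
      apply Fin.ext
      simp only [Fin.ofNat]
      rw [Nat.add_sub_cancel, Nat.sub_sub_self hi, Nat.mod_eq_of_lt i.2]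
    have hidx : n + N - i = n + (N + 1 - 1 - i) := by omega
    rw [hidx, coeff_diag_tupleSeries_eq _ (by omega)]
    beta_reduce
    rw [hi']
    simp only [Polynomial.eval_comp, Polynomial.eval_add, Polynomial.eval_X, Polynomial.eval_C]
    push_cast
    ring
end

section
/- There exist polynomials p0, …, p6 ∈ ℤ[x], each of degree at most 6 and with p6 ≠ 0, such that p0(n)·a(n) + p1(n)·a(n+1) + ⋯ + p6(n)·a(n+6) = 0 for all integers n ≥ 1. In particular, the sequence a is D-finite. -/
/-- `a265234 n` is the number of `4 × n` arrays with entries in `{0,1,2,3}` such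
that each of the four values occurs exactly `n` times, no two vertically
adjacent entries are equal, and values are introduced in row-major order
(OEIS A265234). -/
noncomputable def a265234 (n : ℕ) : ℕ :=
  Nat.card {A : Fin 4 × Fin n → Fin 4 //
    (∀ v : Fin 4, (Finset.filter (fun p => A p = v) Finset.univ).card = n) ∧
    (∀ (i : Fin 4) (j : Fin n), ∀ h : (i : ℕ) + 1 < 4,
      A (i, j) ≠ A (⟨(i : ℕ) + 1, h⟩, j)) ∧
    (∀ p : Fin 4 × Fin n, 0 < (A p : ℕ) →
      ∃ q : Fin 4 × Fin n,
        ((q.1 : ℕ) < (p.1 : ℕ) ∨ (q.1 = p.1 ∧ (q.2 : ℕ) < (p.2 : ℕ))) ∧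
        (A q : ℕ) = (A p : ℕ) - 1)}

/-- Horner evaluation at `x` of the polynomial with the given coefficients, in increasing order. -/
def hornerEval {R : Type*} [CommRing R] (x : R) (l : List ℤ) : R :=
  l.foldr (fun (c : ℤ) s => (c : R) + x * s) 0

/-- The coefficients, in increasing order, of the `k`-th polynomial of the recurrence. -/
def recurrenceCoeffs : ℕ → List ℤ
  | 0 =>
    [0, -28292795596800, -71216912793600, -66544365404160, -29163428904960, -6006923919360,
     -463743221760]
  | 1 =>
    [50877345300480, 162160722247680, 204179162628096, 129972091944960, 44149678571520,
     7587661086720, 514288779264]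
  | 2 =>
    [-53268415119360, -135260793077760, -137704751235072, -72253872095232, -20659064045568,
     -3054693138432, -182348414976]
  | 3 =>
    [12191467438080, 28533930393600, 25720422137856, 11732971438080, 2894091173888,
     368630366208, 19029557248]
  | 4 =>
    [1023982387200, 2047548149760, 1698953175040, 747846770688, 183756021760, 23833006080,
     1271136256]
  | 5 =>
    [-388823040000, -808434094080, -630488107008, -247038275584, -52379842560, -5764202496,
     -258998272]
  | 6 =>
    [8977920000, 18180992000, 13521254400, 5000028160, 993925120, 102036480, 4259840]
  | _ => []

/-- The coefficient of `x ^ a` in the certificate for the recurrence. -/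
def certCoeff {R : Type*} [CommRing R] (y z m : R) : ℕ → R
  | 0 =>
    hornerEval m [109952424010944, 171390114405504, 78639867903744, 14470723118592,
     940809093120] * (y + z) +
    hornerEval m [157680681616320, 331921760804832, 245540154141504, 81977558924160,
     12744221717760, 752518840320] * (y ^ 2 * z + y * z ^ 2) +
    hornerEval m [24193439163264, 43303432980864, 24603612451584, 5734235707392, 517225512960,
     8996782080] * (y ^ 3 + z ^ 3) +
    hornerEval m [10096966726824, 28390487966520, 26063127001680, 10297089764640, 1831048340160,
     120930201600] * (y ^ 3 * z ^ 2 + y ^ 2 * z ^ 3) +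
    hornerEval m [-403998874464] * (y ^ 4 * z + y * z ^ 4) +
    hornerEval m [39671269716] * (y ^ 4 * z ^ 3 + y ^ 3 * z ^ 4) +
    hornerEval m [-48591448560] * (y ^ 5 + z ^ 5) +
    hornerEval m [157616295] * (y ^ 5 * z ^ 4 + y ^ 4 * z ^ 5) +
    hornerEval m [-2115076176] * (y ^ 6 * z + y * z ^ 6) +
    hornerEval m [-179140080] * (y ^ 7 + z ^ 7) +
    hornerEval m [-10428480] * (y ^ 8 * z + y * z ^ 8) +
    hornerEval m [-869040] * (y ^ 9 + z ^ 9)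
  | 1 =>
    hornerEval m [3563539660800, 7581899980800, 4415088328704, 1000115011584, 78517370880] +
    hornerEval m [333084121252704, 551966658811776, 288456176281344, 67289178276864,
     7350722535936, 311312941056] * (y * z) +
    hornerEval m [27505179268992, 2993943468384, -45514874174400, -28001925655680,
     -5925389832960, -424684535808] * (y ^ 2 + z ^ 2) +
    hornerEval m [229861753514784, 445201633274832, 295909128077664, 89481313942848,
     12670214510720, 682418806784] * (y ^ 2 * z ^ 2) +
    hornerEval m [62014161110640, 121690551827064, 79202548025040, 22322109177312,
     2761242259776, 117236600832] * (y ^ 3 * z + y * z ^ 3) +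
    hornerEval m [42733191381264, 87944652247320, 64617826352592, 22127747701248, 3605874242880,
     226314915840] * (y ^ 3 * z ^ 3) +
    hornerEval m [714198813216, -439151716464, -2914721890336, -2075731894976, -516929329280,
     -42999783424] * (y ^ 4 + z ^ 4) +
    hornerEval m [17420377099996, 37932683321620, 29495448253744, 10536072444576, 1765873516160,
     112758497280] * (y ^ 4 * z ^ 2 + y ^ 2 * z ^ 4) +
    hornerEval m [-335999612440, -902566664300, -844507726100, -343308392200, -63034452000,
     -4303104000] * (y ^ 4 * z ^ 4) +
    hornerEval m [-54191823180] * (y ^ 5 * z + y * z ^ 5) +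
    hornerEval m [1500495525] * (y ^ 5 * z ^ 3 + y ^ 3 * z ^ 5) +
    hornerEval m [-2329875792] * (y ^ 6 + z ^ 6) +
    hornerEval m [-453206700] * (y ^ 6 * z ^ 2 + y ^ 2 * z ^ 6) +
    hornerEval m [-142734060] * (y ^ 7 * z + y * z ^ 7) +
    hornerEval m [-10428480] * (y ^ 8 + z ^ 8)
  | 2 =>
    hornerEval m [-55624434873408, -134846030387616, -116707366176192, -43280738518656,
     -7232743674624, -450202681344] * (y + z) +
    hornerEval m [137060665497192, 221702657193912, 108009160597392, 22013225046048,
     1873678213056, 48152752128] * (y ^ 2 * z + y * z ^ 2) +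
    hornerEval m [-4603253807328, -15065356324176, -17567293581216, -8258872666368,
     -1663160918016, -120577327104] * (y ^ 3 + z ^ 3) +
    hornerEval m [96489605772792, 182878402328940, 119041100607840, 35438098965792,
     4956022079424, 264095969280] * (y ^ 3 * z ^ 2 + y ^ 2 * z ^ 3) +
    hornerEval m [13394210394924, 25691279440692, 16099163386368, 4128225351840, 403861431168,
     7260364800] * (y ^ 4 * z + y * z ^ 4) +
    hornerEval m [11665097036280, 23046910085460, 16286933616540, 5433519135000, 873707284320,
     54650419200] * (y ^ 4 * z ^ 3 + y ^ 3 * z ^ 4) +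
    hornerEval m [278003933040, 565117886904, 363422304048, 100063377888, 11865816768,
     457666560] * (y ^ 5 + z ^ 5) +
    hornerEval m [3052259291925, 6068798369100, 4272328308780, 1386473153040, 212117658480,
     12409113600] * (y ^ 5 * z ^ 2 + y ^ 2 * z ^ 5) +
    hornerEval m [-770773140] * (y ^ 6 * z + y * z ^ 6) +
    hornerEval m [-52121160] * (y ^ 7 + z ^ 7)
  | 3 =>
    hornerEval m [-11563955152128, -25145173643904, -18500166375168, -5378952012288,
     -630537682944, -21755854848] +
    hornerEval m [-33012782120112, -81471879046464, -70822288713216, -25225669270272,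
     -3869412139008, -210299781120] * (y * z) +
    hornerEval m [-18156366151152, -35317340570064, -25464768565984, -8877416478528,
     -1497795118976, -97779408896] * (y ^ 2 + z ^ 2) +
    hornerEval m [73417351247664, 125326830889792, 68698003675488, 16706732581248,
     1857124592960, 75855663104] * (y ^ 2 * z ^ 2) +
    hornerEval m [37288324831728, 64734556546500, 35737257632160, 8195281360032, 727284190464,
     11521376256] * (y ^ 3 * z + y * z ^ 3) +
    hornerEval m [27751071245580, 52721946928620, 35141491346220, 10963815089400, 1644473769120,
     96096798720] * (y ^ 3 * z ^ 3) +
    hornerEval m [1358120212180, 2248602164904, 1066292473392, 194012172544, 10835994624,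
     -223215616] * (y ^ 4 + z ^ 4) +
    hornerEval m [16328423903110, 30966882626760, 20479451320960, 6257751970920, 906351487600,
     50463329280] * (y ^ 4 * z ^ 2 + y ^ 2 * z ^ 4) +
    hornerEval m [2592280320945, 5084472841740, 3522880449120, 1129182909240, 171286867440,
     9966627840] * (y ^ 5 * z + y * z ^ 5) +
    hornerEval m [205895514480, 400287755600, 274319615480, 87183658560, 13151638240, 762910720]
     * (y ^ 6 + z ^ 6)
  | 4 =>
    hornerEval m [-9380535327936, -17211655016640, -10974480083712, -3235530168576,
     -452529192960, -24332206080] * (y + z) +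
    hornerEval m [6407225332188, 8560208427840, 1771853211600, -710266188480, -279495410688,
     -24963514368] * (y ^ 2 * z + y * z ^ 2) +
    hornerEval m [932971356468, 1431811363080, 480636569232, -19408812000, -28344927936,
     -3049353216] * (y ^ 3 + z ^ 3) +
    hornerEval m [17883556546635, 32715816197400, 20532999949020, 5942882351880, 817201401120,
     43366901760] * (y ^ 3 * z ^ 2 + y ^ 2 * z ^ 3) +
    hornerEval m [7056688859985, 13183429270860, 8542850127000, 2562032337720, 365491573200,
     20123550720] * (y ^ 4 * z + y * z ^ 4) +
    hornerEval m [783772416000, 1471306407360, 960303021360, 290420179200, 41806315200,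
     2323476480] * (y ^ 5 + z ^ 5)
  | 5 =>
    hornerEval m [-899954604096, -1652463034368, -1044491546624, -305201979392, -42423533568,
     -2276458496] +
    hornerEval m [-1369808603088, -2598456527424, -1850933052672, -621918150912, -99569952768,
     -6129057792] * (y * z) +
    hornerEval m [-245221837016, -586179339408, -563476192448, -234529535808, -43445948416,
     -2958032896] * (y ^ 2 + z ^ 2) +
    hornerEval m [7033006137800, 12749236267680, 7888481954160, 2246405322880, 303621489600,
     15828234240] * (y ^ 2 * z ^ 2) +
    hornerEval m [4534234986570, 8220268940400, 5087189662560, 1448945826240, 195869831040,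
     10212433920] * (y ^ 3 * z + y * z ^ 3) +
    hornerEval m [887715523680, 1638022189040, 1041970564200, 306328424640, 42842419360,
     2314291200] * (y ^ 4 + z ^ 4)
  | 6 =>
    hornerEval m [-136544079360, -257578818240, -180375372288, -59591642880, -9406365696,
     -572522496] * (y + z) +
    hornerEval m [1346728781160, 2447010365280, 1519426966320, 434343761280, 58931970240,
     3083857920] * (y ^ 2 * z + y * z ^ 2) +
    hornerEval m [423267137640, 769211669760, 477766918800, 136613975040, 18540724800,
     970444800] * (y ^ 3 + z ^ 3)
  | 7 =>
    hornerEval m [-10906044480, -20533724160, -14266648576, -4673936384, -732319744, -44302336]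
     +
    hornerEval m [218839407120, 398327612640, 247997666880, 71104890240, 9677441280, 507985920]
     * (y * z) +
    hornerEval m [106615407120, 194071422320, 120841719840, 34651162560, 4716549760, 247603200]
     * (y ^ 2 + z ^ 2)
  | 8 =>
    hornerEval m [14963296560, 27275740320, 17020328640, 4892557440, 667680000, 35143680] * (y +
     z)
  | 9 =>
    hornerEval m [897792000, 1638540800, 1024417280, 295119360, 40368640, 2129920]
  | _ => 0

/-- Half of the Laurent polynomial of a column, in terms of `x`, `y`, `z`, where `x = t + t⁻¹`
and so on. -/
def columnPoly {R : Type*} [CommRing R] (x y z : R) : R :=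
  6 + (x + y + z) ^ 2 + (x * y + x * z + y * z)

/-- If `e` does not depend on `x = t + t⁻¹` and `θ = t d/dt`, this is `columnPoly x y z ^ (1 - m)`
times `θ ((t - t⁻¹) * x ^ a * e * columnPoly x y z ^ m)`. -/
def exactTerm {R : Type*} [CommRing R] (x y z m : R) (a : ℕ) (e : R) : R :=
  (columnPoly x y z * ((a + 1) * x ^ (a + 1) - 4 * a * x ^ (a - 1)) +
    m * (x ^ 2 - 4) * x ^ a * (2 * x + 3 * y + 3 * z)) * e

/-- The exact expression associated with the certificate. -/
def exactSum {R : Type*} [CommRing R] (x y z m : R) : R :=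
  ∑ a ∈ Finset.range 10, exactTerm x y z m a (certCoeff y z m a)

set_option maxRecDepth 10000 in
set_option maxHeartbeats 4000000 in
-- a polynomial identity in four variables with several hundred terms
theorem sum_recurrence_mul_columnPoly_pow {R : Type*} [CommRing R] (x y z m : R) :
    ∑ k ∈ Finset.range 7, hornerEval m (recurrenceCoeffs k) * columnPoly x y z ^ k =
      exactSum x y z m + exactSum y x z m + exactSum z x y m := by
  simp only [exactSum, exactTerm, Finset.sum_range_succ, Finset.sum_range_zero, recurrenceCoeffs,
    certCoeff, columnPoly, hornerEval, List.foldr_cons, List.foldr_nil]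
  push_cast
  ring

theorem hornerEval_cons {R : Type*} [CommRing R] (x : R) (c : ℤ) (l : List ℤ) :
    hornerEval x (c :: l) = c + x * hornerEval x l := rfl

section Moments

variable {A : Type*} [CommRing A] (D : Derivation ℤ A A)

theorem derivation_hornerEval {m : A} (hm : D m = 0) (l : List ℤ) : D (hornerEval m l) = 0 := by
  induction l with
  | nil => simp [hornerEval]
  | cons c l ih =>
    simp [hornerEval_cons, ih, hm]

theorem derivation_certCoeff {y z m : A} (hy : D y = 0) (hz : D z = 0) (hm : D m = 0) (a : ℕ) :
    D (certCoeff y z m a) = 0 := by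
  unfold certCoeff
  split <;> simp [derivation_hornerEval D hm, Derivation.leibniz_pow, hy, hz]

theorem map_exactTerm_mul_pow (φ : A →ₗ[ℤ] ℤ) (hφ : ∀ f, φ (D f) = 0) {x y z t e : A} {κ : ℤ}
    (hκ : κ ≠ 0) (hx : D x = t) (ht : D t = κ * x) (ht2 : t ^ 2 = κ * (x ^ 2 - 4))
    (hy : D y = 0) (hz : D z = 0) (he : D e = 0) (a n : ℕ) :
    φ (exactTerm x y z (n + 1) a e * columnPoly x y z ^ n) = 0 := by
  have hQ : D (columnPoly x y z) = (2 * x + 3 * y + 3 * z) * t := by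
    have h6 : D (6 : A) = 0 := D.map_natCast 6
    simp only [columnPoly, map_add, h6, hx, hy, hz, Derivation.leibniz, Derivation.leibniz_pow,
      smul_eq_mul, nsmul_eq_mul]
    push_cast
    ring
  have key : D (t * x ^ a * e * columnPoly x y z ^ (n + 1)) =
      κ • (exactTerm x y z (n + 1) a e * columnPoly x y z ^ n) := by
    simp only [Derivation.leibniz, Derivation.leibniz_pow, hQ, hx, ht, he, smul_eq_mul,
      nsmul_eq_mul, zsmul_eq_mul, exactTerm, Nat.add_sub_cancel]
    rcases a with _ | a
    · push_cast
      simp only [pow_zero, zero_add, pow_one]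
      linear_combination (2 * x + 3 * y + 3 * z) * e * (n + 1) * columnPoly x y z ^ n * ht2
    · simp only [Nat.add_sub_cancel]
      push_cast
      linear_combination ((2 * x + 3 * y + 3 * z) * e * (n + 1) * columnPoly x y z ^ n * x ^ (a + 1)
        + (a + 1) * x ^ a * e * columnPoly x y z ^ (n + 1)) * ht2
  have h := hφ (t * x ^ a * e * columnPoly x y z ^ (n + 1))
  rw [key, map_smul, smul_eq_mul] at h
  exact (mul_eq_zero.mp h).resolve_left hκ

theorem map_exactSum_mul_pow (φ : A →ₗ[ℤ] ℤ) (hφ : ∀ f, φ (D f) = 0) {x y z t : A} {κ : ℤ}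
    (hκ : κ ≠ 0) (hx : D x = t) (ht : D t = κ * x) (ht2 : t ^ 2 = κ * (x ^ 2 - 4))
    (hy : D y = 0) (hz : D z = 0) (n : ℕ) :
    φ (exactSum x y z (n + 1) * columnPoly x y z ^ n) = 0 := by
  have hm : D ((n : A) + 1) = 0 := by simp
  rw [exactSum, Finset.sum_mul, map_sum]
  exact Finset.sum_eq_zero fun a _ => map_exactTerm_mul_pow D φ hφ hκ hx ht ht2 hy hz
    (derivation_certCoeff D hy hz hm a) a n

end Moments

section LaurentPolynomials

open AddMonoidAlgebra

/-- Laurent polynomials in three variables. -/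
abbrev Laurent : Type := AddMonoidAlgebra ℤ (Fin 3 → ℤ)

/-- The monomial `tᵢ ^ k`. -/
noncomputable def monom (i : Fin 3) (k : ℤ) : Laurent := single (Pi.single i k) 1

theorem monom_mul_monom (i : Fin 3) (k l : ℤ) : monom i k * monom i l = monom i (k + l) := by
  simp [monom, single_mul_single, Pi.single_add]

theorem monom_zero (i : Fin 3) : monom i 0 = 1 := by
  simp [monom, one_def]

/-- The Laurent polynomial `tᵢ ^ 2 + tᵢ ^ (-2)`. -/
noncomputable def cosVar (i : Fin 3) : Laurent := monom i 2 + monom i (-2)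

/-- The constant term. -/
noncomputable def constTerm : Laurent →ₗ[ℤ] ℤ :=
  Finsupp.lapply 0 ∘ₗ (coeffLinearEquiv ℤ).toLinearMap

theorem constTerm_single (v : Fin 3 → ℤ) (r : ℤ) :
    constTerm (single v r) = if v = 0 then r else 0 := by
  simp [constTerm, Finsupp.single_apply]

/-- The Euler operator `tᵢ ∂/∂tᵢ`, as a linear map. -/
noncomputable def eulerLin (i : Fin 3) : Laurent →ₗ[ℤ] Laurent :=
  (coeffLinearEquiv ℤ).symm.toLinearMap ∘ₗ
    Finsupp.lsum ℤ (fun v : Fin 3 → ℤ => v i • Finsupp.lsingle v) ∘ₗ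
      (coeffLinearEquiv ℤ).toLinearMap

theorem eulerLin_single (i : Fin 3) (v : Fin 3 → ℤ) (r : ℤ) :
    eulerLin i (single v r) = single v (v i * r) := by
  ext w
  simp [eulerLin]

/-- The Euler operator `tᵢ ∂/∂tᵢ`. -/
noncomputable def euler (i : Fin 3) : Derivation ℤ Laurent Laurent :=
  Derivation.mk' (eulerLin i) fun f g => by
    induction f using AddMonoidAlgebra.induction_linear with
    | zero => simp
    | add f₁ f₂ h₁ h₂ =>
      simp only [smul_eq_mul] at h₁ h₂ ⊢
      simp only [add_mul, mul_add, map_add, h₁, h₂]; ring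
    | single v r =>
      induction g using AddMonoidAlgebra.induction_linear with
      | zero => simp
      | add g₁ g₂ h₁ h₂ =>
        simp only [smul_eq_mul] at h₁ h₂ ⊢
        simp only [add_mul, mul_add, map_add, h₁, h₂]; ring
      | single w s =>
        simp only [smul_eq_mul, single_mul_single, eulerLin_single, Pi.add_apply]
        rw [add_comm w v, ← single_add]
        congr 1
        ring

theorem euler_single (i : Fin 3) (v : Fin 3 → ℤ) (r : ℤ) :
    euler i (single v r) = single v (v i * r) := eulerLin_single i v r

theorem constTerm_euler (i : Fin 3) (f : Laurent) : constTerm (euler i f) = 0 := by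
  induction f using AddMonoidAlgebra.induction_linear with
  | zero => simp
  | add f g hf hg => simp [hf, hg]
  | single v r =>
    rw [euler_single, constTerm_single]
    split_ifs with h <;> simp [h]

theorem euler_monom_self (i : Fin 3) (k : ℤ) : euler i (monom i k) = k * monom i k := by
  rw [monom, euler_single, ← zsmul_eq_mul, smul_single]
  simp

theorem euler_cosVar_of_ne {i j : Fin 3} (h : i ≠ j) : euler i (cosVar j) = 0 := by
  simp [cosVar, monom, euler_single, h]

theorem euler_cosVar_self (i : Fin 3) :
    euler i (cosVar i) = 2 * (monom i 2 - monom i (-2)) := by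
  simp only [cosVar, map_add, euler_monom_self]
  push_cast
  ring

theorem euler_euler_cosVar_self (i : Fin 3) :
    euler i (2 * (monom i 2 - monom i (-2))) = (4 : ℤ) * cosVar i := by
  have h2 : euler i 2 = 0 := (euler i).map_natCast 2
  simp only [cosVar, Derivation.leibniz, map_sub, h2, euler_monom_self, smul_eq_mul]
  push_cast
  ring

theorem constTerm_exactSum_mul_pow {i j k : Fin 3} (hij : i ≠ j) (hik : i ≠ k) (n : ℕ) :
    constTerm (exactSum (cosVar i) (cosVar j) (cosVar k) (n + 1) *
      columnPoly (cosVar i) (cosVar j) (cosVar k) ^ n) = 0 := by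
  have h : monom i 2 * monom i (-2) = 1 := by rw [monom_mul_monom]; exact monom_zero i
  refine map_exactSum_mul_pow (euler i) constTerm (constTerm_euler i) (κ := 4) (by norm_num)
    (euler_cosVar_self i) (euler_euler_cosVar_self i) ?_ (euler_cosVar_of_ne hij)
    (euler_cosVar_of_ne hik) n
  simp only [cosVar]
  push_cast
  linear_combination (-16) * h

/-- Half of the Laurent polynomial of a column. -/
noncomputable def halfColumn : Laurent := columnPoly (cosVar 0) (cosVar 1) (cosVar 2)

theorem columnPoly_swap {R : Type*} [CommRing R] (x y z : R) :
    columnPoly y x z = columnPoly x y z := by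
  simp only [columnPoly]; ring

theorem columnPoly_rotate {R : Type*} [CommRing R] (x y z : R) :
    columnPoly z x y = columnPoly x y z := by
  simp only [columnPoly]; ring

theorem hornerEval_intCast {R : Type*} [CommRing R] (m : ℤ) (l : List ℤ) :
    hornerEval (m : R) l = ((hornerEval m l : ℤ) : R) := by
  induction l with
  | nil => simp [hornerEval]
  | cons c l ih =>
    simp [hornerEval_cons, ih]

theorem sum_recurrence_mul_constTerm (n : ℕ) :
    ∑ k ∈ Finset.range 7, hornerEval ((n : ℤ) + 1) (recurrenceCoeffs k) *
      constTerm (halfColumn ^ (n + k)) = 0 := by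
  have h₀ := constTerm_exactSum_mul_pow (i := 0) (j := 1) (k := 2) (by decide) (by decide) n
  have h₁ := constTerm_exactSum_mul_pow (i := 1) (j := 0) (k := 2) (by decide) (by decide) n
  have h₂ := constTerm_exactSum_mul_pow (i := 2) (j := 0) (k := 1) (by decide) (by decide) n
  rw [columnPoly_swap] at h₁
  rw [columnPoly_rotate] at h₂
  have h := congrArg (fun f => constTerm (f * halfColumn ^ n))
    (sum_recurrence_mul_columnPoly_pow (cosVar 0) (cosVar 1) (cosVar 2) ((n : Laurent) + 1))
  simp only [add_mul, map_add, halfColumn, h₀, h₁, h₂, add_zero, Finset.sum_mul, map_sum] at h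
  rw [← h]
  refine Finset.sum_congr rfl fun k _ => ?_
  have hc : hornerEval ((n : Laurent) + 1) (recurrenceCoeffs k) =
      ((hornerEval ((n : ℤ) + 1) (recurrenceCoeffs k) : ℤ) : Laurent) := by
    rw [← hornerEval_intCast]; push_cast; rfl
  rw [hc, mul_assoc, ← pow_add, add_comm k n, ← zsmul_eq_mul, map_smul, smul_eq_mul]
  rfl

end LaurentPolynomials

section Counting

open AddMonoidAlgebra

/-- No two adjacent entries of a column are equal. -/
abbrev IsProperColumn (w : Fin 4 → Fin 4) : Prop := w 0 ≠ w 1 ∧ w 1 ≠ w 2 ∧ w 2 ≠ w 3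

/-- The weights of the four values; up to scaling, the only linear relation between them is that
their sum vanishes. -/
def weight : Fin 4 → Fin 3 → ℤ := ![![1, 1, 1], ![1, -1, -1], ![-1, 1, -1], ![-1, -1, 1]]

theorem sum_properColumn {R : Type*} [CommRing R] (X : Fin 4 → R) :
    ∑ w : Fin 4 → Fin 4, (if IsProperColumn w then ∏ i, X (w i) else 0) =
      2 * ((X 0 + X 1 + X 2 + X 3) *
          (X 1 * X 2 * X 3 + X 0 * X 2 * X 3 + X 0 * X 1 * X 3 + X 0 * X 1 * X 2) +
        (X 0 * X 1 + X 0 * X 2 + X 0 * X 3 + X 1 * X 2 + X 1 * X 3 + X 2 * X 3) ^ 2 +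
        2 * (X 0 * X 1 * X 2 * X 3)) := by
  let e : (Fin 4 → Fin 4) ≃ Fin 4 × Fin 4 × Fin 4 × Fin 4 :=
    { toFun := fun w => (w 0, w 1, w 2, w 3)
      invFun := fun p => ![p.1, p.2.1, p.2.2.1, p.2.2.2]
      left_inv := fun w => by ext i; fin_cases i <;> rfl
      right_inv := fun p => rfl }
  rw [Fintype.sum_equiv e _ (fun p => if p.1 ≠ p.2.1 ∧ p.2.1 ≠ p.2.2.1 ∧ p.2.2.1 ≠ p.2.2.2 then
    X p.1 * X p.2.1 * X p.2.2.1 * X p.2.2.2 else 0) fun w => by rw [Fin.prod_univ_four]; rfl]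
  simp only [Fintype.sum_prod_type, Fin.sum_univ_four]
  simp
  ring

theorem prod_single_one {ι : Type*} (s : Finset ι) (v : ι → Fin 3 → ℤ) :
    ∏ i ∈ s, (single (v i) 1 : Laurent) = single (∑ i ∈ s, v i) 1 := by
  classical
  induction s using Finset.induction_on with
  | empty => simp [one_def]
  | insert i s hi ih => simp [Finset.prod_insert hi, Finset.sum_insert hi, ih, single_mul_single]

theorem single_eq_monom_mul (v : Fin 3 → ℤ) :
    (single v 1 : Laurent) = monom 0 (v 0) * monom 1 (v 1) * monom 2 (v 2) := by
  simp only [monom, single_mul_single, mul_one]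
  congr 1
  ext i
  fin_cases i <;> simp

theorem sum_single_properColumn :
    ∑ w : Fin 4 → Fin 4, (if IsProperColumn w then single (∑ i, weight (w i)) 1 else 0) =
      2 * halfColumn := by
  have h (i : Fin 3) : monom i 1 * monom i (-1) = 1 := by
    rw [monom_mul_monom]; exact monom_zero i
  have h2 (i : Fin 3) : cosVar i = monom i 1 ^ 2 + monom i (-1) ^ 2 := by
    rw [sq, sq, monom_mul_monom, monom_mul_monom]; rfl
  simp_rw [← prod_single_one]
  rw [sum_properColumn fun a => single (weight a) 1]
  simp only [single_eq_monom_mul, halfColumn, columnPoly, h2]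
  have h0 := h 0
  have h1 := h 1
  have h2 := h 2
  simp only [weight, Matrix.cons_val_zero, Matrix.cons_val_one, Matrix.cons_val]
  generalize monom 0 1 = a at *
  generalize monom 0 (-1) = a' at *
  generalize monom 1 1 = b at *
  generalize monom 1 (-1) = b' at *
  generalize monom 2 1 = c at *
  generalize monom 2 (-1) = c' at *
  grind

theorem sum_comp_eq_sum_card {ι M : Type*} [Fintype ι] [AddCommMonoid M] (A : ι → Fin 4)
    (g : Fin 4 → M) :
    ∑ p, g (A p) = ∑ v, (Finset.univ.filter fun p => A p = v).card • g v := by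
  rw [← Finset.sum_fiberwise (s := Finset.univ) (g := A)]
  refine Finset.sum_congr rfl fun v _ => ?_
  rw [Finset.sum_congr rfl fun p hp => by rw [(Finset.mem_filter.mp hp).2], Finset.sum_const]

theorem sum_weight_eq_zero_iff {n : ℕ} (A : Fin 4 × Fin n → Fin 4) :
    ∑ p, weight (A p) = 0 ↔ ∀ v, (Finset.univ.filter fun p => A p = v).card = n := by
  have hs := sum_comp_eq_sum_card A weight
  have hc := sum_comp_eq_sum_card A fun _ => 1
  simp only [Finset.sum_const, Finset.card_univ, Fintype.card_prod, Fintype.card_fin, smul_eq_mul,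
    mul_one, Fin.sum_univ_four] at hc
  rw [hs, Fin.forall_fin_succ]
  simp only [funext_iff, Fin.forall_fin_succ, Fin.sum_univ_four, weight]
  simp
  omega

/-- The `4 × n` arrays in which every value occurs exactly `n` times and vertically adjacent
entries differ. -/
abbrev IsBalancedProper {n : ℕ} (A : Fin 4 × Fin n → Fin 4) : Prop :=
  (∀ v : Fin 4, (Finset.filter (fun p => A p = v) Finset.univ).card = n) ∧
    (∀ (i : Fin 4) (j : Fin n), ∀ h : (i : ℕ) + 1 < 4,
      A (i, j) ≠ A (⟨(i : ℕ) + 1, h⟩, j))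

theorem forall_isProperColumn_iff {n : ℕ} (A : Fin 4 × Fin n → Fin 4) :
    (∀ j, IsProperColumn fun i => A (i, j)) ↔
      ∀ (i : Fin 4) (j : Fin n), ∀ h : (i : ℕ) + 1 < 4,
        A (i, j) ≠ A (⟨(i : ℕ) + 1, h⟩, j) := by
  constructor
  · intro H i j h
    obtain ⟨h0, h1, h2⟩ := H j
    fin_cases i
    · exact h0
    · exact h1
    · exact h2
    · simp at h
  · intro H j
    exact ⟨H 0 j (by decide), H 1 j (by decide), H 2 j (by decide)⟩

theorem card_isBalancedProper (n : ℕ) :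
    (Nat.card {A : Fin 4 × Fin n → Fin 4 // IsBalancedProper A} : ℤ) =
      2 ^ n * constTerm (halfColumn ^ n) := by
  classical
  let e : (Fin 4 × Fin n → Fin 4) ≃ (Fin n → Fin 4 → Fin 4) :=
    { toFun := fun A j i => A (i, j)
      invFun := fun f p => f p.2 p.1
      left_inv := fun A => rfl
      right_inv := fun f => rfl }
  have hcard : Nat.card {A : Fin 4 × Fin n → Fin 4 // IsBalancedProper A} =
      Nat.card {f : Fin n → Fin 4 → Fin 4 //
        (∀ j, IsProperColumn (f j)) ∧ ∑ j, ∑ i, weight (f j i) = 0} := by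
    refine Nat.card_congr (e.subtypeEquiv fun A => ?_)
    have hsum : ∑ j, ∑ i, weight (A (i, j)) = ∑ p, weight (A p) := by
      rw [Fintype.sum_prod_type_right]
    simp only [e, Equiv.coe_fn_mk, hsum, sum_weight_eq_zero_iff, forall_isProperColumn_iff]
    exact and_comm
  have hpow : constTerm ((2 * halfColumn) ^ n) = 2 ^ n * constTerm (halfColumn ^ n) := by
    rw [mul_pow, show (2 : Laurent) ^ n * halfColumn ^ n = (2 ^ n : ℤ) • halfColumn ^ n by
      rw [zsmul_eq_mul]; push_cast; rfl, map_smul, smul_eq_mul]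
  rw [hcard, ← hpow, ← sum_single_properColumn, Fintype.sum_pow, map_sum,
    Nat.card_eq_fintype_card, Fintype.card_subtype, ← Finset.sum_boole]
  refine Finset.sum_congr rfl fun f _ => ?_
  rw [Finset.prod_ite_zero, prod_single_one]
  by_cases h : ∀ j, IsProperColumn (f j)
  · rw [if_pos (fun j _ => h j), constTerm_single]
    exact if_congr (and_iff_right h) rfl rfl
  · rw [if_neg fun h' => h h'.1, if_neg fun h' => h fun j => h' j (Finset.mem_univ j), map_zero]

end Counting

section Canonical

variable {P : Type*} (key : P → ℕ)

/-- The first position, in the order given by `key`, of the value `v`. -/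
noncomputable def firstPos (A : P → Fin 4) (v : Fin 4) : ℕ := sInf (key '' {p | A p = v})

variable {key} {A : P → Fin 4}

theorem exists_key_eq_firstPos (hA : Function.Surjective A) (v : Fin 4) :
    ∃ p, A p = v ∧ key p = firstPos key A v := by
  obtain ⟨p, hp⟩ := hA v
  exact Nat.sInf_mem (s := key '' {p | A p = v}) ⟨_, p, hp, rfl⟩

theorem firstPos_le (p : P) : firstPos key A (A p) ≤ key p :=
  Nat.sInf_le ⟨p, rfl, rfl⟩

theorem firstPos_perm_comp (σ : Equiv.Perm (Fin 4)) (v : Fin 4) :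
    firstPos key (σ ∘ A) (σ v) = firstPos key A v := by
  simp [firstPos]

theorem strictMono_firstPos_iff (hA : Function.Surjective A) :
    StrictMono (firstPos key A) ↔
      ∀ p, 0 < (A p : ℕ) → ∃ q, key q < key p ∧ (A q : ℕ) = (A p : ℕ) - 1 := by
  constructor
  · intro h p hp
    obtain ⟨q, hq, hqk⟩ := exists_key_eq_firstPos (key := key) hA ⟨(A p : ℕ) - 1, by omega⟩
    refine ⟨q, ?_, by rw [hq]⟩
    rw [hqk]
    refine lt_of_lt_of_le (h ?_) (firstPos_le p)
    rw [Fin.lt_def]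
    exact Nat.sub_lt hp one_pos
  · intro h
    rw [Fin.strictMono_iff_lt_succ]
    intro i
    obtain ⟨p, hp, hpk⟩ := exists_key_eq_firstPos (key := key) hA i.succ
    obtain ⟨q, hq, hqA⟩ := h p (by simp [hp])
    have hqi : A q = i.castSucc := by
      ext
      simp [hqA, hp]
    rw [← hpk, ← hqi]
    exact (firstPos_le q).trans_lt hq

theorem firstPos_injective (hkey : Function.Injective key) (hA : Function.Surjective A) :
    Function.Injective (firstPos key A) := by
  intro v w h
  obtain ⟨p, hp, hpk⟩ := exists_key_eq_firstPos (key := key) hA v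
  obtain ⟨q, hq, hqk⟩ := exists_key_eq_firstPos (key := key) hA w
  rw [← hp, ← hq, hkey (hpk.trans (h.trans hqk.symm))]

theorem card_eq_mul_card_strictMono_firstPos (hkey : Function.Injective key)
    (S : (P → Fin 4) → Prop) (hS : ∀ A, S A → Function.Surjective A)
    (hperm : ∀ (σ : Equiv.Perm (Fin 4)) A, S A → S (σ ∘ A)) :
    Nat.card {A // S A} = 24 * Nat.card {A // S A ∧ StrictMono (firstPos key A)} := by
  have h24 : Nat.card (Equiv.Perm (Fin 4)) = 24 := by
    rw [Nat.card_eq_fintype_card, Fintype.card_perm, Fintype.card_fin]; rfl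
  rw [← h24, ← Nat.card_prod]
  symm
  let F : Equiv.Perm (Fin 4) × {A // S A ∧ StrictMono (firstPos key A)} → {A // S A} :=
    fun x => ⟨x.1 ∘ x.2.1, hperm x.1 _ x.2.2.1⟩
  refine Nat.card_congr (Equiv.ofBijective F ⟨?_, ?_⟩)
  · rintro ⟨σ, A, hA, hAm⟩ ⟨τ, B, hB, hBm⟩ h
    have hAB : σ ∘ A = τ ∘ B := congrArg Subtype.val h
    have hpos (v : Fin 4) : firstPos key A v = firstPos key B (τ.symm (σ v)) := by
      rw [← firstPos_perm_comp σ, hAB, ← firstPos_perm_comp τ (A := B), Equiv.apply_symm_apply]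
    have hrange : Set.range (firstPos key A) = Set.range (firstPos key B) := by
      have : firstPos key A = firstPos key B ∘ (σ.trans τ.symm) := funext hpos
      rw [this, (σ.trans τ.symm).surjective.range_comp]
    have heq := (StrictMono.range_inj hAm hBm).mp hrange
    have hστ : σ = τ := by
      ext1 v
      have := hpos v
      rw [heq] at this
      rw [← τ.symm_apply_eq, ← hBm.injective this]
    subst hστ
    have : A = B := funext fun p => σ.injective (congrFun hAB p)
    subst this
    rfl
  · rintro ⟨A, hA⟩
    let σ := Tuple.sort (firstPos key A)
    refine ⟨⟨σ, σ.symm ∘ A, hperm _ _ hA, ?_⟩, ?_⟩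
    · have h : firstPos key (σ.symm ∘ A) = firstPos key A ∘ σ := by
        ext v
        rw [Function.comp_apply, ← firstPos_perm_comp σ.symm (A := A), Equiv.symm_apply_apply]
      rw [h]
      exact (Tuple.monotone_sort _).strictMono_of_injective
        ((firstPos_injective hkey (hS A hA)).comp σ.injective)
    · apply Subtype.ext
      funext p
      exact σ.apply_symm_apply (A p)

end Canonical

theorem rowMajor_lt_iff {n : ℕ} (p q : Fin 4 × Fin n) :
    (q.1 : ℕ) * n + q.2 < p.1 * n + p.2 ↔
      (q.1 : ℕ) < p.1 ∨ (q.1 = p.1 ∧ (q.2 : ℕ) < p.2) := by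
  have hp := p.2.isLt
  have hq := q.2.isLt
  rw [Fin.ext_iff]
  rcases lt_trichotomy (q.1 : ℕ) p.1 with h | h | h
  · have := Nat.mul_le_mul_right n (Nat.succ_le_of_lt h)
    rw [Nat.succ_mul] at this
    exact iff_of_true (by omega) (Or.inl h)
  · rw [h]; omega
  · have := Nat.mul_le_mul_right n (Nat.succ_le_of_lt h)
    rw [Nat.succ_mul] at this
    omega

theorem rowMajor_injective_s9 (n : ℕ) :
    Function.Injective fun p : Fin 4 × Fin n => (p.1 : ℕ) * n + p.2 := by
  intro p q h
  have h1 := (rowMajor_lt_iff p q).not.mp h.not_gt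
  have h2 := (rowMajor_lt_iff q p).not.mp h.not_lt
  rw [Fin.ext_iff] at h1 h2
  ext <;> omega

theorem card_isBalancedProper_eq_mul {n : ℕ} (hn : 1 ≤ n) :
    Nat.card {A : Fin 4 × Fin n → Fin 4 // IsBalancedProper A} = 24 * a265234 n := by
  have hsurj (A : Fin 4 × Fin n → Fin 4) (hA : IsBalancedProper A) : Function.Surjective A := by
    intro v
    have : 0 < (Finset.filter (fun p => A p = v) Finset.univ).card := by rw [hA.1 v]; exact hn
    obtain ⟨p, hp⟩ := Finset.card_pos.mp this
    exact ⟨p, (Finset.mem_filter.mp hp).2⟩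
  rw [card_eq_mul_card_strictMono_firstPos (rowMajor_injective_s9 n) _ hsurj]
  · congr 1
    refine Nat.card_congr (Equiv.subtypeEquivRight fun A => ?_)
    rw [← and_assoc]
    refine and_congr_right fun hA => ?_
    simp only [strictMono_firstPos_iff (hsurj A hA), rowMajor_lt_iff]
  · rintro σ A ⟨h1, h2⟩
    refine ⟨fun v => ?_, fun i j h => σ.injective.ne (h2 i j h)⟩
    refine Eq.trans ?_ (h1 (σ.symm v))
    simp [Equiv.eq_symm_apply]

theorem natDegree_hornerEval_le {x : Polynomial ℤ} (hx : x.natDegree ≤ 1) (l : List ℤ) :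
    (hornerEval x l).natDegree ≤ l.length - 1 := by
  induction l with
  | nil => simp [hornerEval]
  | cons c l ih =>
    rw [hornerEval_cons]
    rcases l with _ | ⟨d, l⟩
    · simp [hornerEval]
    · refine (Polynomial.natDegree_add_le _ _).trans (max_le (by simp) ?_)
      refine Polynomial.natDegree_mul_le.trans ?_
      simp only [List.length_cons] at ih ⊢
      omega

theorem eval_hornerEval (x : Polynomial ℤ) (n : ℤ) (l : List ℤ) :
    (hornerEval x l).eval n = hornerEval (x.eval n) l := by
  induction l with
  | nil => simp [hornerEval]
  | cons c l ih => simp [hornerEval_cons, ih]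

/-- There are polynomials `p₀, …, p₆ ∈ ℤ[x]`, each of degree at most `6` and with
`p₆ ≠ 0`, such that `p₀(n)·a(n) + ⋯ + p₆(n)·a(n+6) = 0` for all `n ≥ 1`;
in particular `a265234` is D-finite. -/
theorem stmt9 :
    ∃ p : Fin 7 → Polynomial ℤ,
      (∀ i, (p i).degree ≤ 6) ∧ p 6 ≠ 0 ∧
      ∀ n : ℕ, 1 ≤ n →
        ∑ i : Fin 7, (p i).eval (n : ℤ) * (a265234 (n + (i : ℕ)) : ℤ) = 0 := by
  refine ⟨fun i => Polynomial.C (2 ^ (6 - (i : ℕ))) *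
    hornerEval (Polynomial.X + 1) (recurrenceCoeffs i), fun i => ?_, fun h => ?_, fun n hn => ?_⟩
  · refine Polynomial.degree_le_of_natDegree_le ((Polynomial.natDegree_C_mul_le _ _).trans
      ((natDegree_hornerEval_le (Polynomial.natDegree_X_add_C (1 : ℤ)).le _).trans ?_))
    fin_cases i <;> decide
  · have := congrArg (Polynomial.eval 0) h
    rw [Polynomial.eval_mul, eval_hornerEval] at this
    norm_num [hornerEval, recurrenceCoeffs] at this
  · have ha (k : ℕ) : 24 * (a265234 (n + k) : ℤ) =
        2 ^ (n + k) * constTerm (halfColumn ^ (n + k)) := by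
      rw [← card_isBalancedProper, card_isBalancedProper_eq_mul (by omega)]
      push_cast
      rfl
    have h24 : (24 : ℤ) ≠ 0 := by norm_num
    refine (mul_eq_zero.mp ?_).resolve_left h24
    refine (congrArg (24 * ·) (Finset.sum_range fun k => (Polynomial.C ((2 : ℤ) ^ (6 - k)) *
      hornerEval (Polynomial.X + 1) (recurrenceCoeffs k)).eval (n : ℤ) *
        (a265234 (n + k) : ℤ)).symm).trans ?_
    simp only [Finset.mul_sum]
    have h := congrArg (2 ^ (n + 6) * ·) (sum_recurrence_mul_constTerm n)
    simp only [mul_zero, Finset.mul_sum] at h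
    rw [← h]
    refine Finset.sum_congr rfl fun k hk => ?_
    have hk6 : n + 6 = (6 - k) + (n + k) := by
      have := Finset.mem_range.mp hk
      omega
    rw [mul_left_comm, ha, hk6, pow_add 2 (6 - k), Polynomial.eval_mul, Polynomial.eval_C,
      eval_hornerEval]
    simp only [Polynomial.eval_add, Polynomial.eval_X, Polynomial.eval_one]
    ring
end
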